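/- Let $\Omega\subset\mathbb R^N$ be a bounded domain with smooth boundary, let $1<p<\infty$ and $1\le q<p_*$, where $p_*=p(N-1)/(N-p)$ if $p<N$ and $p_*=\infty$ if $p\ge N$, and let $\mathcal H^{N-1}$ be the $(N-1)$-dimensional Hausdorff measure. For an $\mathcal H^{N-1}$-measurable set $\Gamma\subset\partial\Omega$ let $\mathcal X_\Gamma$ be the set of all $u\in W^{1,p}(\Omega)\setminus W^{1,p}_0(\Omega)$ whose trace on $\partial\Omega$ vanishes $\mathcal H^{N-1}$-a.e. on $\Gamma$, and let $$S(\Gamma):=\inf_{u\in\mathcal X_\Gamma}\frac{\int_\Omega|\nabla u|^p+|u|^p\,dx}{\left(\int_{\partial\Omega}|u|^q\,d\mathcal H^{N-1}\right)^{p/q}},$$ where the boundary integral is that of the trace of $u$. If $\mathcal X_\Gamma\neq\emptyset$, then the infimum defining $S(\Gamma)$ is attained, i.e. there exists $u\in\mathcal X_\Gamma$ with $0<\int_{\partial\Omega}|u|^q\,d\mathcal H^{N-1}<\infty$ and $$S(\Gamma)=\frac{\int_\Omega|\nabla u|^p+|u|^p\,dx}{\left(\int_{\partial\Omega}|u|^q\,d\mathcal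 H^{N-1}\right)^{p/q}}.$$ Moreover, $\mathcal X_\Gamma\neq\emptyset$ whenever $\mathcal H^{N-1}(\overline\Gamma)<\mathcal H^{N-1}(\partial\Omega)$; in particular the infimum is attained for every closed $\Gamma\subset\partial\Omega$ with $\mathcal H^{N-1}(\Gamma)<\mathcal H^{N-1}(\partial\Omega)$. -/

import Mathlib

open MeasureTheory Set Filter Bornology
open scoped ENNReal Topology ContDiff RealInnerProductSpace

noncomputable section

/-- `g` is the weak (distributional) gradient of `u` in the open set `Ω`. -/
def IsWeakGradient {N : ℕ} (Ω : Set (EuclideanSpace ℝ (Fin N)))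
    (u : EuclideanSpace ℝ (Fin N) → ℝ)
    (g : EuclideanSpace ℝ (Fin N) → EuclideanSpace ℝ (Fin N)) : Prop :=
  ∀ φ : EuclideanSpace ℝ (Fin N) → ℝ, ContDiff ℝ ∞ φ → HasCompactSupport φ → tsupport φ ⊆ Ω →
    ∀ v : EuclideanSpace ℝ (Fin N),
      ∫ x in Ω, u x * fderiv ℝ φ x v = - ∫ x in Ω, φ x * ⟪g x, v⟫

/-- `u ∈ W^{1,p}(Ω)`, with weak gradient `g` (which is unique up to a null set). -/
def MemW1p {N : ℕ} (Ω : Set (EuclideanSpace ℝ (Fin N))) (p : ℝ)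
    (u : EuclideanSpace ℝ (Fin N) → ℝ)
    (g : EuclideanSpace ℝ (Fin N) → EuclideanSpace ℝ (Fin N)) : Prop :=
  MemLp u (ENNReal.ofReal p) (volume.restrict Ω) ∧
    MemLp g (ENNReal.ofReal p) (volume.restrict Ω) ∧
    IsWeakGradient Ω u g

/-- The smooth functions `φ n` converge in `W^{1,p}(Ω)` to the function `u` with gradient `g`. -/
def TendstoW1p {N : ℕ} (Ω : Set (EuclideanSpace ℝ (Fin N))) (p : ℝ)
    (φ : ℕ → EuclideanSpace ℝ (Fin N) → ℝ)
    (u : EuclideanSpace ℝ (Fin N) → ℝ)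
    (g : EuclideanSpace ℝ (Fin N) → EuclideanSpace ℝ (Fin N)) : Prop :=
  Tendsto (fun n => eLpNorm (fun x => φ n x - u x) (ENNReal.ofReal p) (volume.restrict Ω))
      atTop (𝓝 0) ∧
    Tendsto
      (fun n => eLpNorm (fun x => gradient (φ n) x - g x) (ENNReal.ofReal p) (volume.restrict Ω))
      atTop (𝓝 0)

/-- `u ∈ W^{1,p}_0(Ω)`: the closure of `C_c^∞(Ω)` in `W^{1,p}(Ω)`. -/
def MemW1p0 {N : ℕ} (Ω : Set (EuclideanSpace ℝ (Fin N))) (p : ℝ)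
    (u : EuclideanSpace ℝ (Fin N) → ℝ)
    (g : EuclideanSpace ℝ (Fin N) → EuclideanSpace ℝ (Fin N)) : Prop :=
  MemW1p Ω p u g ∧
    ∃ φ : ℕ → EuclideanSpace ℝ (Fin N) → ℝ,
      (∀ n, ContDiff ℝ ∞ (φ n) ∧ HasCompactSupport (φ n) ∧ tsupport (φ n) ⊆ Ω) ∧
      TendstoW1p Ω p φ u g

/-- The surface measure: `H^{N-1}` restricted to `∂Ω`. -/
def bdryMeasure {N : ℕ} (Ω : Set (EuclideanSpace ℝ (Fin N))) :
    Measure (EuclideanSpace ℝ (Fin N)) :=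
  (μH[(N : ℝ) - 1]).restrict (frontier Ω)

/-- `t` is the Sobolev trace on `∂Ω` of `u` (with weak gradient `g`): the value at `u` of the
continuous extension to `W^{1,p}(Ω)`, with values in `L^p(∂Ω, H^{N-1})`, of the restriction
`φ ↦ φ|_{∂Ω}` of functions that are smooth up to the boundary. -/
def IsTrace {N : ℕ} (Ω : Set (EuclideanSpace ℝ (Fin N))) (p : ℝ)
    (u : EuclideanSpace ℝ (Fin N) → ℝ)
    (g : EuclideanSpace ℝ (Fin N) → EuclideanSpace ℝ (Fin N))
    (t : EuclideanSpace ℝ (Fin N) → ℝ) : Prop :=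
  MemLp t (ENNReal.ofReal p) (bdryMeasure Ω) ∧
    ∃ φ : ℕ → EuclideanSpace ℝ (Fin N) → ℝ,
      (∀ n, ContDiff ℝ ∞ (φ n)) ∧ TendstoW1p Ω p φ u g ∧
      Tendsto (fun n => eLpNorm (fun x => φ n x - t x) (ENNReal.ofReal p) (bdryMeasure Ω))
        atTop (𝓝 0)

/-- `u ∈ X_Γ`, where `g` is the weak gradient of `u` and `t` its trace on `∂Ω`:
`u ∈ W^{1,p}(Ω) \ W^{1,p}_0(Ω)` and `t = 0` holds `H^{N-1}`-a.e. on `Γ`. -/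
def MemXGamma {N : ℕ} (Ω : Set (EuclideanSpace ℝ (Fin N))) (p : ℝ)
    (Γ : Set (EuclideanSpace ℝ (Fin N)))
    (u : EuclideanSpace ℝ (Fin N) → ℝ)
    (g : EuclideanSpace ℝ (Fin N) → EuclideanSpace ℝ (Fin N))
    (t : EuclideanSpace ℝ (Fin N) → ℝ) : Prop :=
  MemW1p Ω p u g ∧ ¬ MemW1p0 Ω p u g ∧ IsTrace Ω p u g t ∧
    ∀ᵐ x ∂(μH[(N : ℝ) - 1] : Measure (EuclideanSpace ℝ (Fin N))), x ∈ Γ → t x = 0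

/-- `∫_Ω |∇u|^p + |u|^p dx`. -/
def sobolevEnergy {N : ℕ} (Ω : Set (EuclideanSpace ℝ (Fin N))) (p : ℝ)
    (u : EuclideanSpace ℝ (Fin N) → ℝ)
    (g : EuclideanSpace ℝ (Fin N) → EuclideanSpace ℝ (Fin N)) : ℝ≥0∞ :=
  ∫⁻ x in Ω, (‖g x‖ₑ ^ p + ‖u x‖ₑ ^ p)

/-- `∫_{∂Ω} |t|^q dH^{N-1}`. -/
def bdryLqPow {N : ℕ} (Ω : Set (EuclideanSpace ℝ (Fin N))) (q : ℝ)
    (t : EuclideanSpace ℝ (Fin N) → ℝ) : ℝ≥0∞ :=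
  ∫⁻ x, ‖t x‖ₑ ^ q ∂(bdryMeasure Ω)

/-- The Rayleigh quotient, in `[0, ∞]`. -/
def rayleighQuot {N : ℕ} (Ω : Set (EuclideanSpace ℝ (Fin N))) (p q : ℝ)
    (u : EuclideanSpace ℝ (Fin N) → ℝ)
    (g : EuclideanSpace ℝ (Fin N) → EuclideanSpace ℝ (Fin N))
    (t : EuclideanSpace ℝ (Fin N) → ℝ) : ℝ≥0∞ :=
  sobolevEnergy Ω p u g / (bdryLqPow Ω q t) ^ (p / q)

/-- `S(Γ)`, the infimum in `[0, ∞]` of the Rayleigh quotient over `X_Γ`. -/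
def traceConst {N : ℕ} (Ω : Set (EuclideanSpace ℝ (Fin N))) (p q : ℝ)
    (Γ : Set (EuclideanSpace ℝ (Fin N))) : ℝ≥0∞ :=
  sInf {r | ∃ u g t, MemXGamma Ω p Γ u g t ∧ r = rayleighQuot Ω p q u g t}

/-- `Ω` has a smooth boundary: it is the sublevel set of a smooth function whose zero set is `∂Ω`
and whose gradient vanishes nowhere on `∂Ω`. -/
def HasSmoothBoundary {N : ℕ} (Ω : Set (EuclideanSpace ℝ (Fin N))) : Prop :=
  ∃ f : EuclideanSpace ℝ (Fin N) → ℝ, ContDiff ℝ ∞ f ∧ Ω = {x | f x < 0} ∧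
    frontier Ω = {x | f x = 0} ∧ ∀ x ∈ frontier Ω, gradient f x ≠ 0

/-- `q < p_*`, where `p_* = p (N - 1) / (N - p)` if `p < N` and `p_* = ∞` otherwise. -/
def SubcriticalTrace (N : ℕ) (p q : ℝ) : Prop :=
  p < N → q < p * (N - 1) / (N - p)

end

/-! ### Geometry of a compact regular level set -/

section Geometry

open Metric

theorem exists_orthogonal_splitting {n : ℕ} (v : EuclideanSpace ℝ (Fin (n + 1))) (hv : v ≠ 0) :
    ∃ (P : EuclideanSpace ℝ (Fin (n + 1)) →L[ℝ] EuclideanSpace ℝ (Fin n))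
      (Q : EuclideanSpace ℝ (Fin n) →ₗᵢ[ℝ] EuclideanSpace ℝ (Fin (n + 1))),
      (∀ x, P (Q x) = x) ∧ P v = 0 ∧ (∀ x, ⟪v, Q x⟫ = 0) ∧ (∀ x, ‖P x‖ ≤ ‖x‖) ∧
      ∀ x, x = Q (P x) + (⟪v, x⟫ / ‖v‖ ^ 2) • v := by
  have hfr : Module.finrank ℝ (ℝ ∙ v)ᗮ = n := by
    have : Fact (Module.finrank ℝ (EuclideanSpace ℝ (Fin (n + 1))) = n + 1) := ⟨by simp⟩
    exact Submodule.finrank_orthogonal_span_singleton hv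
  let K := (ℝ ∙ v)ᗮ
  let L : K ≃ₗᵢ[ℝ] EuclideanSpace ℝ (Fin n) :=
    ((stdOrthonormalBasis ℝ K).reindex (finCongr hfr)).repr
  refine ⟨L.toContinuousLinearEquiv.toContinuousLinearMap.comp K.orthogonalProjectionOnto,
    K.subtypeₗᵢ.comp L.symm.toLinearIsometry, ?_, ?_, ?_, ?_, ?_⟩
  · intro x
    simp
  · have : K.orthogonalProjectionOnto v = 0 := by
      apply Submodule.orthogonalProjectionOnto_orthogonal_apply_eq_zero
      exact Submodule.mem_span_singleton_self v
    simp [this]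
  · intro x
    have := (L.symm x).2
    exact Submodule.mem_orthogonal_singleton_iff_inner_right.1 this
  · intro x
    simpa using K.norm_orthogonalProjectionOnto_apply_le x
  · intro x
    have h1 := Submodule.starProjection_add_starProjection_orthogonal (K := ℝ ∙ v) x
    rw [Submodule.starProjection_singleton] at h1
    simp only [ContinuousLinearMap.coe_comp, Function.comp_apply, LinearIsometry.coe_comp,
      Submodule.coe_subtypeₗᵢ, LinearIsometryEquiv.coe_toLinearIsometry]
    refine h1.symm.trans ((add_comm _ _).trans ?_)
    congr 1
    simp [K]

theorem continuous_gradient {N : ℕ} {f : EuclideanSpace ℝ (Fin N) → ℝ} (hf : ContDiff ℝ 1 f) :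
    Continuous (gradient f) :=
  (InnerProductSpace.toDual ℝ _).symm.continuous.comp (hf.continuous_fderiv one_ne_zero)

theorem norm_gradient {N : ℕ} (f : EuclideanSpace ℝ (Fin N) → ℝ) (x : EuclideanSpace ℝ (Fin N)) :
    ‖gradient f x‖ = ‖fderiv ℝ f x‖ := by
  simp [gradient]

theorem exists_forall_norm_gradient_sub_lt {N : ℕ} {f : EuclideanSpace ℝ (Fin N) → ℝ}
    (hf : ContDiff ℝ 1 f) {S : Set (EuclideanSpace ℝ (Fin N))} (hS : IsCompact S) {ε : ℝ}
    (hε : 0 < ε) :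
    ∃ δ > 0, ∀ x ∈ S, ∀ y ∈ ball x δ, ‖gradient f y - gradient f x‖ < ε := by
  have h := hS.uniformContinuousAt_of_continuousAt (gradient f)
    (fun x _ => (continuous_gradient hf).continuousAt) (dist_mem_uniformity hε)
  obtain ⟨δ, hδ, h⟩ := mem_uniformity_dist.1 h
  refine ⟨δ, hδ, fun x hx y hy => ?_⟩
  have := h (a := x) (b := y) (by rw [dist_comm]; exact hy) hx
  rw [← dist_eq_norm, dist_comm]
  exact this

theorem exists_uniform_linearization {N : ℕ} {f : EuclideanSpace ℝ (Fin N) → ℝ}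
    (hf : ContDiff ℝ 1 f) {S : Set (EuclideanSpace ℝ (Fin N))} (hS : IsCompact S) {ε : ℝ}
    (hε : 0 < ε) :
    ∃ δ > 0, ∀ x ∈ S, ∀ y ∈ ball x δ, ∀ z ∈ ball x δ,
      |f y - f z - ⟪gradient f x, y - z⟫| ≤ ε * ‖y - z‖ := by
  obtain ⟨δ, hδ, h⟩ := exists_forall_norm_gradient_sub_lt hf hS hε
  refine ⟨δ, hδ, fun x hx y hy z hz => ?_⟩
  have := (convex_ball x δ).norm_image_sub_le_of_norm_fderiv_le' (𝕜 := ℝ) (f := f)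
    (φ := fderiv ℝ f x) (C := ε)
    (fun w _ => (hf.differentiable one_ne_zero).differentiableAt) (fun w hw => ?_) hz hy
  · rwa [inner_gradient_left, ← Real.norm_eq_abs]
  · have := (h x hx w hw).le
    rwa [gradient, gradient, ← map_sub, LinearIsometryEquiv.norm_map] at this

theorem exists_pos_le_norm_gradient {N : ℕ} {f : EuclideanSpace ℝ (Fin N) → ℝ}
    (hf : ContDiff ℝ 1 f) {S : Set (EuclideanSpace ℝ (Fin N))} (hS : IsCompact S)
    (h0 : ∀ x ∈ S, gradient f x ≠ 0) : ∃ c > 0, ∀ x ∈ S, c ≤ ‖gradient f x‖ := by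
  rcases S.eq_empty_or_nonempty with rfl | hne
  · exact ⟨1, one_pos, by simp⟩
  · obtain ⟨x, hx, hmin⟩ := hS.exists_isMinOn hne (continuous_gradient hf).norm.continuousOn
    exact ⟨_, norm_pos_iff.2 (h0 x hx), fun y hy => hmin hy⟩

/-- The `n`-dimensional Hausdorff measure of the Euclidean unit ball of dimension `n`. -/
noncomputable def unitBallHausdorff (n : ℕ) : ℝ≥0∞ :=
  μH[(n : ℝ)] (ball (0 : EuclideanSpace ℝ (Fin n)) 1)

theorem isAddHaarMeasure_hausdorffMeasure_euclidean (n : ℕ) :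
    (μH[(n : ℝ)] : Measure (EuclideanSpace ℝ (Fin n))).IsAddHaarMeasure := by
  simpa using MeasureTheory.isAddHaarMeasure_hausdorffMeasure (E := EuclideanSpace ℝ (Fin n))

theorem unitBallHausdorff_pos (n : ℕ) : 0 < unitBallHausdorff n := by
  have := isAddHaarMeasure_hausdorffMeasure_euclidean n
  exact isOpen_ball.measure_pos _ ⟨0, mem_ball_self one_pos⟩

theorem unitBallHausdorff_lt_top (n : ℕ) : unitBallHausdorff n < ⊤ := by
  have := isAddHaarMeasure_hausdorffMeasure_euclidean n
  exact measure_ball_lt_top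

theorem hausdorffMeasure_euclidean_ball (n : ℕ) (y : EuclideanSpace ℝ (Fin n)) {τ : ℝ}
    (hτ : 0 < τ) :
    μH[(n : ℝ)] (ball y τ) = ENNReal.ofReal (τ ^ n) * unitBallHausdorff n := by
  have := isAddHaarMeasure_hausdorffMeasure_euclidean n
  rw [Measure.addHaar_ball_of_pos _ _ hτ, unitBallHausdorff]
  simp

theorem hausdorffMeasure_levelSet_inter_ball_le {n : ℕ}
    {f : EuclideanSpace ℝ (Fin (n + 1)) → ℝ} {S : Set (EuclideanSpace ℝ (Fin (n + 1)))}
    (hS : S = {x | f x = 0}) {x v : EuclideanSpace ℝ (Fin (n + 1))} (hv : v ≠ 0) {δ : ℝ}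
    (hlin : ∀ y ∈ ball x δ, ∀ z ∈ ball x δ, |f y - f z - ⟪v, y - z⟫| ≤ ‖v‖ / 2 * ‖y - z‖)
    {τ : ℝ} (hτ : 0 < τ) (hτδ : τ ≤ δ) :
    μH[(n : ℝ)] (S ∩ ball x τ) ≤ 2 ^ n * (ENNReal.ofReal (τ ^ n) * unitBallHausdorff n) := by
  obtain ⟨P, Q, -, -, -, hPle, hdec⟩ := exists_orthogonal_splitting v hv
  have hv0 : 0 < ‖v‖ := norm_pos_iff.2 hv
  set s := S ∩ ball x τ with hs
  have hanti : ∀ y ∈ s, ∀ z ∈ s, ‖y - z‖ ≤ 2 * ‖P y - P z‖ := by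
    intro y hy z hz
    have h1 := hlin y (ball_subset_ball hτδ hy.2) z (ball_subset_ball hτδ hz.2)
    have hy0 : f y = 0 := by have := hy.1; rw [hS] at this; exact this
    have hz0 : f z = 0 := by have := hz.1; rw [hS] at this; exact this
    rw [hy0, hz0, sub_zero, zero_sub, abs_neg] at h1
    have h2 : ‖y - z‖ ≤ ‖P (y - z)‖ + |⟪v, y - z⟫| / ‖v‖ := by
      calc ‖y - z‖ = ‖Q (P (y - z)) + (⟪v, y - z⟫ / ‖v‖ ^ 2) • v‖ := by rw [← hdec]
        _ ≤ ‖Q (P (y - z))‖ + ‖(⟪v, y - z⟫ / ‖v‖ ^ 2) • v‖ := norm_add_le _ _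
        _ = _ := by
          rw [Q.norm_map, norm_smul, Real.norm_eq_abs, abs_div, abs_of_pos (pow_pos hv0 2)]
          field_simp
    have h3 : |⟪v, y - z⟫| / ‖v‖ ≤ ‖y - z‖ / 2 := by
      rw [div_le_iff₀ hv0]; linarith
    rw [map_sub] at h2
    linarith
  set g := Function.invFunOn P s
  have hg : ∀ k ∈ P '' s, g k ∈ s ∧ P (g k) = k := fun k hk => Function.invFunOn_pos hk
  have hlip : LipschitzOnWith 2 g (P '' s) := by
    apply LipschitzOnWith.of_dist_le_mul
    intro k hk l hl
    have := hanti _ (hg k hk).1 _ (hg l hl).1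
    rw [(hg k hk).2, (hg l hl).2] at this
    simpa [dist_eq_norm] using this
  have hsub : s ⊆ g '' (P '' s) := by
    intro y hy
    have hk : P y ∈ P '' s := mem_image_of_mem P hy
    refine ⟨P y, hk, ?_⟩
    have := hanti _ (hg _ hk).1 _ hy
    rw [(hg _ hk).2, sub_self, norm_zero, mul_zero] at this
    exact sub_eq_zero.1 (norm_le_zero_iff.1 this)
  have hPs : P '' s ⊆ ball (P x) τ := by
    rintro _ ⟨y, hy, rfl⟩
    rw [mem_ball, dist_eq_norm, ← map_sub]
    exact (hPle _).trans_lt (by simpa [dist_eq_norm] using hy.2)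
  calc μH[(n : ℝ)] s ≤ μH[(n : ℝ)] (g '' (P '' s)) := measure_mono hsub
    _ ≤ ((2 : NNReal) : ℝ≥0∞) ^ (n : ℝ) * μH[(n : ℝ)] (P '' s) :=
      hlip.hausdorffMeasure_image_le (Nat.cast_nonneg n)
    _ ≤ 2 ^ n * μH[(n : ℝ)] (ball (P x) τ) := by
      rw [ENNReal.rpow_natCast]
      gcongr
      simp
    _ = _ := by rw [hausdorffMeasure_euclidean_ball n _ hτ]

theorem le_hausdorffMeasure_levelSet_inter_ball {n : ℕ}
    {f : EuclideanSpace ℝ (Fin (n + 1)) → ℝ} (hf : Continuous f)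
    {S : Set (EuclideanSpace ℝ (Fin (n + 1)))}
    (hS : S = {x | f x = 0}) {x v : EuclideanSpace ℝ (Fin (n + 1))} (hx : x ∈ S) (hv : v ≠ 0)
    {δ : ℝ}
    (hlin : ∀ y ∈ ball x δ, ∀ z ∈ ball x δ, |f y - f z - ⟪v, y - z⟫| ≤ ‖v‖ / 2 * ‖y - z‖)
    {τ : ℝ} (hτ : 0 < τ) (hτδ : τ ≤ δ) :
    ENNReal.ofReal ((τ / 4) ^ n) * unitBallHausdorff n ≤ μH[(n : ℝ)] (S ∩ ball x τ) := by
  obtain ⟨P, Q, hPQ, hPv, hQv, hPle, hdec⟩ := exists_orthogonal_splitting v hv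
  have hv0 : 0 < ‖v‖ := norm_pos_iff.2 hv
  have hx0 : f x = 0 := by rw [hS] at hx; exact hx
  have hsub : ball (P x) (τ / 4) ⊆ P '' (S ∩ ball x τ) := by
    intro k hk
    set k' := k - P x
    have hk' : ‖k'‖ < τ / 4 := by rwa [mem_ball, dist_eq_norm] at hk
    let γ : ℝ → EuclideanSpace ℝ (Fin (n + 1)) := fun s => x + (Q k' + (s / ‖v‖) • v)
    have hγc : Continuous γ := by fun_prop
    have hγn : ∀ s, ‖γ s - x‖ ≤ ‖k'‖ + |s| := by
      intro s
      simp only [γ, add_sub_cancel_left]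
      refine (norm_add_le _ _).trans ?_
      rw [Q.norm_map, norm_smul, Real.norm_eq_abs, abs_div, abs_norm,
        div_mul_cancel₀ _ hv0.ne']
    have hγb : ∀ s, |s| ≤ τ / 2 → γ s ∈ ball x τ := by
      intro s hs
      rw [mem_ball, dist_eq_norm]
      linarith [hγn s]
    have hγf : ∀ s, |s| ≤ τ / 2 → |f (γ s) - s * ‖v‖| ≤ ‖v‖ / 2 * (‖k'‖ + |s|) := by
      intro s hs
      have h1 := hlin (γ s) (ball_subset_ball hτδ (hγb s hs)) x
        (mem_ball_self (hτ.trans_le hτδ))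
      have h2 : ⟪v, γ s - x⟫ = s * ‖v‖ := by
        simp only [γ, add_sub_cancel_left, inner_add_right, hQv, inner_smul_right,
          real_inner_self_eq_norm_sq]
        field_simp
        simp
      rw [hx0, sub_zero, h2] at h1
      exact h1.trans (by gcongr; exact hγn s)
    have hlo : f (γ (-(τ / 2))) ≤ 0 := by
      have := (abs_le.1 (hγf (-(τ / 2)) (by rw [abs_neg, abs_of_pos (by linarith)]))).2
      rw [abs_neg, abs_of_pos (by linarith)] at this
      nlinarith
    have hhi : 0 ≤ f (γ (τ / 2)) := by
      have := (abs_le.1 (hγf (τ / 2) (by rw [abs_of_pos (by linarith)]))).1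
      rw [abs_of_pos (by linarith)] at this
      nlinarith
    obtain ⟨s, hs, hfs⟩ := intermediate_value_Icc (by linarith : -(τ / 2) ≤ τ / 2)
      (hf.comp hγc).continuousOn (show (0 : ℝ) ∈ Icc _ _ from ⟨hlo, hhi⟩)
    refine ⟨γ s, ⟨by rw [hS]; exact hfs, hγb s (abs_le.2 hs)⟩, ?_⟩
    simp only [γ, map_add, hPQ, map_smul, hPv, smul_zero, add_zero, k']
    abel
  have hlip : LipschitzOnWith 1 P (S ∩ ball x τ) := by
    apply LipschitzOnWith.of_dist_le_mul
    intro y _ z _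
    rw [dist_eq_norm, dist_eq_norm, ← map_sub]
    simpa using hPle (y - z)
  calc ENNReal.ofReal ((τ / 4) ^ n) * unitBallHausdorff n
      = μH[(n : ℝ)] (ball (P x) (τ / 4)) :=
        (hausdorffMeasure_euclidean_ball n _ (by positivity)).symm
    _ ≤ μH[(n : ℝ)] (P '' (S ∩ ball x τ)) := measure_mono hsub
    _ ≤ ((1 : NNReal) : ℝ≥0∞) ^ (n : ℝ) * μH[(n : ℝ)] (S ∩ ball x τ) :=
      hlip.hausdorffMeasure_image_le (Nat.cast_nonneg n)
    _ = _ := by simp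

end Geometry

section Collar

open Metric

/-- Quantitative description of a smooth bounded domain `Ω = {f < 0}` near its boundary: the
segments leaving `x ∈ ∂Ω` in the directions opposite to `∇f x + d`, `‖d‖ < r`, enter `Ω` at
linear speed, and the surface measure is comparable with the `(N-1)`-dimensional volume. -/
structure IsCollar {N : ℕ} (Ω : Set (EuclideanSpace ℝ (Fin N)))
    (f : EuclideanSpace ℝ (Fin N) → ℝ) (r δ c M L : ℝ) : Prop where
  contDiff : ContDiff ℝ ∞ f
  eq_sublevel : Ω = {x | f x < 0}
  r_pos : 0 < r
  δ_pos : 0 < δ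
  c_pos : 0 < c
  M_pos : 0 < M
  L_pos : 0 < L
  norm_le : ∀ x ∈ frontier Ω, ∀ d, ‖d‖ < r → ‖gradient f x + d‖ ≤ M
  le_neg : ∀ x ∈ frontier Ω, ∀ d, ‖d‖ < r → ∀ τ, 0 < τ → τ < δ →
    c * τ ≤ -f (x - τ • (gradient f x + d))
  neg_le : ∀ x ∈ frontier Ω, ∀ d, ‖d‖ < r → ∀ τ, 0 < τ → τ < δ →
    -f (x - τ • (gradient f x + d)) ≤ M * τ
  ball_le : ∀ y τ, 0 < τ → τ < δ → bdryMeasure Ω (ball y (2 * M * τ)) ≤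
    ENNReal.ofReal (L * (τ ^ N / τ))
  density : ∀ w ∈ Ω, ∀ a, 0 < a → a < δ → -f w < c * a → ∃ s, 0 < s ∧ (1 + c) * s ≤ a ∧
    ∀ τ ∈ Icc s ((1 + c) * s),
      ENNReal.ofReal (c * (τ ^ N / τ)) ≤ bdryMeasure Ω {x | ‖x - w - τ • gradient f x‖ < r * τ}
  finite : bdryMeasure Ω univ < ⊤

theorem bdryMeasure_apply {N : ℕ} (Ω s : Set (EuclideanSpace ℝ (Fin N))) :
    bdryMeasure Ω s = μH[(N : ℝ) - 1] (frontier Ω ∩ s) := by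
  rw [bdryMeasure, Measure.restrict_apply' isClosed_frontier.measurableSet, inter_comm]

theorem ae_mem_frontier {N : ℕ} (Ω : Set (EuclideanSpace ℝ (Fin N))) :
    ∀ᵐ x ∂(bdryMeasure Ω), x ∈ frontier Ω :=
  ae_restrict_mem isClosed_frontier.measurableSet

theorem exists_bdryMeasure_ball_le {N : ℕ} {Ω : Set (EuclideanSpace ℝ (Fin N))}
    {f : EuclideanSpace ℝ (Fin N) → ℝ} (hf : ContDiff ℝ 1 f) (hS : frontier Ω = {x | f x = 0})
    (hc : IsCompact (frontier Ω)) (h0 : ∀ x ∈ frontier Ω, gradient f x ≠ 0) :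
    ∃ L > 0, ∃ δ > 0, ∀ y ρ, 0 < ρ → ρ < δ →
      bdryMeasure Ω (ball y ρ) ≤ ENNReal.ofReal (L * (ρ ^ N / ρ)) := by
  obtain ⟨c, hc0, hcle⟩ := exists_pos_le_norm_gradient hf hc h0
  obtain ⟨δ, hδ, hlin⟩ := exists_uniform_linearization hf hc (half_pos hc0)
  have hκ := unitBallHausdorff_pos (N - 1)
  have hκ' := unitBallHausdorff_lt_top (N - 1)
  have hκr : 0 < (unitBallHausdorff (N - 1)).toReal := ENNReal.toReal_pos hκ.ne' hκ'.ne
  refine ⟨4 ^ (N - 1) * (unitBallHausdorff (N - 1)).toReal, by positivity, δ / 2, by positivity,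
    fun y ρ hρ hρδ => ?_⟩
  rw [bdryMeasure_apply]
  rcases (frontier Ω ∩ ball y ρ).eq_empty_or_nonempty with he | ⟨x, hx, hxy⟩
  · simp [he]
  cases N with
  | zero => exact absurd (Subsingleton.elim _ _) (h0 x hx)
  | succ n =>
    have hsub : frontier Ω ∩ ball y ρ ⊆ frontier Ω ∩ ball x (2 * ρ) := by
      refine inter_subset_inter_right _ (ball_subset_ball' ?_)
      rw [mem_ball, dist_comm] at hxy
      linarith
    have h1 := hausdorffMeasure_levelSet_inter_ball_le hS (h0 x hx) (δ := δ)
      (fun y hy z hz => (hlin x hx y hy z hz).trans (by gcongr; exact hcle x hx))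
      (by positivity : 0 < 2 * ρ) (by linarith)
    have he : ((n + 1 : ℕ) : ℝ) - 1 = n := by push_cast; ring
    rw [he]
    refine (measure_mono hsub).trans (h1.trans (le_of_eq ?_))
    have hn : n + 1 - 1 = n := rfl
    rw [hn] at hκ' ⊢
    rw [pow_succ, mul_div_cancel_right₀ _ hρ.ne', mul_pow]
    rw [← ENNReal.ofReal_toReal hκ'.ne, ENNReal.toReal_ofReal ENNReal.toReal_nonneg,
      ← ENNReal.ofReal_mul (by positivity)]
    rw [show (2 : ℝ≥0∞) ^ n = ENNReal.ofReal (2 ^ n) by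
      rw [ENNReal.ofReal_pow (by norm_num)]; simp, ← ENNReal.ofReal_mul (by positivity)]
    congr 1
    rw [show (4 : ℝ) = 2 * 2 by norm_num, mul_pow]
    ring

theorem exists_le_bdryMeasure_ball {N : ℕ} {Ω : Set (EuclideanSpace ℝ (Fin N))}
    {f : EuclideanSpace ℝ (Fin N) → ℝ} (hf : ContDiff ℝ 1 f) (hS : frontier Ω = {x | f x = 0})
    (hc : IsCompact (frontier Ω)) (h0 : ∀ x ∈ frontier Ω, gradient f x ≠ 0) :
    ∃ b > 0, ∃ δ > 0, ∀ x ∈ frontier Ω, ∀ ρ, 0 < ρ → ρ < δ →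
      ENNReal.ofReal (b * (ρ ^ N / ρ)) ≤ bdryMeasure Ω (ball x ρ) := by
  obtain ⟨c, hc0, hcle⟩ := exists_pos_le_norm_gradient hf hc h0
  obtain ⟨δ, hδ, hlin⟩ := exists_uniform_linearization hf hc (half_pos hc0)
  have hκ := unitBallHausdorff_pos (N - 1)
  have hκ' := unitBallHausdorff_lt_top (N - 1)
  have hκr : 0 < (unitBallHausdorff (N - 1)).toReal := ENNReal.toReal_pos hκ.ne' hκ'.ne
  refine ⟨(unitBallHausdorff (N - 1)).toReal / 4 ^ (N - 1), by positivity, δ, hδ,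
    fun x hx ρ hρ hρδ => ?_⟩
  rw [bdryMeasure_apply]
  cases N with
  | zero => exact absurd (Subsingleton.elim _ _) (h0 x hx)
  | succ n =>
    have h1 := le_hausdorffMeasure_levelSet_inter_ball hf.continuous hS hx (h0 x hx) (δ := δ)
      (fun y hy z hz => (hlin x hx y hy z hz).trans (by gcongr; exact hcle x hx)) hρ hρδ.le
    have he : ((n + 1 : ℕ) : ℝ) - 1 = n := by push_cast; ring
    rw [he]
    refine (le_of_eq ?_).trans h1
    have hn : n + 1 - 1 = n := rfl
    rw [hn] at hκ' ⊢
    rw [pow_succ, mul_div_cancel_right₀ _ hρ.ne', div_pow]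
    rw [← ENNReal.ofReal_toReal hκ'.ne, ENNReal.toReal_ofReal ENNReal.toReal_nonneg,
      ← ENNReal.ofReal_mul (by positivity)]
    congr 1
    ring

theorem bdryMeasure_univ_lt_top_of_ball_le {N : ℕ} {Ω : Set (EuclideanSpace ℝ (Fin N))}
    (hc : IsCompact (frontier Ω)) {L δ : ℝ} (hδ : 0 < δ)
    (h : ∀ y ρ, 0 < ρ → ρ < δ → bdryMeasure Ω (ball y ρ) ≤ ENNReal.ofReal (L * (ρ ^ N / ρ))) :
    bdryMeasure Ω univ < ⊤ := by
  have h1 : bdryMeasure Ω univ = bdryMeasure Ω (frontier Ω) := by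
    simp [bdryMeasure_apply]
  rw [h1]
  refine hc.measure_lt_top_of_nhdsWithin fun x _ =>
    ⟨ball x (δ / 2), mem_nhdsWithin_of_mem_nhds (ball_mem_nhds x (half_pos hδ)),
      (h x (δ / 2) (half_pos hδ) (half_lt_self hδ)).trans_lt ENNReal.ofReal_lt_top⟩

/-- Points of `Ω` where `f` is almost zero are close to the boundary. -/
theorem exists_forall_dist_frontier_lt {N : ℕ} {Ω : Set (EuclideanSpace ℝ (Fin N))}
    {f : EuclideanSpace ℝ (Fin N) → ℝ} (hf : Continuous f) (hΩ : Ω = {x | f x < 0})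
    (hΩb : IsBounded Ω) {ρ : ℝ} (hρ : 0 < ρ) :
    ∃ σ > 0, ∀ w ∈ Ω, -f w < σ → ∃ x ∈ frontier Ω, dist w x < ρ := by
  have hΩo : IsOpen Ω := by rw [hΩ]; exact isOpen_lt hf continuous_const
  set A := closure Ω \ thickening ρ (frontier Ω)
  have hA : IsCompact A := hΩb.isCompact_closure.diff isOpen_thickening
  have hAneg : ∀ x ∈ A, 0 < -f x := by
    rintro x ⟨hx, hxn⟩
    have : x ∈ Ω := by
      by_contra hxΩ
      refine hxn (self_subset_thickening hρ _ ?_)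
      rw [hΩo.frontier_eq]
      exact ⟨hx, hxΩ⟩
    rw [hΩ] at this
    simpa using this
  rcases A.eq_empty_or_nonempty with he | hne
  · refine ⟨1, one_pos, fun w hw _ => ?_⟩
    have : w ∈ thickening ρ (frontier Ω) := by
      by_contra hn
      exact (he ▸ (⟨subset_closure hw, hn⟩ : w ∈ A) : w ∈ (∅ : Set _))
    exact mem_thickening_iff.1 this
  · obtain ⟨x, hx, hmin⟩ := hA.exists_isMinOn hne hf.neg.continuousOn
    refine ⟨-f x, hAneg x hx, fun w hw hlt => ?_⟩
    have : w ∈ thickening ρ (frontier Ω) := by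
      by_contra hn
      have : -f x ≤ -f w := hmin (⟨subset_closure hw, hn⟩ : w ∈ A)
      linarith
    exact mem_thickening_iff.1 this

set_option maxHeartbeats 1000000 in
theorem exists_isCollar {N : ℕ} {Ω : Set (EuclideanSpace ℝ (Fin N))} (hΩb : IsBounded Ω)
    (hΩs : HasSmoothBoundary Ω) : ∃ f r δ c M L, IsCollar Ω f r δ c M L := by
  obtain ⟨f, hf, hΩ, hS, h0⟩ := hΩs
  have hf1 : ContDiff ℝ 1 f := hf.of_le (by exact_mod_cast le_top)
  have hcS : IsCompact (frontier Ω) :=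
    hΩb.isCompact_closure.of_isClosed_subset isClosed_frontier frontier_subset_closure
  obtain ⟨c₀, hc₀, hcle⟩ := exists_pos_le_norm_gradient hf1 hcS h0
  obtain ⟨B, hB⟩ := hcS.exists_bound_of_continuousOn (continuous_gradient hf1).continuousOn
  obtain ⟨M₀, hM₀, hMle⟩ : ∃ M₀ : ℝ, 1 ≤ M₀ ∧ ∀ x ∈ frontier Ω, ‖gradient f x‖ ≤ M₀ :=
    ⟨max B 1, le_max_right _ _, fun x hx => (hB x hx).trans (le_max_left _ _)⟩
  obtain ⟨r, hr, hrc, hr1⟩ : ∃ r : ℝ, 0 < r ∧ r ≤ c₀ / 4 ∧ r ≤ 1 :=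
    ⟨min (c₀ / 4) 1, by positivity, min_le_left _ _, min_le_right _ _⟩
  obtain ⟨ε, hε, hε1, hε2⟩ : ∃ ε : ℝ, 0 < ε ∧ ε * (M₀ + 1) ≤ c₀ ^ 2 / 4 ∧ ε ≤ c₀ / 2 :=
    ⟨min (c₀ ^ 2 / 4 / (M₀ + 1)) (c₀ / 2), by positivity,
      (le_div_iff₀ (by positivity)).1 (min_le_left _ _), min_le_right _ _⟩
  obtain ⟨δ₁, hδ₁, hlin⟩ := exists_uniform_linearization hf1 hcS hε
  obtain ⟨δ₂, hδ₂, hgrad⟩ := exists_forall_norm_gradient_sub_lt hf1 hcS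
    (by positivity : 0 < r / 4)
  obtain ⟨L, hL, δ₃, hδ₃, hup⟩ := exists_bdryMeasure_ball_le hf1 hS hcS h0
  obtain ⟨b, hb, δ₄, hδ₄, hlow⟩ := exists_le_bdryMeasure_ball hf1 hS hcS h0
  obtain ⟨ρ, hρ, hρ1, hρ2⟩ : ∃ ρ : ℝ, 0 < ρ ∧ ρ ≤ δ₁ ∧ ρ ≤ δ₂ :=
    ⟨min δ₁ δ₂, by positivity, min_le_left _ _, min_le_right _ _⟩
  obtain ⟨σ, hσ, hnear⟩ := exists_forall_dist_frontier_lt hf.continuous hΩ hΩb (half_pos hρ)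
  obtain ⟨M, hM, hM1, hM2⟩ : ∃ M : ℝ, 0 < M ∧ M₀ + 1 ≤ M ∧ M₀ * (M₀ + 1) + c₀ ^ 2 / 4 ≤ M :=
    ⟨max (M₀ + 1) (M₀ * (M₀ + 1) + c₀ ^ 2 / 4), by positivity, le_max_left _ _, le_max_right _ _⟩
  obtain ⟨c, hc, hcb, hc1, hc2, hc3, hcr⟩ : ∃ c : ℝ, 0 < c ∧ c ≤ b * ((r / 4) ^ N / (r / 4)) ∧
      c ≤ 1 ∧ c ≤ c₀ ^ 2 / 4 ∧ c ≤ c₀ ^ 2 / 2 ∧ c * M₀ ≤ r / 4 :=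
    ⟨min (b * ((r / 4) ^ N / (r / 4))) (min 1 (min (c₀ ^ 2 / 4) (r / 4 / M₀))), by positivity,
      min_le_left _ _, (min_le_right _ _).trans (min_le_left _ _),
      (min_le_right _ _).trans ((min_le_right _ _).trans (min_le_left _ _)),
      ((min_le_right _ _).trans ((min_le_right _ _).trans (min_le_left _ _))).trans
        (by nlinarith [sq_nonneg c₀]),
      (le_div_iff₀ (by positivity)).1
        ((min_le_right _ _).trans ((min_le_right _ _).trans (min_le_right _ _)))⟩
  obtain ⟨δ, hδ, hδa, hδb, hδc, hδd, hδe⟩ : ∃ δ : ℝ, 0 < δ ∧ δ * (M₀ + 1) ≤ δ₁ ∧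
      2 * M * δ ≤ δ₃ ∧ δ ≤ δ₄ ∧ δ ≤ σ ∧ δ * M₀ ≤ ρ / 4 := by
    refine ⟨min (δ₁ / (M₀ + 1)) (min (δ₃ / (2 * M)) (min δ₄ (min σ (ρ / 4 / M₀)))), by positivity,
      (le_div_iff₀ (by positivity)).1 (min_le_left _ _), ?_, ?_, ?_, ?_⟩
    · rw [mul_comm]
      exact (le_div_iff₀ (by positivity)).1 ((min_le_right _ _).trans (min_le_left _ _))
    · exact (min_le_right _ _).trans ((min_le_right _ _).trans (min_le_left _ _))
    · exact (min_le_right _ _).trans ((min_le_right _ _).trans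
        ((min_le_right _ _).trans (min_le_left _ _)))
    · exact (le_div_iff₀ (by positivity)).1 ((min_le_right _ _).trans ((min_le_right _ _).trans
        ((min_le_right _ _).trans (min_le_right _ _))))
  have hnorm : ∀ x ∈ frontier Ω, ∀ d, ‖d‖ < r → ‖gradient f x + d‖ ≤ M₀ + 1 := fun x hx d hd =>
    (norm_add_le _ _).trans (add_le_add (hMle x hx) (hd.le.trans hr1))
  have hexp : ∀ x ∈ frontier Ω, ∀ d, ‖d‖ < r → ∀ τ, 0 < τ → τ < δ →
      |-f (x - τ • (gradient f x + d)) - τ * ⟪gradient f x, gradient f x + d⟫| ≤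
        τ * (c₀ ^ 2 / 4) := by
    intro x hx d hd τ hτ hτδ
    have hn := hnorm x hx d hd
    have hx0 : f x = 0 := by rw [hS] at hx; exact hx
    have h1 := hlin x hx (x - τ • (gradient f x + d)) (by
      rw [mem_ball, dist_eq_norm, sub_sub_cancel_left, norm_neg, norm_smul, Real.norm_eq_abs,
        abs_of_pos hτ]
      calc τ * ‖gradient f x + d‖ ≤ τ * (M₀ + 1) := by gcongr
        _ < δ * (M₀ + 1) := by gcongr
        _ ≤ δ₁ := hδa) x (mem_ball_self hδ₁)
    rw [hx0, sub_sub_cancel_left, inner_neg_right, inner_smul_right, norm_neg, norm_smul,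
      Real.norm_eq_abs, abs_of_pos hτ, sub_zero, sub_neg_eq_add] at h1
    rw [← abs_neg, neg_sub, sub_neg_eq_add, add_comm]
    refine h1.trans ?_
    calc ε * (τ * ‖gradient f x + d‖) ≤ ε * (τ * (M₀ + 1)) := by gcongr
      _ = τ * (ε * (M₀ + 1)) := by ring
      _ ≤ _ := by gcongr
  refine ⟨f, r, δ, c, M, L * ((2 * M) ^ N / (2 * M)), hf, hΩ, hr, hδ, hc, hM, by positivity, ?_,
    ?_, ?_, ?_, ?_, bdryMeasure_univ_lt_top_of_ball_le hcS hδ₃ hup⟩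
  · exact fun x hx d hd => (hnorm x hx d hd).trans hM1
  · intro x hx d hd τ hτ hτδ
    have h1 := (abs_le.1 (hexp x hx d hd τ hτ hτδ)).1
    have h2 : c₀ * (3 / 4 * c₀) ≤ ⟪gradient f x, gradient f x + d⟫ := by
      rw [inner_add_right, real_inner_self_eq_norm_sq]
      have h3 := (abs_le.1 (abs_real_inner_le_norm (gradient f x) d)).1
      have h4 := hcle x hx
      have h5 : ‖gradient f x‖ * ‖d‖ ≤ ‖gradient f x‖ * (c₀ / 4) := by
        gcongr; linarith
      nlinarith
    nlinarith
  · intro x hx d hd τ hτ hτδ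
    have h1 := (abs_le.1 (hexp x hx d hd τ hτ hτδ)).2
    have h2 : ⟪gradient f x, gradient f x + d⟫ ≤ M₀ * (M₀ + 1) :=
      (real_inner_le_norm _ _).trans
        (mul_le_mul (hMle x hx) (hnorm x hx d hd) (norm_nonneg _) (by linarith))
    nlinarith
  · intro y τ hτ hτδ
    refine (hup y (2 * M * τ) (by positivity) ?_).trans (le_of_eq ?_)
    · calc 2 * M * τ < 2 * M * δ := by gcongr
        _ ≤ δ₃ := hδb
    · rw [mul_pow]
      congr 1
      field_simp
  · intro w hw a ha haδ hwa
    have hfw : f w < 0 := by rw [hΩ] at hw; exact hw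
    have hca : c * a ≤ a := by nlinarith
    obtain ⟨x₀, hx₀, hwx⟩ := hnear w hw (by linarith)
    set G := gradient f x₀
    have hG1 : c₀ ≤ ‖G‖ := hcle x₀ hx₀
    have hG2 : ‖G‖ ≤ M₀ := hMle x₀ hx₀
    set s₁ := -f w / (c₀ ^ 2 / 2)
    have hs₁ : 0 < s₁ := by
      have : 0 < -f w := by linarith
      positivity
    have hs₁w : s₁ * (c₀ ^ 2 / 2) = -f w := div_mul_cancel₀ _ (by positivity)
    have hs₁a : 2 * s₁ ≤ a := by
      have : 0 < c₀ ^ 2 := by positivity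
      nlinarith
    have hpath : ∀ s ∈ Icc 0 s₁, dist (w + s • G) x₀ < 3 * ρ / 4 := by
      intro s hs
      have h1 : ‖s • G‖ ≤ ρ / 4 := by
        rw [norm_smul, Real.norm_eq_abs, abs_of_nonneg hs.1]
        calc s * ‖G‖ ≤ δ * M₀ := by
              apply mul_le_mul _ hG2 (norm_nonneg _) hδ.le
              linarith [hs.2]
          _ ≤ ρ / 4 := hδe
      calc dist (w + s • G) x₀ ≤ dist (w + s • G) w + dist w x₀ := dist_triangle _ _ _
        _ < ρ / 4 + ρ / 2 := by
          rw [dist_self_add_left]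
          linarith
        _ = _ := by ring
    have hend : 0 ≤ f (w + s₁ • G) := by
      have h1 := (abs_le.1 (hlin x₀ hx₀ (w + s₁ • G)
        (mem_ball.2 (by linarith [hpath s₁ ⟨hs₁.le, le_rfl⟩])) w
        (mem_ball.2 (by linarith)))).1
      rw [add_sub_cancel_left, inner_smul_right, real_inner_self_eq_norm_sq, norm_smul,
        Real.norm_eq_abs, abs_of_pos hs₁] at h1
      have h2 : ε * (s₁ * ‖G‖) ≤ c₀ / 2 * (s₁ * ‖G‖) := by gcongr
      have h3 : c₀ ^ 2 / 2 ≤ ‖G‖ ^ 2 - c₀ / 2 * ‖G‖ := by nlinarith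
      nlinarith [mul_le_mul_of_nonneg_left h3 hs₁.le]
    obtain ⟨s, hs, hfs⟩ := intermediate_value_Icc hs₁.le
      (f := fun s : ℝ => f (w + s • G)) (by have := hf.continuous; fun_prop)
      (show (0 : ℝ) ∈ Icc _ _ from ⟨by simpa using hfw.le, hend⟩)
    have hs0 : 0 < s := by
      rcases hs.1.eq_or_lt with h | h
      · rw [← h] at hfs
        simp only [zero_smul, add_zero] at hfs
        linarith
      · exact h
    refine ⟨s, hs0, by nlinarith [hs.2], fun τ hτ => ?_⟩
    have hτ0 : 0 < τ := hs0.trans_le hτ.1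
    have hτa : τ ≤ a := hτ.2.trans (by nlinarith [hs.2])
    set x' := w + s • G
    have hx' : x' ∈ frontier Ω := by rw [hS]; exact hfs
    have hrτ : r / 4 * τ < δ := by nlinarith
    have h1 := hlow x' hx' (r / 4 * τ) (by positivity) (by linarith)
    have h2 : ENNReal.ofReal (c * (τ ^ N / τ)) ≤
        ENNReal.ofReal (b * ((r / 4 * τ) ^ N / (r / 4 * τ))) := by
      apply ENNReal.ofReal_le_ofReal
      calc c * (τ ^ N / τ) ≤ b * ((r / 4) ^ N / (r / 4)) * (τ ^ N / τ) := by gcongr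
        _ = _ := by rw [mul_pow]; field_simp
    refine (h2.trans h1).trans ?_
    rw [bdryMeasure_apply, bdryMeasure_apply]
    refine measure_mono fun x hx => ⟨hx.1, ?_⟩
    have hxx' : ‖x - x'‖ < r / 4 * τ := by
      have := hx.2
      rwa [mem_ball, dist_eq_norm] at this
    have hxx₀ : x ∈ ball x₀ δ₂ := by
      have h3 := hpath s hs
      have h4 : dist x x' ≤ ρ / 4 := by
        rw [dist_eq_norm]
        nlinarith
      have := dist_triangle x x' x₀
      rw [mem_ball]
      linarith
    have h5 := hgrad x₀ hx₀ x hxx₀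
    have h6 : x - w - τ • gradient f x =
        (x - x') + (s - τ) • G - τ • (gradient f x - G) := by
      simp only [x', sub_smul, smul_sub]
      abel
    rw [mem_ofPred_eq, h6]
    have h7 : ‖(s - τ) • G‖ ≤ r / 4 * τ := by
      rw [norm_smul, Real.norm_eq_abs, abs_sub_comm, abs_of_nonneg (sub_nonneg.2 hτ.1)]
      calc (τ - s) * ‖G‖ ≤ (c * s) * M₀ := by
            apply mul_le_mul _ hG2 (norm_nonneg _) (by positivity)
            linarith [hτ.2]
        _ = s * (c * M₀) := by ring
        _ ≤ τ * (r / 4) := mul_le_mul hτ.1 hcr (by positivity) hτ0.le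
        _ = _ := mul_comm _ _
    have h8 : ‖τ • (gradient f x - G)‖ ≤ r / 4 * τ := by
      rw [norm_smul, Real.norm_eq_abs, abs_of_pos hτ0, mul_comm]
      gcongr
    have h9 := norm_sub_le ((x - x') + (s - τ) • G) (τ • (gradient f x - G))
    have h10 := norm_add_le (x - x') ((s - τ) • G)
    nlinarith

end Collar

section Cones

open Metric

variable {N : ℕ}

theorem map_cone_restrict (x v : EuclideanSpace ℝ (Fin N)) {r τ : ℝ} (hτ : 0 < τ) :
    Measure.map (fun d => x - τ • (v + d)) (volume.restrict (ball 0 r)) =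
      (ENNReal.ofReal (τ ^ N))⁻¹ • volume.restrict {w | ‖x - w - τ • v‖ < r * τ} := by
  have hmeas : MeasurableSet {w : EuclideanSpace ℝ (Fin N) | ‖x - w - τ • v‖ < r * τ} :=
    (isOpen_lt (by fun_prop) continuous_const).measurableSet
  have hψ : Measurable (fun d : EuclideanSpace ℝ (Fin N) => x - τ • (v + d)) := by fun_prop
  have hmap : Measure.map (fun d : EuclideanSpace ℝ (Fin N) => x - τ • (v + d)) volume =
      (ENNReal.ofReal (τ ^ N))⁻¹ • volume := by
    have : (fun d : EuclideanSpace ℝ (Fin N) => x - τ • (v + d)) =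
        (fun y => (x - τ • v) - y) ∘ (fun d => τ • d) := by
      funext d
      simp only [Function.comp_apply, smul_add]
      abel
    rw [this, ← Measure.map_map (by fun_prop) (by fun_prop),
      Measure.map_addHaar_smul _ hτ.ne', Measure.map_smul, Measure.map_sub_left_eq_self]
    congr 1
    rw [finrank_euclideanSpace_fin, abs_of_pos (by positivity),
      ENNReal.ofReal_inv_of_pos (by positivity)]
  have hpre : (fun d : EuclideanSpace ℝ (Fin N) => x - τ • (v + d)) ⁻¹'
      {w | ‖x - w - τ • v‖ < r * τ} = ball 0 r := by
    ext d
    have : x - (x - τ • (v + d)) - τ • v = τ • d := by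
      rw [smul_add]; abel
    simp only [mem_preimage, mem_ofPred_eq, this, norm_smul, Real.norm_eq_abs, abs_of_pos hτ,
      mem_ball_zero_iff]
    rw [mul_comm r τ, mul_lt_mul_iff_right₀ hτ]
  rw [← hpre, ← Measure.restrict_map hψ hmeas, hmap, Measure.restrict_smul]

theorem lintegral_cone_eq (x v : EuclideanSpace ℝ (Fin N)) {r τ : ℝ} (hτ : 0 < τ)
    {h : EuclideanSpace ℝ (Fin N) → ℝ≥0∞} (hh : Measurable h) :
    ∫⁻ d in ball 0 r, h (x - τ • (v + d)) =
      (ENNReal.ofReal (τ ^ N))⁻¹ * ∫⁻ w in {w | ‖x - w - τ • v‖ < r * τ}, h w := by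
  rw [← lintegral_map hh (by fun_prop : Measurable fun d => x - τ • (v + d)),
    map_cone_restrict x v hτ, lintegral_smul_measure, smul_eq_mul]

variable {Ω : Set (EuclideanSpace ℝ (Fin N))} {f : EuclideanSpace ℝ (Fin N) → ℝ}
  {r δ c M L : ℝ}

namespace IsCollar

theorem contDiff_one (hC : IsCollar Ω f r δ c M L) : ContDiff ℝ 1 f :=
  hC.contDiff.of_le (by exact_mod_cast le_top)

theorem continuous_grad (hC : IsCollar Ω f r δ c M L) : Continuous (gradient f) :=
  continuous_gradient hC.contDiff_one

theorem isOpen (hC : IsCollar Ω f r δ c M L) : IsOpen Ω := by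
  rw [hC.eq_sublevel]
  exact isOpen_lt hC.contDiff.continuous continuous_const

theorem measurableSet (hC : IsCollar Ω f r δ c M L) : MeasurableSet Ω := hC.isOpen.measurableSet

theorem isFiniteMeasure (hC : IsCollar Ω f r δ c M L) : IsFiniteMeasure (bdryMeasure Ω) :=
  ⟨hC.finite⟩

theorem cone_bounds (hC : IsCollar Ω f r δ c M L) {x w : EuclideanSpace ℝ (Fin N)}
    (hx : x ∈ frontier Ω) {τ : ℝ} (hτ : 0 < τ) (hτδ : τ < δ)
    (hw : ‖x - w - τ • gradient f x‖ < r * τ) :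
    c * τ ≤ -f w ∧ -f w ≤ M * τ ∧ w ∈ Ω ∧ dist x w ≤ M * τ := by
  set d := τ⁻¹ • (x - w) - gradient f x
  have hd : ‖d‖ < r := by
    have : τ • d = x - w - τ • gradient f x := by
      simp only [d, smul_sub, smul_inv_smul₀ hτ.ne']
    rw [← this, norm_smul, Real.norm_eq_abs, abs_of_pos hτ, mul_comm r] at hw
    exact lt_of_mul_lt_mul_left hw hτ.le
  have hxw : x - τ • (gradient f x + d) = w := by
    simp [d, smul_inv_smul₀ hτ.ne']
  have h1 := hC.le_neg x hx d hd τ hτ hτδ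
  have h2 := hC.neg_le x hx d hd τ hτ hτδ
  rw [hxw] at h1 h2
  refine ⟨h1, h2, ?_, ?_⟩
  · rw [hC.eq_sublevel]
    have := mul_pos hC.c_pos hτ
    exact show f w < 0 by linarith
  · rw [dist_eq_norm, ← hxw, sub_sub_cancel, norm_smul, Real.norm_eq_abs, abs_of_pos hτ, mul_comm]
    gcongr
    exact hC.norm_le x hx d hd

theorem cone_subset (hC : IsCollar Ω f r δ c M L) {x : EuclideanSpace ℝ (Fin N)}
    (hx : x ∈ frontier Ω) {τ : ℝ} (hτ : 0 < τ) (hτδ : τ < δ) :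
    {w | ‖x - w - τ • gradient f x‖ < r * τ} ⊆ Ω := fun _ hw =>
  (hC.cone_bounds hx hτ hτδ hw).2.2.1

theorem section_le (hC : IsCollar Ω f r δ c M L) (w : EuclideanSpace ℝ (Fin N)) {τ : ℝ}
    (hτ : 0 < τ) (hτδ : τ < δ) :
    bdryMeasure Ω {x | ‖x - w - τ • gradient f x‖ < r * τ} ≤ ENNReal.ofReal (L * (τ ^ N / τ)) := by
  refine le_trans ?_ (hC.ball_le w τ hτ hτδ)
  rw [bdryMeasure_apply, bdryMeasure_apply]
  refine measure_mono fun x hx => ⟨hx.1, ?_⟩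
  have := (hC.cone_bounds hx.1 hτ hτδ hx.2).2.2.2
  rw [mem_ball]
  have := mul_pos hC.M_pos hτ
  linarith

theorem lintegral_cone_le (hC : IsCollar Ω f r δ c M L) {x : EuclideanSpace ℝ (Fin N)}
    (hx : x ∈ frontier Ω) {τ : ℝ} (hτ : 0 < τ) (hτδ : τ < δ)
    {h : EuclideanSpace ℝ (Fin N) → ℝ≥0∞} (hh : Measurable h) :
    ∫⁻ d in ball 0 r, h (x - τ • (gradient f x + d)) ≤
      (ENNReal.ofReal (τ ^ N))⁻¹ * ∫⁻ w in Ω, h w := by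
  rw [lintegral_cone_eq x _ hτ hh]
  gcongr
  exact hC.cone_subset hx hτ hτδ

/-- Integration over the cones of aperture `r` with vertices on `∂Ω`, at height `τ`. -/
theorem lintegral_lintegral_cone_eq (hC : IsCollar Ω f r δ c M L) {τ : ℝ} (hτ : 0 < τ)
    {h : EuclideanSpace ℝ (Fin N) → ℝ≥0∞} (hh : Measurable h) :
    ∫⁻ x, (∫⁻ d in ball 0 r, h (x - τ • (gradient f x + d))) ∂(bdryMeasure Ω) =
      ∫⁻ w, h w * ((ENNReal.ofReal (τ ^ N))⁻¹ *
        bdryMeasure Ω {x | ‖x - w - τ • gradient f x‖ < r * τ}) := by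
  have := hC.isFiniteMeasure
  have hmeas : MeasurableSet {q : EuclideanSpace ℝ (Fin N) × EuclideanSpace ℝ (Fin N) |
      ‖q.1 - q.2 - τ • gradient f q.1‖ < r * τ} := by
    have := hC.continuous_grad
    exact (isOpen_lt (by fun_prop) (by fun_prop)).measurableSet
  calc ∫⁻ x, (∫⁻ d in ball 0 r, h (x - τ • (gradient f x + d))) ∂(bdryMeasure Ω)
      = ∫⁻ x, (∫⁻ w, (ENNReal.ofReal (τ ^ N))⁻¹ *
          ({q : EuclideanSpace ℝ (Fin N) × EuclideanSpace ℝ (Fin N) |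
            ‖q.1 - q.2 - τ • gradient f q.1‖ < r * τ}.indicator (fun q => h q.2) (x, w)))
          ∂(bdryMeasure Ω) := by
        refine lintegral_congr fun x => ?_
        rw [lintegral_cone_eq x _ hτ hh, lintegral_const_mul, ← lintegral_indicator]
        · rfl
        · exact measurable_prodMk_left hmeas
        · exact ((hh.comp measurable_snd).indicator hmeas).comp measurable_prodMk_left
    _ = ∫⁻ w, ∫⁻ x, (ENNReal.ofReal (τ ^ N))⁻¹ *
          ({q : EuclideanSpace ℝ (Fin N) × EuclideanSpace ℝ (Fin N) |
            ‖q.1 - q.2 - τ • gradient f q.1‖ < r * τ}.indicator (fun q => h q.2) (x, w))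
          ∂(bdryMeasure Ω) :=
        lintegral_lintegral_swap
          (((hh.comp measurable_snd).indicator hmeas).const_mul _).aemeasurable
    _ = _ := by
        refine lintegral_congr fun w => ?_
        have hsec : MeasurableSet {x | ‖x - w - τ • gradient f x‖ < r * τ} :=
          measurable_prodMk_right hmeas
        rw [lintegral_const_mul]
        · have : ∀ x, ({q : EuclideanSpace ℝ (Fin N) × EuclideanSpace ℝ (Fin N) |
              ‖q.1 - q.2 - τ • gradient f q.1‖ < r * τ}.indicator (fun q => h q.2) (x, w)) =
              {x | ‖x - w - τ • gradient f x‖ < r * τ}.indicator (fun _ => h w) x := fun x => rfl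
          simp_rw [this]
          rw [lintegral_indicator hsec, setLIntegral_const]
          ring
        · exact ((hh.comp measurable_snd).indicator hmeas).comp measurable_prodMk_right

theorem lintegral_lintegral_cone_le (hC : IsCollar Ω f r δ c M L) {τ : ℝ} (hτ : 0 < τ)
    (hτδ : τ < δ) {h : EuclideanSpace ℝ (Fin N) → ℝ≥0∞} (hh : Measurable h) :
    ∫⁻ x, (∫⁻ d in ball 0 r, h (x - τ • (gradient f x + d))) ∂(bdryMeasure Ω) ≤
      ENNReal.ofReal (L / τ) * ∫⁻ w in Ω, h w := by
  rw [hC.lintegral_lintegral_cone_eq hτ hh, ← lintegral_const_mul _ hh,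
    ← lintegral_indicator hC.measurableSet]
  refine lintegral_mono fun w => ?_
  by_cases hw : w ∈ Ω
  · rw [indicator_of_mem hw, mul_comm]
    gcongr
    calc _ ≤ (ENNReal.ofReal (τ ^ N))⁻¹ * ENNReal.ofReal (L * (τ ^ N / τ)) := by
          gcongr; exact hC.section_le w hτ hτδ
      _ = _ := by
          rw [← ENNReal.ofReal_inv_of_pos (by positivity), ← ENNReal.ofReal_mul (by positivity)]
          congr 1
          field_simp
  · have : bdryMeasure Ω {x | ‖x - w - τ • gradient f x‖ < r * τ} = 0 := by
      rw [bdryMeasure_apply]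
      have he : frontier Ω ∩ {x | ‖x - w - τ • gradient f x‖ < r * τ} = ∅ := by
        rw [eq_empty_iff_forall_notMem]
        rintro x ⟨hx, hxw⟩
        exact hw (hC.cone_subset hx hτ hτδ hxw)
      rw [he, measure_empty]
    simp [this]

end IsCollar

end Cones

section WeightedHolder

theorem lintegral_Ioo_ofReal_rpow {a ε : ℝ} (ha : -1 < a) (hε : 0 < ε) :
    ∫⁻ s in Ioo 0 ε, ENNReal.ofReal (s ^ a) = ENNReal.ofReal (ε ^ (a + 1) / (a + 1)) := by
  have hInt : IntegrableOn (fun s : ℝ => s ^ a) (Ioc 0 ε) :=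
    (intervalIntegrable_iff_integrableOn_Ioc_of_le hε.le).1
      (intervalIntegral.intervalIntegrable_rpow' ha)
  rw [IntegrableOn, ← restrict_Ioo_eq_restrict_Ioc] at hInt
  rw [← ofReal_integral_eq_lintegral_ofReal hInt, ← integral_Ioc_eq_integral_Ioo,
    ← intervalIntegral.integral_of_le hε.le, integral_rpow (Or.inl ha),
    Real.zero_rpow (by linarith), sub_zero]
  filter_upwards [ae_restrict_mem measurableSet_Ioo] with s hs
  exact Real.rpow_nonneg hs.1.le _

theorem lintegral_le_lintegral_rpow_mul {α : Type*} [MeasurableSpace α] (μ : Measure α) {p : ℝ}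
    (hp : 1 < p) {F : α → ℝ≥0∞} (hF : AEMeasurable F μ) :
    ∫⁻ x, F x ∂μ ≤ (∫⁻ x, F x ^ p ∂μ) ^ (1 / p) * μ univ ^ (1 - 1 / p) := by
  have h := ENNReal.lintegral_mul_le_Lp_mul_Lq μ (Real.HolderConjugate.conjExponent hp) hF
    (aemeasurable_const (b := (1 : ℝ≥0∞)))
  have he : 1 / (p.conjExponent) = 1 - 1 / p := by
    rw [Real.conjExponent]
    field_simp
  simpa [he] using h

theorem lintegral_rpow_le_of_le {α : Type*} [MeasurableSpace α] (μ : Measure α) {p R : ℝ}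
    (hp : 0 < p) (hpR : p ≤ R) {P : α → ℝ≥0∞} (hP : Measurable P) {A B : ℝ≥0∞}
    (hA : ∀ᵐ x ∂μ, P x ≤ A) (hB : ∫⁻ x, P x ∂μ ≤ B) :
    ∫⁻ x, (P x ^ (1 / p)) ^ R ∂μ ≤ A ^ (R / p - 1) * B := by
  have hk : 0 ≤ R / p - 1 := by rw [sub_nonneg, one_le_div hp]; exact hpR
  calc ∫⁻ x, (P x ^ (1 / p)) ^ R ∂μ ≤ ∫⁻ x, A ^ (R / p - 1) * P x ∂μ := by
        refine lintegral_mono_ae ?_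
        filter_upwards [hA] with x hx
        rw [← ENNReal.rpow_mul, one_div_mul_eq_div, ← sub_add_cancel (R / p) 1,
          ENNReal.rpow_add_of_nonneg _ _ hk zero_le_one, ENNReal.rpow_one, add_sub_cancel_right]
        gcongr
    _ = A ^ (R / p - 1) * ∫⁻ x, P x ∂μ := lintegral_const_mul _ hP
    _ ≤ _ := by gcongr

theorem lintegral_lintegral_le_lintegral_rpow {α β : Type*} [MeasurableSpace α]
    [MeasurableSpace β] (μ : Measure α) [SFinite μ] (ν : Measure β) [SFinite ν] {p : ℝ}
    (hp : 1 < p) {F : α → β → ℝ≥0∞} (hF : Measurable (Function.uncurry F)) :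
    ∫⁻ d, (∫⁻ s, F d s ∂ν) ∂μ ≤
      μ univ ^ (1 - 1 / p) * ∫⁻ s, (∫⁻ d, F d s ^ p ∂μ) ^ (1 / p) ∂ν := by
  rw [lintegral_lintegral_swap hF.aemeasurable, ← lintegral_const_mul]
  · refine lintegral_mono fun s => ?_
    rw [mul_comm]
    exact lintegral_le_lintegral_rpow_mul μ hp (hF.comp measurable_prodMk_right).aemeasurable
  · exact ((hF.pow_const p).lintegral_prod_left' (μ := μ)).pow_const _

/-- The constant of `lintegral_lintegral_Ioo_rpow_le`. -/
noncomputable def weightedHolderConst (R γ : ℝ) : ℝ≥0∞ :=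
  ENNReal.ofReal (((R - γ) / (2 * (R - 1)))⁻¹) ^ (R - 1) * ENNReal.ofReal (((R - γ) / 2)⁻¹)

theorem weightedHolderConst_ne_top {R γ : ℝ} (hR : 1 < R) : weightedHolderConst R γ ≠ ⊤ :=
  ENNReal.mul_ne_top (ENNReal.rpow_ne_top_of_nonneg (by linarith) ENNReal.ofReal_ne_top)
    ENNReal.ofReal_ne_top

/-- A weighted Hölder (Hardy type) inequality: if the `L^R` norm of `Φ(·, s)` blows up at most
like `s^{-γ/R}` with `γ < R`, then `∫_0^ε Φ(·, s) ds` is small in `L^R`. -/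
theorem lintegral_lintegral_Ioo_rpow_le {α : Type*} [MeasurableSpace α] (β : Measure α)
    [SFinite β] {Φ : α → ℝ → ℝ≥0∞} (hΦ : Measurable (Function.uncurry Φ)) {R γ ε : ℝ}
    (hR : 1 < R) (hγ : γ < R) (hε : 0 < ε) {A : ℝ≥0∞}
    (hA : ∀ s, 0 < s → s < ε → ∫⁻ x, Φ x s ^ R ∂β ≤ A * ENNReal.ofReal (s ^ (-γ))) :
    ∫⁻ x, (∫⁻ s in Ioo 0 ε, Φ x s) ^ R ∂β ≤
      weightedHolderConst R γ * ENNReal.ofReal (ε ^ (R - γ)) * A := by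
  set θ := (γ + R - 2) / (2 * R)
  have hconj := Real.HolderConjugate.conjExponent hR
  set R' := R.conjExponent
  have hR'val : R' = R / (R - 1) := rfl
  have hR0 : 0 < R := by linarith
  have hR1 : 0 < R - 1 := by linarith
  have hR'0 : 0 < R' := by rw [hR'val]; positivity
  have ha : -(θ * R') + 1 = (R - γ) / (2 * (R - 1)) := by
    rw [hR'val]
    simp only [θ]
    field_simp
    ring
  have hb : θ * R - γ + 1 = (R - γ) / 2 := by
    simp only [θ]
    field_simp
    ring
  have hapos : 0 < (R - γ) / (2 * (R - 1)) := div_pos (by linarith) (by linarith)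
  have hbpos : 0 < (R - γ) / 2 := by linarith
  have hI1 : ∫⁻ s in Ioo 0 ε, ENNReal.ofReal (s ^ (-θ)) ^ R' =
      ENNReal.ofReal (ε ^ ((R - γ) / (2 * (R - 1))) / ((R - γ) / (2 * (R - 1)))) := by
    rw [← ha, ← lintegral_Ioo_ofReal_rpow (by linarith) hε]
    refine setLIntegral_congr_fun measurableSet_Ioo fun s hs => ?_
    rw [ENNReal.ofReal_rpow_of_pos (Real.rpow_pos_of_pos hs.1 _), ← Real.rpow_mul hs.1.le, neg_mul]
  have hI2 : ∫⁻ s in Ioo 0 ε, ENNReal.ofReal (s ^ (θ * R)) * ENNReal.ofReal (s ^ (-γ)) =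
      ENNReal.ofReal (ε ^ ((R - γ) / 2) / ((R - γ) / 2)) := by
    rw [← hb, ← lintegral_Ioo_ofReal_rpow (by linarith) hε]
    refine setLIntegral_congr_fun measurableSet_Ioo fun s hs => ?_
    rw [← ENNReal.ofReal_mul (Real.rpow_nonneg hs.1.le _), ← Real.rpow_add hs.1, sub_eq_add_neg]
  have hmeasΦ : ∀ x, Measurable (Φ x) := fun x => hΦ.comp measurable_prodMk_left
  have hmw : ∀ a : ℝ, Measurable fun s : ℝ => ENNReal.ofReal (s ^ a) := fun a => by fun_prop
  have hpt : ∀ x, (∫⁻ s in Ioo 0 ε, Φ x s) ^ R ≤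
      ENNReal.ofReal (ε ^ ((R - γ) / (2 * (R - 1))) / ((R - γ) / (2 * (R - 1)))) ^ (R - 1) *
        ∫⁻ s in Ioo 0 ε, ENNReal.ofReal (s ^ (θ * R)) * Φ x s ^ R := by
    intro x
    have h1 := ENNReal.lintegral_mul_le_Lp_mul_Lq (volume.restrict (Ioo 0 ε)) hconj.symm
      (hmw (-θ)).aemeasurable ((hmw θ).mul (hmeasΦ x)).aemeasurable
    have h2 : ∫⁻ s in Ioo 0 ε, Φ x s = ∫⁻ s in Ioo 0 ε,
        ((fun s : ℝ => ENNReal.ofReal (s ^ (-θ))) *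
          ((fun s : ℝ => ENNReal.ofReal (s ^ θ)) * Φ x)) s := by
      refine setLIntegral_congr_fun measurableSet_Ioo fun s hs => ?_
      simp only [Pi.mul_apply]
      rw [← mul_assoc, ← ENNReal.ofReal_mul (Real.rpow_nonneg hs.1.le _), ← Real.rpow_add hs.1,
        neg_add_cancel, Real.rpow_zero, ENNReal.ofReal_one, one_mul]
    have h3 : ∫⁻ s in Ioo 0 ε, ((fun s : ℝ => ENNReal.ofReal (s ^ θ)) * Φ x) s ^ R =
        ∫⁻ s in Ioo 0 ε, ENNReal.ofReal (s ^ (θ * R)) * Φ x s ^ R := by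
      refine setLIntegral_congr_fun measurableSet_Ioo fun s hs => ?_
      simp only [Pi.mul_apply]
      rw [ENNReal.mul_rpow_of_nonneg _ _ hR0.le,
        ENNReal.ofReal_rpow_of_pos (Real.rpow_pos_of_pos hs.1 _), ← Real.rpow_mul hs.1.le]
    rw [← h2, h3, hI1] at h1
    calc (∫⁻ s in Ioo 0 ε, Φ x s) ^ R ≤ _ ^ R := ENNReal.rpow_le_rpow h1 hR0.le
      _ = _ := by
        rw [ENNReal.mul_rpow_of_nonneg _ _ hR0.le, ← ENNReal.rpow_mul, ← ENNReal.rpow_mul,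
          one_div_mul_cancel hR0.ne', ENNReal.rpow_one]
        congr 2
        rw [hR'val]
        field_simp
  set B := ENNReal.ofReal (ε ^ ((R - γ) / (2 * (R - 1))) / ((R - γ) / (2 * (R - 1)))) ^ (R - 1)
    with hB
  have hmeas2 : Measurable (Function.uncurry fun (x : α) (s : ℝ) =>
      ENNReal.ofReal (s ^ (θ * R)) * Φ x s ^ R) :=
    ((hmw (θ * R)).comp measurable_snd).mul (hΦ.pow_const R)
  calc ∫⁻ x, (∫⁻ s in Ioo 0 ε, Φ x s) ^ R ∂β
      ≤ ∫⁻ x, (B * ∫⁻ s in Ioo 0 ε, ENNReal.ofReal (s ^ (θ * R)) * Φ x s ^ R) ∂β :=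
        lintegral_mono hpt
    _ = B * ∫⁻ x, (∫⁻ s in Ioo 0 ε, ENNReal.ofReal (s ^ (θ * R)) * Φ x s ^ R) ∂β :=
        lintegral_const_mul _ (hmeas2.lintegral_prod_right' (ν := volume.restrict (Ioo 0 ε)))
    _ = B * ∫⁻ s in Ioo 0 ε, (∫⁻ x, ENNReal.ofReal (s ^ (θ * R)) * Φ x s ^ R ∂β) := by
        rw [lintegral_lintegral_swap hmeas2.aemeasurable]
    _ ≤ B * ∫⁻ s in Ioo 0 ε,
          ENNReal.ofReal (s ^ (θ * R)) * ENNReal.ofReal (s ^ (-γ)) * A := by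
        refine mul_le_mul' le_rfl (setLIntegral_mono' measurableSet_Ioo fun s hs => ?_)
        have hΦs : Measurable fun x => Φ x s := hΦ.comp measurable_prodMk_right
        rw [lintegral_const_mul _ (hΦs.pow_const R), mul_assoc, mul_comm _ A]
        gcongr
        exact hA s hs.1 hs.2
    _ = B * (ENNReal.ofReal (ε ^ ((R - γ) / 2) / ((R - γ) / 2)) * A) := by
        rw [lintegral_mul_const _ (by fun_prop), hI2]
    _ = _ := by
        rw [hB, weightedHolderConst, div_eq_mul_inv, div_eq_mul_inv (ε ^ ((R - γ) / 2)),
          ENNReal.ofReal_mul (by positivity), ENNReal.ofReal_mul (by positivity),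
          ENNReal.mul_rpow_of_nonneg _ _ hR1.le,
          ENNReal.ofReal_rpow_of_pos (x := ε ^ _) (by positivity), ← Real.rpow_mul hε.le]
        have h1 : (R - γ) / (2 * (R - 1)) * (R - 1) = (R - γ) / 2 := by field_simp
        have h2 : ENNReal.ofReal (ε ^ (R - γ)) =
            ENNReal.ofReal (ε ^ ((R - γ) / 2)) * ENNReal.ofReal (ε ^ ((R - γ) / 2)) := by
          rw [← ENNReal.ofReal_mul (by positivity), ← Real.rpow_add hε, add_halves]
        rw [h1, h2]
        ring

end WeightedHolder

section ConeAverage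

open Metric

variable {N : ℕ}

theorem enorm_sub_le_lintegral_gradient {φ : EuclideanSpace ℝ (Fin N) → ℝ} (hφ : ContDiff ℝ 1 φ)
    (x z : EuclideanSpace ℝ (Fin N)) {τ : ℝ} (hτ : 0 ≤ τ) :
    ‖φ x - φ (x - τ • z)‖ₑ ≤ ‖z‖ₑ * ∫⁻ s in Ioo 0 τ, ‖gradient φ (x - s • z)‖ₑ := by
  have hderiv : ∀ s : ℝ, HasDerivAt (fun s : ℝ => φ (x - s • z))
      (-(fderiv ℝ φ (x - s • z) z)) s := by
    intro s
    have h1 : HasDerivAt (fun s : ℝ => x - s • z) (-z) s := by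
      simpa using ((hasDerivAt_id s).smul_const z).const_sub x
    have h2 := ((hφ.differentiable one_ne_zero) (x - s • z)).hasFDerivAt.comp_hasDerivAt s h1
    rw [map_neg] at h2
    exact h2
  have hcont : Continuous fun s : ℝ => -(fderiv ℝ φ (x - s • z) z) := by
    have := hφ.continuous_fderiv one_ne_zero
    fun_prop
  have hftc := intervalIntegral.integral_eq_sub_of_hasDerivAt (a := 0) (b := τ)
    (fun s _ => hderiv s) (hcont.intervalIntegrable 0 τ)
  simp only [zero_smul, sub_zero] at hftc
  rw [← enorm_neg, neg_sub, ← hftc, intervalIntegral.integral_of_le hτ,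
    ← lintegral_const_mul' _ _ enorm_ne_top, restrict_Ioo_eq_restrict_Ioc]
  refine (enorm_integral_le_lintegral_enorm _).trans (lintegral_mono fun s => ?_)
  rw [enorm_neg, ← inner_gradient_left, mul_comm, ← enorm_norm z,
    ← enorm_norm (gradient φ (x - s • z)), ← enorm_mul]
  rw [enorm_le_iff_norm_le, norm_mul, norm_norm, norm_norm]
  exact norm_inner_le_norm _ _

/-- The mean of `φ` over the ball of radius `ε r` centred at `x - ε ∇f x`. -/
noncomputable def coneAverage (f : EuclideanSpace ℝ (Fin N) → ℝ) (r ε : ℝ)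
    (φ : EuclideanSpace ℝ (Fin N) → ℝ) (x : EuclideanSpace ℝ (Fin N)) : ℝ :=
  ⨍ d in ball 0 r, φ (x - ε • (gradient f x + d))

variable {Ω : Set (EuclideanSpace ℝ (Fin N))} {f : EuclideanSpace ℝ (Fin N) → ℝ}
  {r δ c M L : ℝ}

theorem integrableOn_ball_cone {φ : EuclideanSpace ℝ (Fin N) → ℝ} (hφ : Continuous φ)
    (x v : EuclideanSpace ℝ (Fin N)) (r ε : ℝ) :
    IntegrableOn (fun d => φ (x - ε • (v + d))) (ball 0 r) :=
  ((by fun_prop : Continuous fun d => φ (x - ε • (v + d))).continuousOn.integrableOn_compact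
    (isCompact_closedBall 0 r)).mono_set ball_subset_closedBall

theorem enorm_sub_average_le {α : Type*} [MeasurableSpace α] {μ : Measure α} [IsFiniteMeasure μ]
    [NeZero μ] {F : α → ℝ} (hF : Integrable F μ) (a : ℝ) :
    ‖a - ⨍ x, F x ∂μ‖ₑ ≤ (μ univ)⁻¹ * ∫⁻ x, ‖a - F x‖ₑ ∂μ := by
  have h1 : a - ⨍ x, F x ∂μ = ⨍ x, (a - F x) ∂μ := by
    rw [average_eq, average_eq, integral_sub (integrable_const a) hF, integral_const, smul_sub,
      smul_smul, inv_mul_cancel₀, one_smul]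
    rw [measureReal_def]
    exact (ENNReal.toReal_pos (by simp [NeZero.ne μ]) (measure_ne_top μ _)).ne'
  rw [h1, average]
  refine (enorm_integral_le_lintegral_enorm _).trans ?_
  rw [lintegral_smul_measure, smul_eq_mul]

theorem measurable_enorm_gradient_cone (hf : ContDiff ℝ 1 f)
    {φ : EuclideanSpace ℝ (Fin N) → ℝ} (hφ : ContDiff ℝ 1 φ) (p : ℝ) :
    Measurable fun q : (EuclideanSpace ℝ (Fin N) × ℝ) × EuclideanSpace ℝ (Fin N) =>
      ‖gradient φ (q.1.1 - q.1.2 • (gradient f q.1.1 + q.2))‖ₑ ^ p := by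
  have h1 := continuous_gradient hf
  have h2 := continuous_gradient hφ
  have : Continuous fun q : (EuclideanSpace ℝ (Fin N) × ℝ) × EuclideanSpace ℝ (Fin N) =>
      gradient φ (q.1.1 - q.1.2 • (gradient f q.1.1 + q.2)) := by fun_prop
  exact this.measurable.enorm.pow_const p

namespace IsCollar

theorem lintegral_cone_gradient_rpow_le (hC : IsCollar Ω f r δ c M L) {p R : ℝ} (hp : 1 < p)
    (hpR : p ≤ R) {φ : EuclideanSpace ℝ (Fin N) → ℝ} (hφ : ContDiff ℝ 1 φ) {s : ℝ} (hs : 0 < s)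
    (hsδ : s < δ) :
    ∫⁻ x, ((∫⁻ d in ball 0 r, ‖gradient φ (x - s • (gradient f x + d))‖ₑ ^ p) ^ (1 / p)) ^ R
        ∂(bdryMeasure Ω) ≤
      ENNReal.ofReal L * (∫⁻ w in Ω, ‖gradient φ w‖ₑ ^ p) ^ (R / p) *
        ENNReal.ofReal (s ^ (-(N * (R / p - 1) + 1))) := by
  set E := ∫⁻ w in Ω, ‖gradient φ w‖ₑ ^ p
  have hm : Measurable fun w => ‖gradient φ w‖ₑ ^ p :=
    (continuous_gradient hφ).measurable.enorm.pow_const p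
  have hp0 : 0 < p := by linarith
  have hk : 0 ≤ R / p - 1 := by rw [sub_nonneg, one_le_div hp0]; exact hpR
  set k := R / p - 1
  have hRk : R / p = k + 1 := by simp [k]
  have hPm : Measurable fun x =>
      ∫⁻ d in ball 0 r, ‖gradient φ (x - s • (gradient f x + d))‖ₑ ^ p := by
    have h1 := hC.continuous_grad
    have h2 := continuous_gradient hφ
    have h3 : Measurable fun q : EuclideanSpace ℝ (Fin N) × EuclideanSpace ℝ (Fin N) =>
        ‖gradient φ (q.1 - s • (gradient f q.1 + q.2))‖ₑ ^ p :=
      (by fun_prop : Continuous fun q : EuclideanSpace ℝ (Fin N) × EuclideanSpace ℝ (Fin N) =>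
        gradient φ (q.1 - s • (gradient f q.1 + q.2))).measurable.enorm.pow_const p
    exact h3.lintegral_prod_right' (ν := volume.restrict (ball 0 r))
  have hP1 : ∀ x ∈ frontier Ω,
      ∫⁻ d in ball 0 r, ‖gradient φ (x - s • (gradient f x + d))‖ₑ ^ p ≤
        (ENNReal.ofReal (s ^ N))⁻¹ * E := fun x hx => hC.lintegral_cone_le hx hs hsδ hm
  have hP2 : ∫⁻ x, (∫⁻ d in ball 0 r, ‖gradient φ (x - s • (gradient f x + d))‖ₑ ^ p)
      ∂(bdryMeasure Ω) ≤ ENNReal.ofReal (L / s) * E := hC.lintegral_lintegral_cone_le hs hsδ hm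
  refine (lintegral_rpow_le_of_le _ hp0 hpR hPm
    ((ae_mem_frontier Ω).mono fun x hx => hP1 x hx) hP2).trans (le_of_eq ?_)
  change _ ^ k * _ = _
  rw [ENNReal.mul_rpow_of_nonneg _ _ hk, hRk, ENNReal.rpow_add_of_nonneg _ _ hk zero_le_one,
    ENNReal.rpow_one, ← ENNReal.ofReal_inv_of_pos (by positivity),
    ENNReal.ofReal_rpow_of_pos (by positivity), div_eq_mul_inv, ENNReal.ofReal_mul hC.L_pos.le]
  have : s ^ (-(N * k + 1)) = ((s ^ N)⁻¹) ^ k * s⁻¹ := by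
    rw [neg_add, Real.rpow_add hs, Real.rpow_neg_one, ← Real.rpow_natCast s N,
      ← Real.rpow_neg hs.le, ← Real.rpow_mul hs.le, neg_mul]
  rw [this, ENNReal.ofReal_mul (by positivity)]
  ring

theorem enorm_sub_coneAverage_le (hC : IsCollar Ω f r δ c M L) {p : ℝ} (hp : 1 < p)
    {φ : EuclideanSpace ℝ (Fin N) → ℝ} (hφ : ContDiff ℝ 1 φ) {ε : ℝ} (hε : 0 < ε)
    {x : EuclideanSpace ℝ (Fin N)} (hx : x ∈ frontier Ω) :
    ‖φ x - coneAverage f r ε φ x‖ₑ ≤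
      (volume (ball (0 : EuclideanSpace ℝ (Fin N)) r))⁻¹ * (ENNReal.ofReal M *
        (volume (ball (0 : EuclideanSpace ℝ (Fin N)) r) ^ (1 - 1 / p) *
          ∫⁻ s in Ioo 0 ε, (∫⁻ d in ball 0 r,
            ‖gradient φ (x - s • (gradient f x + d))‖ₑ ^ p) ^ (1 / p))) := by
  have hV0 : volume (ball (0 : EuclideanSpace ℝ (Fin N)) r) ≠ 0 :=
    (measure_ball_pos _ _ hC.r_pos).ne'
  have hVt : volume (ball (0 : EuclideanSpace ℝ (Fin N)) r) ≠ ⊤ := measure_ball_lt_top.ne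
  have : NeZero (volume.restrict (ball (0 : EuclideanSpace ℝ (Fin N)) r)) :=
    ⟨by rw [Ne, Measure.restrict_eq_zero]; exact hV0⟩
  have : IsFiniteMeasure (volume.restrict (ball (0 : EuclideanSpace ℝ (Fin N)) r)) :=
    ⟨by rw [Measure.restrict_apply_univ]; exact hVt.lt_top⟩
  have hF : Measurable (Function.uncurry fun (d : EuclideanSpace ℝ (Fin N)) (s : ℝ) =>
      ‖gradient φ (x - s • (gradient f x + d))‖ₑ) := by
    have h2 := continuous_gradient hφ
    exact (by fun_prop : Continuous fun q : EuclideanSpace ℝ (Fin N) × ℝ =>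
      gradient φ (x - q.2 • (gradient f x + q.1))).measurable.enorm
  have h1 := enorm_sub_average_le
    (integrableOn_ball_cone hφ.continuous x (gradient f x) r ε) (φ x)
  rw [Measure.restrict_apply_univ] at h1
  refine h1.trans (mul_le_mul' le_rfl ?_)
  have h2 := lintegral_lintegral_le_lintegral_rpow
    (volume.restrict (ball (0 : EuclideanSpace ℝ (Fin N)) r)) (volume.restrict (Ioo 0 ε)) hp hF
  rw [Measure.restrict_apply_univ] at h2
  refine le_trans ?_ (mul_le_mul' le_rfl h2)
  rw [← lintegral_const_mul' _ _ ENNReal.ofReal_ne_top]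
  refine setLIntegral_mono' measurableSet_ball fun d hd => ?_
  refine (enorm_sub_le_lintegral_gradient hφ x _ hε.le).trans (mul_le_mul' ?_ le_rfl)
  rw [← ofReal_norm]
  exact ENNReal.ofReal_le_ofReal (hC.norm_le x hx d (mem_ball_zero_iff.1 hd))

/-- `φ` is close to its cone averages in `L^R(∂Ω)`, for every subcritical exponent `R`. -/
theorem exists_lintegral_sub_coneAverage_le (hC : IsCollar Ω f r δ c M L) {p R : ℝ} (hp : 1 < p)
    (hpR : p ≤ R) (hsub : N * (R / p - 1) + 1 < R) :
    ∃ K : ℝ≥0∞, K ≠ ⊤ ∧ ∀ φ : EuclideanSpace ℝ (Fin N) → ℝ, ContDiff ℝ 1 φ →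
      ∀ ε, 0 < ε → ε < δ →
      ∫⁻ x, ‖φ x - coneAverage f r ε φ x‖ₑ ^ R ∂(bdryMeasure Ω) ≤
        K * ENNReal.ofReal (ε ^ (R - (N * (R / p - 1) + 1))) *
          (∫⁻ w in Ω, ‖gradient φ w‖ₑ ^ p) ^ (R / p) := by
  have := hC.isFiniteMeasure
  have hR : 1 < R := by linarith
  have hR0 : 0 ≤ R := by linarith
  have hp0 : 0 < p := by linarith
  set γ := N * (R / p - 1) + 1
  set V : ℝ≥0∞ := volume (ball (0 : EuclideanSpace ℝ (Fin N)) r)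
  have hV0 : V ≠ 0 := (measure_ball_pos _ _ hC.r_pos).ne'
  have hVt : V ≠ ⊤ := measure_ball_lt_top.ne
  have hp1 : 0 ≤ 1 - 1 / p := by
    rw [sub_nonneg, div_le_one hp0]; exact hp.le
  set B : ℝ≥0∞ := V⁻¹ * ENNReal.ofReal M * V ^ (1 - 1 / p)
  have hBt : B ≠ ⊤ := ENNReal.mul_ne_top (ENNReal.mul_ne_top (ENNReal.inv_ne_top.2 hV0)
    ENNReal.ofReal_ne_top) (ENNReal.rpow_ne_top_of_nonneg hp1 hVt)
  refine ⟨B ^ R * weightedHolderConst R γ * ENNReal.ofReal L,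
    ENNReal.mul_ne_top (ENNReal.mul_ne_top (ENNReal.rpow_ne_top_of_nonneg hR0 hBt)
      (weightedHolderConst_ne_top hR)) ENNReal.ofReal_ne_top, fun φ hφ ε hε hεδ => ?_⟩
  have hΦm : Measurable (Function.uncurry fun (x : EuclideanSpace ℝ (Fin N)) (s : ℝ) =>
      (∫⁻ d in ball 0 r, ‖gradient φ (x - s • (gradient f x + d))‖ₑ ^ p) ^ (1 / p)) :=
    ((measurable_enorm_gradient_cone hC.contDiff_one hφ p).lintegral_prod_right'
      (ν := volume.restrict (ball 0 r))).pow_const _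
  have hpt : ∀ x ∈ frontier Ω, ‖φ x - coneAverage f r ε φ x‖ₑ ≤
      B * ∫⁻ s in Ioo 0 ε,
        (∫⁻ d in ball 0 r, ‖gradient φ (x - s • (gradient f x + d))‖ₑ ^ p) ^ (1 / p) := by
    intro x hx
    refine (hC.enorm_sub_coneAverage_le hp hφ hε hx).trans (le_of_eq ?_)
    rw [← mul_assoc, ← mul_assoc]
  calc ∫⁻ x, ‖φ x - coneAverage f r ε φ x‖ₑ ^ R ∂(bdryMeasure Ω)
      ≤ ∫⁻ x, B ^ R * (∫⁻ s in Ioo 0 ε, (∫⁻ d in ball 0 r,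
          ‖gradient φ (x - s • (gradient f x + d))‖ₑ ^ p) ^ (1 / p)) ^ R ∂(bdryMeasure Ω) := by
        refine lintegral_mono_ae ?_
        filter_upwards [ae_mem_frontier Ω] with x hx
        rw [← ENNReal.mul_rpow_of_nonneg _ _ hR0]
        exact ENNReal.rpow_le_rpow (hpt x hx) hR0
    _ = B ^ R * ∫⁻ x, (∫⁻ s in Ioo 0 ε, (∫⁻ d in ball 0 r,
          ‖gradient φ (x - s • (gradient f x + d))‖ₑ ^ p) ^ (1 / p)) ^ R ∂(bdryMeasure Ω) :=
        lintegral_const_mul _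
          ((hΦm.lintegral_prod_right' (ν := volume.restrict (Ioo 0 ε))).pow_const R)
    _ ≤ B ^ R * (weightedHolderConst R γ * ENNReal.ofReal (ε ^ (R - γ)) *
          (ENNReal.ofReal L * (∫⁻ w in Ω, ‖gradient φ w‖ₑ ^ p) ^ (R / p))) := by
        refine mul_le_mul' le_rfl (lintegral_lintegral_Ioo_rpow_le _ hΦm hR hsub hε
          fun s hs hsε => ?_)
        exact hC.lintegral_cone_gradient_rpow_le hp hpR hφ hs (hsε.trans hεδ)
    _ = _ := by ring

end IsCollar

end ConeAverage

section WeakCompactness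

theorem eLpNorm_ofReal_eq {α F : Type*} [MeasurableSpace α] [NormedAddCommGroup F]
    (μ : Measure α) {p : ℝ} (hp : 0 < p) (g : α → F) :
    eLpNorm g (ENNReal.ofReal p) μ = (∫⁻ x, ‖g x‖ₑ ^ p ∂μ) ^ (1 / p) := by
  rw [eLpNorm_eq_lintegral_rpow_enorm_toReal (by simpa using hp) ENNReal.ofReal_ne_top,
    ENNReal.toReal_ofReal hp.le]

theorem eLpNorm_ofReal_rpow {α F : Type*} [MeasurableSpace α] [NormedAddCommGroup F]
    (μ : Measure α) {p : ℝ} (hp : 0 < p) (g : α → F) :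
    eLpNorm g (ENNReal.ofReal p) μ ^ p = ∫⁻ x, ‖g x‖ₑ ^ p ∂μ := by
  rw [eLpNorm_ofReal_eq μ hp, ← ENNReal.rpow_mul, one_div_mul_cancel hp.ne', ENNReal.rpow_one]

/-- A bounded sequence in `L^p`, `1 < p < ∞`, has a subsequence whose integrals over every
measurable set converge. -/
theorem exists_subseq_tendsto_setIntegral {α : Type*} [MeasurableSpace α]
    [MeasurableSpace.CountablyGenerated α] (μ : Measure α)
    [IsFiniteMeasure μ] {p : ℝ} (hp : 1 < p) {u : ℕ → α → ℝ}
    (hu : ∀ n, MemLp (u n) (ENNReal.ofReal p) μ) {C : ℝ≥0∞} (hC : C ≠ ⊤)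
    (hb : ∀ n, eLpNorm (u n) (ENNReal.ofReal p) μ ≤ C) :
    ∃ ns : ℕ → ℕ, StrictMono ns ∧ ∀ A, MeasurableSet A →
      ∃ a, Tendsto (fun n => ∫ x in A, u (ns n) x ∂μ) atTop (𝓝 a) := by
  have hconj := Real.HolderConjugate.conjExponent hp
  set q := p.conjExponent
  have hq1 : 1 < q := hconj.symm.lt
  have : ENNReal.HolderConjugate (ENNReal.ofReal p) (ENNReal.ofReal q) :=
    hconj.ennrealOfReal
  have : Fact (1 ≤ ENNReal.ofReal p) := ⟨by simpa using hp.le⟩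
  have : Fact (1 ≤ ENNReal.ofReal q) := ⟨by simpa using hq1.le⟩
  have : Fact (ENNReal.ofReal q ≠ ⊤) := ⟨ENNReal.ofReal_ne_top⟩
  let B := (ContinuousLinearMap.mul ℝ ℝ).lpPairing μ (ENNReal.ofReal p) (ENNReal.ofReal q)
  let T : ℕ → WeakDual ℝ (Lp ℝ (ENNReal.ofReal q) μ) := fun n =>
    StrongDual.toWeakDual (B ((hu n).toLp (u n)))
  have hT : ∀ n, T n ∈ WeakDual.toStrongDual ⁻¹' Metric.closedBall
      (0 : StrongDual ℝ (Lp ℝ (ENNReal.ofReal q) μ)) (‖B‖ * C.toReal) := by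
    intro n
    simp only [mem_preimage, mem_closedBall_zero_iff]
    refine (B.le_opNorm _).trans ?_
    gcongr
    rw [Lp.norm_toLp]
    exact ENNReal.toReal_mono hC (hb n)
  obtain ⟨T₀, -, ns, hns, hlim⟩ := WeakDual.isSeqCompact_closedBall ℝ _ _ _ hT
  refine ⟨ns, hns, fun A hA => ?_⟩
  let g : Lp ℝ (ENNReal.ofReal q) μ := indicatorConstLp _ hA (measure_ne_top μ A) 1
  refine ⟨T₀ g, ?_⟩
  have h1 : Tendsto (fun n => T (ns n) g) atTop (𝓝 (T₀ g)) :=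
    ((WeakDual.eval_continuous g).tendsto _).comp hlim
  refine h1.congr fun n => ?_
  change B ((hu (ns n)).toLp _) g = _
  rw [ContinuousLinearMap.lpPairing_eq_integral, ← integral_indicator hA]
  refine integral_congr_ae ?_
  filter_upwards [(hu (ns n)).coeFn_toLp,
    indicatorConstLp_coeFn (p := ENNReal.ofReal q) (hs := hA) (hμs := measure_ne_top μ A)
      (c := (1 : ℝ))] with x h2 h3
  rw [h2, h3]
  by_cases hx : x ∈ A <;> simp [hx]

end WeakCompactness

section TraceCompactness

open Metric

variable {N : ℕ} {Ω : Set (EuclideanSpace ℝ (Fin N))} {f : EuclideanSpace ℝ (Fin N) → ℝ}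
  {r δ c M L : ℝ}

theorem memLp_of_continuous_of_ae_mem {F : Type*} [NormedAddCommGroup F]
    [SecondCountableTopology F] {μ : Measure (EuclideanSpace ℝ (Fin N))} [IsFiniteMeasure μ]
    {S : Set (EuclideanSpace ℝ (Fin N))} (hS : IsCompact S) (hμ : ∀ᵐ x ∂μ, x ∈ S)
    {g : EuclideanSpace ℝ (Fin N) → F} (hg : Continuous g) (P : ℝ≥0∞) : MemLp g P μ := by
  obtain ⟨B, hB⟩ := hS.exists_bound_of_continuousOn hg.continuousOn
  exact MemLp.of_bound hg.aestronglyMeasurable B (hμ.mono fun x hx => hB x hx)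

theorem isFiniteMeasure_restrict_of_isBounded (hΩb : IsBounded Ω) :
    IsFiniteMeasure (volume.restrict Ω) :=
  ⟨by rw [Measure.restrict_apply_univ]; exact hΩb.measure_lt_top⟩

theorem memLp_restrict_of_continuous {F : Type*} [NormedAddCommGroup F]
    [SecondCountableTopology F] (hΩm : MeasurableSet Ω) (hΩb : IsBounded Ω)
    {g : EuclideanSpace ℝ (Fin N) → F} (hg : Continuous g) (P : ℝ≥0∞) :
    MemLp g P (volume.restrict Ω) :=
  have := isFiniteMeasure_restrict_of_isBounded hΩb
  memLp_of_continuous_of_ae_mem hΩb.isCompact_closure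
    ((ae_restrict_mem hΩm).mono fun _ hx => subset_closure hx) hg P

theorem isCompact_frontier_of_isBounded (hΩb : IsBounded Ω) : IsCompact (frontier Ω) :=
  hΩb.isCompact_closure.of_isClosed_subset isClosed_frontier frontier_subset_closure

theorem memLp_bdryMeasure_of_continuous {F : Type*} [NormedAddCommGroup F]
    [SecondCountableTopology F] [IsFiniteMeasure (bdryMeasure Ω)] (hΩb : IsBounded Ω)
    {g : EuclideanSpace ℝ (Fin N) → F} (hg : Continuous g) (P : ℝ≥0∞) :
    MemLp g P (bdryMeasure Ω) :=
  memLp_of_continuous_of_ae_mem (isCompact_frontier_of_isBounded hΩb) (ae_mem_frontier Ω) hg P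

theorem gradient_sub_of_contDiff {φ ψ : EuclideanSpace ℝ (Fin N) → ℝ} (hφ : ContDiff ℝ 1 φ)
    (hψ : ContDiff ℝ 1 ψ) (x : EuclideanSpace ℝ (Fin N)) :
    gradient (fun y => φ y - ψ y) x = gradient φ x - gradient ψ x := by
  rw [gradient, fderiv_fun_sub (hφ.differentiable one_ne_zero).differentiableAt
    (hψ.differentiable one_ne_zero).differentiableAt, map_sub]
  rfl

theorem coneAverage_sub {φ ψ : EuclideanSpace ℝ (Fin N) → ℝ} (hφ : Continuous φ)
    (hψ : Continuous ψ) (r ε : ℝ) (x : EuclideanSpace ℝ (Fin N)) :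
    coneAverage f r ε (fun y => φ y - ψ y) x =
      coneAverage f r ε φ x - coneAverage f r ε ψ x := by
  rw [coneAverage, coneAverage, coneAverage, average_eq, average_eq, average_eq,
    integral_sub (integrableOn_ball_cone hφ x _ r ε) (integrableOn_ball_cone hψ x _ r ε), smul_sub]

theorem stronglyMeasurable_coneAverage (hf : ContDiff ℝ 1 f)
    {φ : EuclideanSpace ℝ (Fin N) → ℝ} (hφ : Continuous φ) (r ε : ℝ) :
    StronglyMeasurable (coneAverage f r ε φ) := by
  have h1 := continuous_gradient hf
  have h2 : Continuous fun q : EuclideanSpace ℝ (Fin N) × EuclideanSpace ℝ (Fin N) =>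
      φ (q.1 - ε • (gradient f q.1 + q.2)) := by fun_prop
  have h3 := h2.stronglyMeasurable.integral_prod_right' (ν := volume.restrict (ball 0 r))
  have h4 : coneAverage f r ε φ = fun x =>
      ((volume.restrict (ball (0 : EuclideanSpace ℝ (Fin N)) r)).real univ)⁻¹ •
        ∫ d in ball 0 r, φ (x - ε • (gradient f x + d)) := by
    funext x
    rw [coneAverage, average_eq]
  rw [h4]
  exact h3.const_smul ((volume.restrict (ball (0 : EuclideanSpace ℝ (Fin N)) r)).real univ)⁻¹

namespace IsCollar

theorem coneAverage_eq (hC : IsCollar Ω f r δ c M L) {x : EuclideanSpace ℝ (Fin N)}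
    (hx : x ∈ frontier Ω) {ε : ℝ} (hε : 0 < ε) (hεδ : ε < δ)
    {φ : EuclideanSpace ℝ (Fin N) → ℝ} (hφ : Continuous φ) :
    coneAverage f r ε φ x =
      ((volume.restrict (ball (0 : EuclideanSpace ℝ (Fin N)) r)).real univ)⁻¹ •
        ((ENNReal.ofReal (ε ^ N))⁻¹).toReal •
          ∫ w in {w | ‖x - w - ε • gradient f x‖ < r * ε}, φ w ∂(volume.restrict Ω) := by
  have hmeas : MeasurableSet {w : EuclideanSpace ℝ (Fin N) | ‖x - w - ε • gradient f x‖ < r * ε} :=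
    (isOpen_lt (by fun_prop) continuous_const).measurableSet
  rw [coneAverage, average_eq]
  congr 1
  rw [Measure.restrict_restrict hmeas, inter_eq_left.2 (hC.cone_subset hx hε hεδ),
    ← integral_smul_measure, ← map_cone_restrict x (gradient f x) hε,
    integral_map (by fun_prop) hφ.aestronglyMeasurable]

theorem exists_enorm_coneAverage_le (hC : IsCollar Ω f r δ c M L) {p : ℝ} (hp : 1 < p) {ε : ℝ}
    (hε : 0 < ε) (hεδ : ε < δ) :
    ∃ K : ℝ≥0∞, K ≠ ⊤ ∧ ∀ φ : EuclideanSpace ℝ (Fin N) → ℝ, Continuous φ → ∀ x ∈ frontier Ω,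
      ‖coneAverage f r ε φ x‖ₑ ≤ K * eLpNorm φ (ENNReal.ofReal p) (volume.restrict Ω) := by
  have hp0 : 0 < p := by linarith
  set V : ℝ≥0∞ := volume (ball (0 : EuclideanSpace ℝ (Fin N)) r)
  have hV0 : V ≠ 0 := (measure_ball_pos _ _ hC.r_pos).ne'
  have hVt : V ≠ ⊤ := measure_ball_lt_top.ne
  have hp1 : 0 ≤ 1 - 1 / p := by
    rw [sub_nonneg, div_le_one hp0]; exact hp.le
  have hp2 : 0 ≤ 1 / p := by positivity
  refine ⟨V⁻¹ * (((ENNReal.ofReal (ε ^ N))⁻¹) ^ (1 / p) * V ^ (1 - 1 / p)),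
    ENNReal.mul_ne_top (ENNReal.inv_ne_top.2 hV0) (ENNReal.mul_ne_top
      (ENNReal.rpow_ne_top_of_nonneg hp2 (ENNReal.inv_ne_top.2 (by positivity)))
      (ENNReal.rpow_ne_top_of_nonneg hp1 hVt)), fun φ hφ x hx => ?_⟩
  have h1 : ‖coneAverage f r ε φ x‖ₑ ≤
      V⁻¹ * ∫⁻ d in ball 0 r, ‖φ (x - ε • (gradient f x + d))‖ₑ := by
    rw [coneAverage, average]
    refine (enorm_integral_le_lintegral_enorm _).trans (le_of_eq ?_)
    rw [lintegral_smul_measure, smul_eq_mul, Measure.restrict_apply_univ]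
  have h2 := lintegral_le_lintegral_rpow_mul
    (volume.restrict (ball (0 : EuclideanSpace ℝ (Fin N)) r)) hp
    (F := fun d => ‖φ (x - ε • (gradient f x + d))‖ₑ)
    (by fun_prop : Continuous fun d => φ (x - ε • (gradient f x + d))).measurable.enorm.aemeasurable
  rw [Measure.restrict_apply_univ] at h2
  have h3 := hC.lintegral_cone_le hx hε hεδ (hφ.measurable.enorm.pow_const p)
  calc ‖coneAverage f r ε φ x‖ₑ ≤ V⁻¹ * (((ENNReal.ofReal (ε ^ N))⁻¹ *
        ∫⁻ w in Ω, ‖φ w‖ₑ ^ p) ^ (1 / p) * V ^ (1 - 1 / p)) :=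
        h1.trans (mul_le_mul' le_rfl (h2.trans (mul_le_mul' (ENNReal.rpow_le_rpow h3 hp2) le_rfl)))
    _ = _ := by
        rw [ENNReal.mul_rpow_of_nonneg _ _ hp2, eLpNorm_ofReal_eq _ hp0]
        ring

theorem exists_eLpNorm_sub_coneAverage_le (hC : IsCollar Ω f r δ c M L) {p R : ℝ} (hp : 1 < p)
    (hpR : p ≤ R) (hsub : N * (R / p - 1) + 1 < R) :
    ∃ K : ℝ → ℝ≥0∞, (∀ ε, K ε ≠ ⊤) ∧ Tendsto K (𝓝[>] 0) (𝓝 0) ∧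
      ∀ φ : EuclideanSpace ℝ (Fin N) → ℝ, ContDiff ℝ 1 φ → ∀ ε, 0 < ε → ε < δ →
      eLpNorm (fun x => φ x - coneAverage f r ε φ x) (ENNReal.ofReal R) (bdryMeasure Ω) ≤
        K ε * eLpNorm (gradient φ) (ENNReal.ofReal p) (volume.restrict Ω) := by
  obtain ⟨K, hK, h⟩ := hC.exists_lintegral_sub_coneAverage_le hp hpR hsub
  have hR0 : 0 < R := by linarith
  have hp0 : 0 < p := by linarith
  set κ := R - (N * (R / p - 1) + 1)
  have hκ : 0 < κ := by simp only [κ]; linarith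
  refine ⟨fun ε => (K * ENNReal.ofReal (ε ^ κ)) ^ (1 / R), fun ε =>
    ENNReal.rpow_ne_top_of_nonneg (by positivity) (ENNReal.mul_ne_top hK ENNReal.ofReal_ne_top),
    ?_, fun φ hφ ε hε hεδ => ?_⟩
  · have h1 : Tendsto (fun ε : ℝ => ε ^ κ) (𝓝[>] 0) (𝓝 0) := by
      have := (Real.continuousAt_rpow_const 0 κ (Or.inr hκ.le)).tendsto
      rw [Real.zero_rpow hκ.ne'] at this
      exact this.mono_left nhdsWithin_le_nhds
    have h2 := (ENNReal.continuous_ofReal.tendsto 0).comp h1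
    rw [ENNReal.ofReal_zero] at h2
    have h3 := ENNReal.Tendsto.const_mul (a := K) h2 (Or.inr hK)
    rw [mul_zero] at h3
    have h4 := (ENNReal.continuous_rpow_const (y := 1 / R)).tendsto 0
    rw [ENNReal.zero_rpow_of_pos (by positivity)] at h4
    exact h4.comp h3
  · rw [eLpNorm_ofReal_eq _ hR0, eLpNorm_ofReal_eq _ hp0]
    refine (ENNReal.rpow_le_rpow (h φ hφ ε hε hεδ) (by positivity)).trans (le_of_eq ?_)
    rw [ENNReal.mul_rpow_of_nonneg _ _ (by positivity), ← ENNReal.rpow_mul (∫⁻ _ in Ω, _)]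
    congr 2
    field_simp

/-- The trace inequality, for functions that are smooth up to the boundary. -/
theorem exists_eLpNorm_bdry_le (hC : IsCollar Ω f r δ c M L) {p R : ℝ} (hp : 1 < p)
    (hpR : p ≤ R) (hsub : N * (R / p - 1) + 1 < R) :
    ∃ K : ℝ≥0∞, K ≠ ⊤ ∧ ∀ φ : EuclideanSpace ℝ (Fin N) → ℝ, ContDiff ℝ 1 φ →
      eLpNorm φ (ENNReal.ofReal R) (bdryMeasure Ω) ≤
        K * (eLpNorm φ (ENNReal.ofReal p) (volume.restrict Ω) +
          eLpNorm (gradient φ) (ENNReal.ofReal p) (volume.restrict Ω)) := by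
  have := hC.isFiniteMeasure
  obtain ⟨K₁, hK₁, -, h₁⟩ := hC.exists_eLpNorm_sub_coneAverage_le hp hpR hsub
  have hε : 0 < δ / 2 := half_pos hC.δ_pos
  have hεδ : δ / 2 < δ := half_lt_self hC.δ_pos
  obtain ⟨K₂, hK₂, h₂⟩ := hC.exists_enorm_coneAverage_le hp hε hεδ
  have hR0 : 0 < R := by linarith
  set b : ℝ≥0∞ := bdryMeasure Ω univ ^ (1 / R)
  have hb : b ≠ ⊤ := ENNReal.rpow_ne_top_of_nonneg (by positivity) (measure_ne_top _ _)
  refine ⟨K₁ (δ / 2) + K₂ * b, ENNReal.add_ne_top.2 ⟨hK₁ _, ENNReal.mul_ne_top hK₂ hb⟩,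
    fun φ hφ => ?_⟩
  set A := eLpNorm φ (ENNReal.ofReal p) (volume.restrict Ω)
  set B := eLpNorm (gradient φ) (ENNReal.ofReal p) (volume.restrict Ω)
  have hav := (stronglyMeasurable_coneAverage (f := f) hC.contDiff_one hφ.continuous r
    (δ / 2)).aestronglyMeasurable (μ := bdryMeasure Ω)
  have h3 : eLpNorm (coneAverage f r (δ / 2) φ) (ENNReal.ofReal R) (bdryMeasure Ω) ≤
      K₂ * A * b := by
    rw [eLpNorm_ofReal_eq _ hR0]
    calc (∫⁻ x, ‖coneAverage f r (δ / 2) φ x‖ₑ ^ R ∂(bdryMeasure Ω)) ^ (1 / R)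
        ≤ (∫⁻ _, (K₂ * A) ^ R ∂(bdryMeasure Ω)) ^ (1 / R) := by
          refine ENNReal.rpow_le_rpow (lintegral_mono_ae ?_) (by positivity)
          filter_upwards [ae_mem_frontier Ω] with x hx
          exact ENNReal.rpow_le_rpow (h₂ φ hφ.continuous x hx) hR0.le
      _ = _ := by
          rw [lintegral_const, ENNReal.mul_rpow_of_nonneg _ _ (by positivity), ← ENNReal.rpow_mul,
            mul_one_div_cancel hR0.ne', ENNReal.rpow_one]
  have h4 := eLpNorm_add_le (p := ENNReal.ofReal R)
    ((hφ.continuous.aestronglyMeasurable (μ := bdryMeasure Ω)).sub hav) hav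
    (by simpa using (by linarith : 1 ≤ R))
  rw [sub_add_cancel] at h4
  calc eLpNorm φ (ENNReal.ofReal R) (bdryMeasure Ω) ≤ K₁ (δ / 2) * B + K₂ * A * b :=
        h4.trans (add_le_add (h₁ φ hφ _ hε hεδ) h3)
    _ = K₁ (δ / 2) * B + K₂ * b * A := by ring
    _ ≤ (K₁ (δ / 2) + K₂ * b) * B + (K₁ (δ / 2) + K₂ * b) * A := by
        gcongr
        · exact le_self_add
        · exact le_add_self
    _ = _ := by ring

/-- The embedding of `W^{1,p}(Ω)` in `L^R(∂Ω)` is compact for every subcritical `R`. -/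
theorem exists_subseq_tendsto_eLpNorm_sub (hC : IsCollar Ω f r δ c M L) (hΩb : IsBounded Ω)
    {p R : ℝ} (hp : 1 < p) (hpR : p ≤ R) (hsub : N * (R / p - 1) + 1 < R)
    {φ : ℕ → EuclideanSpace ℝ (Fin N) → ℝ} (hφ : ∀ n, ContDiff ℝ 1 (φ n)) {B : ℝ≥0∞}
    (hB : B ≠ ⊤) (hφB : ∀ n, eLpNorm (φ n) (ENNReal.ofReal p) (volume.restrict Ω) ≤ B)
    (hgB : ∀ n, eLpNorm (gradient (φ n)) (ENNReal.ofReal p) (volume.restrict Ω) ≤ B) :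
    ∃ ns : ℕ → ℕ, StrictMono ns ∧
      Tendsto (fun q : ℕ × ℕ => eLpNorm (fun x => φ (ns q.1) x - φ (ns q.2) x)
        (ENNReal.ofReal R) (bdryMeasure Ω)) atTop (𝓝 0) := by
  have := hC.isFiniteMeasure
  have := isFiniteMeasure_restrict_of_isBounded hΩb
  have hR0 : 0 < R := by linarith
  have hR1 : 1 ≤ ENNReal.ofReal R := by simpa using (by linarith : 1 ≤ R)
  obtain ⟨ns, hns, hconv⟩ := exists_subseq_tendsto_setIntegral (volume.restrict Ω) hp
    (fun n => memLp_restrict_of_continuous hC.measurableSet hΩb (hφ n).continuous _) hB hφB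
  obtain ⟨K, hK, hK0, h₁⟩ := hC.exists_eLpNorm_sub_coneAverage_le hp hpR hsub
  refine ⟨ns, hns, ?_⟩
  have hm : ∀ n ε, AEStronglyMeasurable (coneAverage f r ε (φ n)) (bdryMeasure Ω) := fun n ε =>
    (stronglyMeasurable_coneAverage hC.contDiff_one (hφ n).continuous r ε).aestronglyMeasurable
  have hlim : ∀ ε, 0 < ε → ε < δ → ∃ a : EuclideanSpace ℝ (Fin N) → ℝ,
      AEStronglyMeasurable a (bdryMeasure Ω) ∧
      Tendsto (fun n => eLpNorm (fun x => coneAverage f r ε (φ (ns n)) x - a x)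
        (ENNReal.ofReal R) (bdryMeasure Ω)) atTop (𝓝 0) := by
    intro ε hε hεδ
    have hpt : ∀ x, ∃ a, x ∈ frontier Ω →
        Tendsto (fun n => coneAverage f r ε (φ (ns n)) x) atTop (𝓝 a) := by
      intro x
      by_cases hx : x ∈ frontier Ω
      · obtain ⟨a, ha⟩ := hconv {w | ‖x - w - ε • gradient f x‖ < r * ε}
          (isOpen_lt (by fun_prop) continuous_const).measurableSet
        refine ⟨_, fun _ => Tendsto.congr (fun n => ?_) ((ha.const_smul
          (((ENNReal.ofReal (ε ^ N))⁻¹).toReal)).const_smul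
          (((volume.restrict (ball (0 : EuclideanSpace ℝ (Fin N)) r)).real univ)⁻¹))⟩
        exact (hC.coneAverage_eq hx hε hεδ (hφ (ns n)).continuous).symm
      · exact ⟨0, fun h => absurd h hx⟩
    choose a ha using hpt
    have hae : ∀ᵐ x ∂(bdryMeasure Ω),
        Tendsto (fun n => coneAverage f r ε (φ (ns n)) x) atTop (𝓝 (a x)) :=
      (ae_mem_frontier Ω).mono fun x hx => ha x hx
    have ham : AEStronglyMeasurable a (bdryMeasure Ω) :=
      aestronglyMeasurable_of_tendsto_ae atTop (fun n => hm (ns n) ε) hae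
    refine ⟨a, ham, ?_⟩
    obtain ⟨K₂, hK₂, h₂⟩ := hC.exists_enorm_coneAverage_le hp hε hεδ
    have hbd : ∀ n, ∀ x ∈ frontier Ω, ‖coneAverage f r ε (φ (ns n)) x‖ ≤ (K₂ * B).toReal := by
      intro n x hx
      rw [← toReal_enorm]
      exact ENNReal.toReal_mono (ENNReal.mul_ne_top hK₂ hB)
        ((h₂ _ (hφ (ns n)).continuous x hx).trans (mul_le_mul' le_rfl (hφB _)))
    exact tendsto_Lp_finite_of_tendsto_ae hR1 ENNReal.ofReal_ne_top (fun n => hm (ns n) ε)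
      (MemLp.of_bound ham (K₂ * B).toReal (by
        filter_upwards [ae_mem_frontier Ω] with x hx
        exact le_of_tendsto (ha x hx).norm (Eventually.of_forall fun n => hbd n x hx)))
      (unifIntegrable_of hR1 ENNReal.ofReal_ne_top (fun n => hm (ns n) ε) fun ρ _ =>
        ⟨(K₂ * B).toNNReal + 1, fun n => by
          refine le_of_eq_of_le ?_ zero_le
          rw [← eLpNorm_zero (α := EuclideanSpace ℝ (Fin N)) (ε := ℝ)
            (μ := bdryMeasure Ω) (p := ENNReal.ofReal R)]
          refine eLpNorm_congr_ae ?_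
          filter_upwards [ae_mem_frontier Ω] with x hx
          refine indicator_of_notMem (fun hmem => ?_) _
          have h3 : (K₂ * B).toReal + 1 ≤ ‖coneAverage f r ε (φ (ns n)) x‖ := by
            exact_mod_cast (show (K₂ * B).toNNReal + 1 ≤ ‖coneAverage f r ε (φ (ns n)) x‖₊ from hmem)
          linarith [hbd n x hx]⟩) hae
  rw [ENNReal.tendsto_nhds_zero]
  intro η hη
  have h2B : B + B ≠ ⊤ := ENNReal.add_ne_top.2 ⟨hB, hB⟩
  have hsmall : ∀ᶠ ε in 𝓝[>] (0 : ℝ), K ε * (B + B) ≤ η / 2 := by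
    have h3 := ENNReal.Tendsto.mul_const (b := B + B) hK0 (Or.inr h2B)
    rw [zero_mul] at h3
    exact ENNReal.tendsto_nhds_zero.1 h3 _ (ENNReal.half_pos hη.ne')
  obtain ⟨ε, hKε, hε, hεδ⟩ := (hsmall.and (Ioo_mem_nhdsGT hC.δ_pos)).exists
  obtain ⟨a, ham, ha⟩ := hlim ε hε hεδ
  obtain ⟨n₀, hn₀⟩ := eventually_atTop.1
    (ENNReal.tendsto_nhds_zero.1 ha _ (ENNReal.half_pos (ENNReal.half_pos hη.ne').ne'))
  filter_upwards [eventually_ge_atTop (n₀, n₀)] with q hq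
  have hm1 := (hm (ns q.1) ε).sub ham
  have hm2 := (hm (ns q.2) ε).sub ham
  have hd : ContDiff ℝ 1 fun x => φ (ns q.1) x - φ (ns q.2) x := (hφ _).sub (hφ _)
  have hg : eLpNorm (gradient fun x => φ (ns q.1) x - φ (ns q.2) x) (ENNReal.ofReal p)
      (volume.restrict Ω) ≤ B + B := by
    have : (gradient fun x => φ (ns q.1) x - φ (ns q.2) x) =
        gradient (φ (ns q.1)) - gradient (φ (ns q.2)) := by
      funext x
      exact gradient_sub_of_contDiff (hφ _) (hφ _) x
    rw [this]
    exact (eLpNorm_sub_le (continuous_gradient (hφ _)).aestronglyMeasurable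
      (continuous_gradient (hφ _)).aestronglyMeasurable (by simpa using hp.le)).trans
      (add_le_add (hgB _) (hgB _))
  have h3 := (h₁ _ hd ε hε hεδ).trans ((mul_le_mul' le_rfl hg).trans hKε)
  have hsplit : (fun x => φ (ns q.1) x - φ (ns q.2) x) =
      (fun x => (φ (ns q.1) x - φ (ns q.2) x) -
        coneAverage f r ε (fun x => φ (ns q.1) x - φ (ns q.2) x) x) +
      ((fun x => coneAverage f r ε (φ (ns q.1)) x - a x) -
        fun x => coneAverage f r ε (φ (ns q.2)) x - a x) := by
    funext x
    simp only [Pi.add_apply, Pi.sub_apply]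
    rw [coneAverage_sub (hφ _).continuous (hφ _).continuous]
    ring
  rw [hsplit]
  refine (eLpNorm_add_le (hd.continuous.aestronglyMeasurable.sub
    (stronglyMeasurable_coneAverage hC.contDiff_one hd.continuous r ε).aestronglyMeasurable)
    (hm1.sub hm2) hR1).trans ?_
  refine (add_le_add h3 ((eLpNorm_sub_le hm1 hm2 hR1).trans
    (add_le_add (hn₀ q.1 hq.1) (hn₀ q.2 hq.2)))).trans ?_
  rw [ENNReal.add_halves, ENNReal.add_halves]

end IsCollar

end TraceCompactness

section Strip

open Metric

variable {N : ℕ} {Ω : Set (EuclideanSpace ℝ (Fin N))} {f : EuclideanSpace ℝ (Fin N) → ℝ}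
  {r δ c M L : ℝ}

/-- The density of the measure obtained by spreading the surface measure over the truncated cones
of height `a` with vertices on `∂Ω`. -/
noncomputable def coneDensity (Ω : Set (EuclideanSpace ℝ (Fin N)))
    (f : EuclideanSpace ℝ (Fin N) → ℝ) (r a : ℝ) (w : EuclideanSpace ℝ (Fin N)) : ℝ≥0∞ :=
  ∫⁻ τ in Ioo 0 a, (ENNReal.ofReal (τ ^ N))⁻¹ *
    bdryMeasure Ω {x | ‖x - w - τ • gradient f x‖ < r * τ}

namespace IsCollar

theorem measurable_coneDensity_integrand (hC : IsCollar Ω f r δ c M L) :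
    Measurable fun q : ℝ × EuclideanSpace ℝ (Fin N) => (ENNReal.ofReal (q.1 ^ N))⁻¹ *
      bdryMeasure Ω {x | ‖x - q.2 - q.1 • gradient f x‖ < r * q.1} := by
  have := hC.isFiniteMeasure
  have hm : MeasurableSet {q : (ℝ × EuclideanSpace ℝ (Fin N)) × EuclideanSpace ℝ (Fin N) |
      ‖q.2 - q.1.2 - q.1.1 • gradient f q.2‖ < r * q.1.1} := by
    have := hC.continuous_grad
    exact (isOpen_lt (by fun_prop) (by fun_prop)).measurableSet
  exact (by fun_prop : Measurable fun q : ℝ × EuclideanSpace ℝ (Fin N) =>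
    (ENNReal.ofReal (q.1 ^ N))⁻¹).mul (measurable_measure_prodMk_left hm)

theorem lintegral_cones_eq (hC : IsCollar Ω f r δ c M L) (a : ℝ)
    {h : EuclideanSpace ℝ (Fin N) → ℝ≥0∞} (hh : Measurable h) :
    ∫⁻ τ in Ioo 0 a, (∫⁻ x, (∫⁻ d in ball 0 r, h (x - τ • (gradient f x + d)))
      ∂(bdryMeasure Ω)) = ∫⁻ w, h w * coneDensity Ω f r a w := by
  have := hC.isFiniteMeasure
  have hm := hC.measurable_coneDensity_integrand
  set F : ℝ → EuclideanSpace ℝ (Fin N) → ℝ≥0∞ := fun τ w => (ENNReal.ofReal (τ ^ N))⁻¹ *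
    bdryMeasure Ω {x | ‖x - w - τ • gradient f x‖ < r * τ}
  have hFm : Measurable (Function.uncurry F) := hm
  have h1 : ∀ w, coneDensity Ω f r a w = ∫⁻ τ in Ioo 0 a, F τ w := fun w => rfl
  have h2 : ∀ τ ∈ Ioo 0 a, ∫⁻ x, (∫⁻ d in ball 0 r, h (x - τ • (gradient f x + d)))
      ∂(bdryMeasure Ω) = ∫⁻ w, h w * F τ w := fun τ hτ =>
    hC.lintegral_lintegral_cone_eq hτ.1 hh
  clear_value F
  have hsw : Measurable (Function.uncurry fun (τ : ℝ) (w : EuclideanSpace ℝ (Fin N)) =>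
      h w * F τ w) := (hh.comp measurable_snd).mul hFm
  have h3 : ∫⁻ τ in Ioo 0 a, (∫⁻ w, h w * F τ w) = ∫⁻ w, (∫⁻ τ in Ioo 0 a, h w * F τ w) :=
    lintegral_lintegral_swap hsw.aemeasurable
  have h4 : ∀ w, ∫⁻ τ in Ioo 0 a, h w * F τ w = h w * coneDensity Ω f r a w := by
    intro w
    have hFw : Measurable fun τ => F τ w := hFm.comp (measurable_prodMk_right (y := w))
    rw [h1, lintegral_const_mul _ hFw]
  exact (setLIntegral_congr_fun measurableSet_Ioo h2).trans (h3.trans (lintegral_congr h4))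

theorem enorm_rpow_cone_le (hC : IsCollar Ω f r δ c M L) {p : ℝ} (hp : 1 < p)
    {φ : EuclideanSpace ℝ (Fin N) → ℝ} (hφ : ContDiff ℝ 1 φ) {a τ : ℝ} (hτ : τ ∈ Ioo 0 a)
    {x d : EuclideanSpace ℝ (Fin N)} (hx : x ∈ frontier Ω) (hd : ‖d‖ < r) :
    ‖φ (x - τ • (gradient f x + d))‖ₑ ^ p ≤ 2 ^ (p - 1) * (‖φ x‖ₑ ^ p +
      ENNReal.ofReal M ^ p * (ENNReal.ofReal a ^ (p - 1) *
        ∫⁻ s in Ioo 0 a, ‖gradient φ (x - s • (gradient f x + d))‖ₑ ^ p)) := by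
  have hp0 : 0 < p := by linarith
  set z := gradient f x + d
  have hz : ‖z‖ₑ ≤ ENNReal.ofReal M := by
    rw [← ofReal_norm]
    exact ENNReal.ofReal_le_ofReal (hC.norm_le x hx d hd)
  have h1 : ‖φ (x - τ • z)‖ₑ ≤ ‖φ x‖ₑ + ‖φ x - φ (x - τ • z)‖ₑ := by
    have := enorm_sub_le (E := ℝ) (a := φ x) (b := φ x - φ (x - τ • z))
    rwa [sub_sub_cancel] at this
  have hgm : Measurable fun s : ℝ => ‖gradient φ (x - s • z)‖ₑ := by
    have := continuous_gradient hφ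
    exact (by fun_prop : Continuous fun s : ℝ => gradient φ (x - s • z)).measurable.enorm
  have h2 : ‖φ x - φ (x - τ • z)‖ₑ ≤ ENNReal.ofReal M * ∫⁻ s in Ioo 0 a,
      ‖gradient φ (x - s • z)‖ₑ :=
    (enorm_sub_le_lintegral_gradient hφ x z hτ.1.le).trans
      (mul_le_mul' hz (lintegral_mono_set (Ioo_subset_Ioo le_rfl hτ.2.le)))
  have h3 : (∫⁻ s in Ioo 0 a, ‖gradient φ (x - s • z)‖ₑ) ^ p ≤ ENNReal.ofReal a ^ (p - 1) *
      ∫⁻ s in Ioo 0 a, ‖gradient φ (x - s • z)‖ₑ ^ p := by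
    refine (ENNReal.rpow_le_rpow (lintegral_le_lintegral_rpow_mul _ hp hgm.aemeasurable)
      hp0.le).trans (le_of_eq ?_)
    rw [ENNReal.mul_rpow_of_nonneg _ _ hp0.le, ← ENNReal.rpow_mul, ← ENNReal.rpow_mul,
      one_div_mul_cancel hp0.ne', ENNReal.rpow_one, Measure.restrict_apply_univ, Real.volume_Ioo,
      sub_zero, mul_comm]
    congr 2
    field_simp
  calc ‖φ (x - τ • z)‖ₑ ^ p ≤ (‖φ x‖ₑ + ENNReal.ofReal M * ∫⁻ s in Ioo 0 a,
        ‖gradient φ (x - s • z)‖ₑ) ^ p :=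
        ENNReal.rpow_le_rpow (h1.trans (add_le_add le_rfl h2)) hp0.le
    _ ≤ 2 ^ (p - 1) * (‖φ x‖ₑ ^ p + (ENNReal.ofReal M * ∫⁻ s in Ioo 0 a,
        ‖gradient φ (x - s • z)‖ₑ) ^ p) :=
        ENNReal.rpow_add_le_mul_rpow_add_rpow _ _ hp.le
    _ ≤ _ := by
        rw [ENNReal.mul_rpow_of_nonneg _ _ hp0.le]
        gcongr

theorem lintegral_bdry_cone_swap (hC : IsCollar Ω f r δ c M L)
    {h : EuclideanSpace ℝ (Fin N) → ℝ≥0∞} (hh : Measurable h) (a : ℝ) :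
    ∫⁻ x, (∫⁻ d in ball 0 r, (∫⁻ s in Ioo 0 a, h (x - s • (gradient f x + d))))
        ∂(bdryMeasure Ω) =
      ∫⁻ s in Ioo 0 a, (∫⁻ x, (∫⁻ d in ball 0 r, h (x - s • (gradient f x + d)))
        ∂(bdryMeasure Ω)) := by
  have := hC.isFiniteMeasure
  have hg := hC.continuous_grad
  have hF : Measurable (Function.uncurry
      fun (q : EuclideanSpace ℝ (Fin N) × ℝ) (d : EuclideanSpace ℝ (Fin N)) =>
        h (q.1 - q.2 • (gradient f q.1 + d))) :=
    hh.comp (by fun_prop : Continuous fun q : (EuclideanSpace ℝ (Fin N) × ℝ) ×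
      EuclideanSpace ℝ (Fin N) => q.1.1 - q.1.2 • (gradient f q.1.1 + q.2)).measurable
  have hP : Measurable (Function.uncurry fun (x : EuclideanSpace ℝ (Fin N)) (s : ℝ) =>
      ∫⁻ d in ball 0 r, h (x - s • (gradient f x + d))) :=
    hF.lintegral_prod_right' (ν := volume.restrict (ball 0 r))
  rw [← lintegral_lintegral_swap hP.aemeasurable]
  refine lintegral_congr fun x => ?_
  have hx : Measurable (Function.uncurry fun (d : EuclideanSpace ℝ (Fin N)) (s : ℝ) =>
      h (x - s • (gradient f x + d))) :=
    hh.comp (by fun_prop : Continuous fun q : EuclideanSpace ℝ (Fin N) × ℝ =>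
      x - q.2 • (gradient f x + q.1)).measurable
  exact lintegral_lintegral_swap hx.aemeasurable

theorem lintegral_cone_enorm_rpow_le (hC : IsCollar Ω f r δ c M L) {p : ℝ} (hp : 1 < p)
    {φ : EuclideanSpace ℝ (Fin N) → ℝ} (hφ : ContDiff ℝ 1 φ) {a τ : ℝ} (hτ : τ ∈ Ioo 0 a) :
    ∫⁻ x, (∫⁻ d in ball 0 r, ‖φ (x - τ • (gradient f x + d))‖ₑ ^ p) ∂(bdryMeasure Ω) ≤
      2 ^ (p - 1) * (volume (ball (0 : EuclideanSpace ℝ (Fin N)) r) *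
        ∫⁻ x, ‖φ x‖ₑ ^ p ∂(bdryMeasure Ω) +
        ENNReal.ofReal M ^ p * (ENNReal.ofReal a ^ (p - 1) *
          ∫⁻ x, (∫⁻ d in ball 0 r, (∫⁻ s in Ioo 0 a,
            ‖gradient φ (x - s • (gradient f x + d))‖ₑ ^ p)) ∂(bdryMeasure Ω))) := by
  have := hC.isFiniteMeasure
  have hp0 : 0 < p := by linarith
  have h2t : (2 : ℝ≥0∞) ^ (p - 1) ≠ ⊤ := ENNReal.rpow_ne_top_of_nonneg (by linarith) (by simp)
  have hMt : ENNReal.ofReal M ^ p ≠ ⊤ :=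
    ENNReal.rpow_ne_top_of_nonneg hp0.le ENNReal.ofReal_ne_top
  have hat : ENNReal.ofReal a ^ (p - 1) ≠ ⊤ :=
    ENNReal.rpow_ne_top_of_nonneg (by linarith) ENNReal.ofReal_ne_top
  have hφm : Measurable fun w => ‖φ w‖ₑ ^ p := hφ.continuous.measurable.enorm.pow_const p
  rw [← lintegral_const_mul' _ _ hat, ← lintegral_const_mul' _ _ hMt, ← lintegral_const_mul _ hφm,
    ← lintegral_add_left (hφm.const_mul _), ← lintegral_const_mul' _ _ h2t]
  refine lintegral_mono_ae ?_
  filter_upwards [ae_mem_frontier Ω] with x hx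
  rw [← lintegral_const_mul' _ _ hat, ← lintegral_const_mul' _ _ hMt, mul_comm (volume _),
    ← setLIntegral_const, ← lintegral_add_left measurable_const, ← lintegral_const_mul' _ _ h2t]
  exact setLIntegral_mono' measurableSet_ball fun d hd =>
    hC.enorm_rpow_cone_le hp hφ hτ hx (mem_ball_zero_iff.1 hd)

theorem coneDensity_le (hC : IsCollar Ω f r δ c M L) {a : ℝ} (haδ : a < δ)
    (w : EuclideanSpace ℝ (Fin N)) :
    coneDensity Ω f r a w ≤
      (Ω ∩ {w | -f w < M * a}).indicator (fun _ => ENNReal.ofReal (L * M / c)) w := by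
  have hzero : ∀ τ ∈ Ioo 0 a, ¬ (w ∈ Ω ∧ c * τ ≤ -f w ∧ -f w ≤ M * τ) →
      bdryMeasure Ω {x | ‖x - w - τ • gradient f x‖ < r * τ} = 0 := by
    intro τ hτ hn
    rw [bdryMeasure_apply]
    have he : frontier Ω ∩ {x | ‖x - w - τ • gradient f x‖ < r * τ} = ∅ := by
      rw [eq_empty_iff_forall_notMem]
      rintro x ⟨hx, hxw⟩
      have := hC.cone_bounds hx hτ.1 (hτ.2.trans haδ) hxw
      exact hn ⟨this.2.2.1, this.1, this.2.1⟩
    rw [he, measure_empty]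
  by_cases hw : w ∈ Ω ∩ {w | -f w < M * a}
  · rw [indicator_of_mem hw]
    have hfw : 0 < -f w := by
      have := hw.1
      rw [hC.eq_sublevel] at this
      exact neg_pos.2 this
    have hc := hC.c_pos
    have hM := hC.M_pos
    have hL := hC.L_pos
    calc coneDensity Ω f r a w
        ≤ ∫⁻ τ in Ioo 0 a, (Icc 0 (-f w / c)).indicator
            (fun _ => ENNReal.ofReal (L * M / -f w)) τ := by
          refine setLIntegral_mono' measurableSet_Ioo fun τ hτ => ?_
          by_cases hτw : w ∈ Ω ∧ c * τ ≤ -f w ∧ -f w ≤ M * τ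
          · have hτI : τ ∈ Icc 0 (-f w / c) := ⟨hτ.1.le, by rw [le_div_iff₀ hc]; linarith⟩
            rw [indicator_of_mem hτI]
            have hτ0 : 0 < τ := hτ.1
            refine (mul_le_mul' le_rfl (hC.section_le w hτ.1 (hτ.2.trans haδ))).trans ?_
            rw [← ENNReal.ofReal_inv_of_pos (by positivity), ← ENNReal.ofReal_mul (by positivity)]
            apply ENNReal.ofReal_le_ofReal
            have : (τ ^ N)⁻¹ * (L * (τ ^ N / τ)) = L / τ := by field_simp
            rw [this, div_le_div_iff₀ hτ0 hfw]
            nlinarith [hτw.2.2]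
          · rw [hzero τ hτ hτw, mul_zero]
            exact zero_le
      _ ≤ ∫⁻ τ, (Icc 0 (-f w / c)).indicator (fun _ => ENNReal.ofReal (L * M / -f w)) τ :=
          setLIntegral_le_lintegral _ _
      _ = ENNReal.ofReal (L * M / c) := by
          rw [lintegral_indicator measurableSet_Icc, setLIntegral_const, Real.volume_Icc, sub_zero,
            ← ENNReal.ofReal_mul (by positivity)]
          congr 1
          field_simp
          exact div_self (by linarith)
  · rw [indicator_of_notMem hw, coneDensity, nonpos_iff_eq_zero]
    refine (setLIntegral_congr_fun measurableSet_Ioo fun τ hτ => ?_).trans lintegral_zero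
    rw [hzero τ hτ, mul_zero]
    rintro ⟨h1, -, h3⟩
    exact hw ⟨h1, h3.trans_lt (mul_lt_mul_of_pos_left hτ.2 hC.M_pos)⟩

theorem le_coneDensity (hC : IsCollar Ω f r δ c M L) {a : ℝ} (ha : 0 < a) (haδ : a < δ)
    (w : EuclideanSpace ℝ (Fin N)) :
    (Ω ∩ {w | -f w < c * a}).indicator (fun _ => ENNReal.ofReal (c ^ 2 / (1 + c))) w ≤
      coneDensity Ω f r a w := by
  by_cases hw : w ∈ Ω ∩ {w | -f w < c * a}
  · rw [indicator_of_mem hw]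
    have hc := hC.c_pos
    obtain ⟨s, hs, hsa, hden⟩ := hC.density w hw.1 a ha haδ hw.2
    calc ENNReal.ofReal (c ^ 2 / (1 + c))
        = ∫⁻ τ in Ioo s ((1 + c) * s), ENNReal.ofReal (c / ((1 + c) * s)) := by
          rw [setLIntegral_const, Real.volume_Ioo, ← ENNReal.ofReal_mul (by positivity)]
          congr 1
          field_simp
          ring
      _ ≤ ∫⁻ τ in Ioo s ((1 + c) * s), (ENNReal.ofReal (τ ^ N))⁻¹ *
            bdryMeasure Ω {x | ‖x - w - τ • gradient f x‖ < r * τ} := by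
          refine setLIntegral_mono' measurableSet_Ioo fun τ hτ => ?_
          have hτ0 : 0 < τ := hs.trans hτ.1
          refine le_trans ?_ (mul_le_mul' le_rfl (hden τ ⟨hτ.1.le, hτ.2.le⟩))
          rw [← ENNReal.ofReal_inv_of_pos (by positivity), ← ENNReal.ofReal_mul (by positivity)]
          apply ENNReal.ofReal_le_ofReal
          have : (τ ^ N)⁻¹ * (c * (τ ^ N / τ)) = c / τ := by field_simp
          rw [this]
          gcongr
          exact hτ.2.le
      _ ≤ _ := lintegral_mono_set (Ioo_subset_Ioo hs.le hsa)
  · rw [indicator_of_notMem hw]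
    exact zero_le

theorem lintegral_mul_coneDensity_le (hC : IsCollar Ω f r δ c M L) {a : ℝ} (haδ : a < δ)
    {h : EuclideanSpace ℝ (Fin N) → ℝ≥0∞} (hh : Measurable h) :
    ∫⁻ w, h w * coneDensity Ω f r a w ≤
      ENNReal.ofReal (L * M / c) * ∫⁻ w in Ω ∩ {w | -f w < M * a}, h w := by
  have hm : MeasurableSet (Ω ∩ {w | -f w < M * a}) := hC.measurableSet.inter
    (measurableSet_lt hC.contDiff.continuous.neg.measurable measurable_const)
  rw [← lintegral_const_mul _ hh, ← lintegral_indicator hm]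
  refine lintegral_mono fun w => ?_
  refine (mul_le_mul' le_rfl (hC.coneDensity_le haδ w)).trans (le_of_eq ?_)
  by_cases hw : w ∈ Ω ∩ {w | -f w < M * a}
  · rw [indicator_of_mem hw, indicator_of_mem hw, mul_comm]
  · rw [indicator_of_notMem hw, indicator_of_notMem hw, mul_zero]

theorem le_lintegral_mul_coneDensity (hC : IsCollar Ω f r δ c M L) {a : ℝ} (ha : 0 < a)
    (haδ : a < δ) {h : EuclideanSpace ℝ (Fin N) → ℝ≥0∞} (hh : Measurable h) :
    ENNReal.ofReal (c ^ 2 / (1 + c)) * ∫⁻ w in Ω ∩ {w | -f w < c * a}, h w ≤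
      ∫⁻ w, h w * coneDensity Ω f r a w := by
  have hm : MeasurableSet (Ω ∩ {w | -f w < c * a}) := hC.measurableSet.inter
    (measurableSet_lt hC.contDiff.continuous.neg.measurable measurable_const)
  rw [← lintegral_const_mul _ hh, ← lintegral_indicator hm]
  refine lintegral_mono fun w => ?_
  refine le_trans (le_of_eq ?_) (mul_le_mul' le_rfl (hC.le_coneDensity ha haδ w))
  by_cases hw : w ∈ Ω ∩ {w | -f w < c * a}
  · rw [indicator_of_mem hw, indicator_of_mem hw, mul_comm]
  · rw [indicator_of_notMem hw, indicator_of_notMem hw, mul_zero]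

/-- In a boundary strip of width `a`, the `L^p` norm of `φ` is controlled by its boundary values
and `a` times its gradient. -/
theorem exists_lintegral_strip_le (hC : IsCollar Ω f r δ c M L) {p : ℝ} (hp : 1 < p) :
    ∃ K : ℝ≥0∞, K ≠ ⊤ ∧ ∀ φ : EuclideanSpace ℝ (Fin N) → ℝ, ContDiff ℝ 1 φ → ∀ a, 0 < a → a < δ →
      ∫⁻ w in Ω ∩ {w | -f w < c * a}, ‖φ w‖ₑ ^ p ≤
        K * (ENNReal.ofReal a * ∫⁻ x, ‖φ x‖ₑ ^ p ∂(bdryMeasure Ω) +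
          ENNReal.ofReal a ^ p * ∫⁻ w in Ω ∩ {w | -f w < M * a}, ‖gradient φ w‖ₑ ^ p) := by
  have := hC.isFiniteMeasure
  have hp0 : 0 < p := by linarith
  have hc := hC.c_pos
  set V : ℝ≥0∞ := volume (ball (0 : EuclideanSpace ℝ (Fin N)) r)
  have hVt : V ≠ ⊤ := measure_ball_lt_top.ne
  set k := ENNReal.ofReal (c ^ 2 / (1 + c))
  have hk0 : k ≠ 0 := by simp only [k]; positivity
  have hkt : k ≠ ⊤ := ENNReal.ofReal_ne_top
  set A := ENNReal.ofReal M ^ p * ENNReal.ofReal (L * M / c)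
  have hA : A ≠ ⊤ := ENNReal.mul_ne_top
    (ENNReal.rpow_ne_top_of_nonneg hp0.le ENNReal.ofReal_ne_top) ENNReal.ofReal_ne_top
  have h2t : (2 : ℝ≥0∞) ^ (p - 1) ≠ ⊤ :=
    ENNReal.rpow_ne_top_of_nonneg (by linarith) (by simp)
  refine ⟨k⁻¹ * 2 ^ (p - 1) * (V + A), ENNReal.mul_ne_top
    (ENNReal.mul_ne_top (ENNReal.inv_ne_top.2 hk0) h2t) (ENNReal.add_ne_top.2 ⟨hVt, hA⟩),
    fun φ hφ a ha haδ => ?_⟩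
  have hgm := measurable_enorm_gradient_cone hC.contDiff_one hφ p
  have hφm : Measurable fun w => ‖φ w‖ₑ ^ p := hφ.continuous.measurable.enorm.pow_const p
  have hgm' : Measurable fun w => ‖gradient φ w‖ₑ ^ p :=
    (continuous_gradient hφ).measurable.enorm.pow_const p
  set Tb := ∫⁻ x, ‖φ x‖ₑ ^ p ∂(bdryMeasure Ω)
  set Tg := ∫⁻ w in Ω ∩ {w | -f w < M * a}, ‖gradient φ w‖ₑ ^ p
  set J := ∫⁻ x, (∫⁻ d in ball 0 r, (∫⁻ s in Ioo 0 a,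
    ‖gradient φ (x - s • (gradient f x + d))‖ₑ ^ p)) ∂(bdryMeasure Ω)
  have hJ : J ≤ ENNReal.ofReal (L * M / c) * Tg := by
    refine le_trans (le_of_eq ?_) (hC.lintegral_mul_coneDensity_le haδ hgm')
    rw [← hC.lintegral_cones_eq a hgm']
    exact hC.lintegral_bdry_cone_swap hgm' a
  have hin : ∀ τ ∈ Ioo 0 a, ∫⁻ x, (∫⁻ d in ball 0 r, ‖φ (x - τ • (gradient f x + d))‖ₑ ^ p)
      ∂(bdryMeasure Ω) ≤ 2 ^ (p - 1) * (V * Tb +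
        ENNReal.ofReal M ^ p * (ENNReal.ofReal a ^ (p - 1) * J)) := by
    exact fun τ hτ => hC.lintegral_cone_enorm_rpow_le hp hφ hτ
  have hmain : k * ∫⁻ w in Ω ∩ {w | -f w < c * a}, ‖φ w‖ₑ ^ p ≤
      2 ^ (p - 1) * (V * Tb + ENNReal.ofReal M ^ p * (ENNReal.ofReal a ^ (p - 1) * J)) *
        ENNReal.ofReal a := by
    refine (hC.le_lintegral_mul_coneDensity ha haδ hφm).trans ?_
    rw [← hC.lintegral_cones_eq a hφm]
    refine (setLIntegral_mono' measurableSet_Ioo hin).trans (le_of_eq ?_)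
    rw [setLIntegral_const, Real.volume_Ioo, sub_zero]
  have hap : ENNReal.ofReal a ^ p = ENNReal.ofReal a ^ (p - 1) * ENNReal.ofReal a := by
    conv_lhs => rw [← sub_add_cancel p 1]
    rw [ENNReal.rpow_add_of_nonneg _ _ (by linarith) zero_le_one, ENNReal.rpow_one]
  calc _ = k⁻¹ * (k * ∫⁻ w in Ω ∩ {w | -f w < c * a}, ‖φ w‖ₑ ^ p) := by
        rw [← mul_assoc, ENNReal.inv_mul_cancel hk0 hkt, one_mul]
    _ ≤ k⁻¹ * (2 ^ (p - 1) * (V * Tb + ENNReal.ofReal M ^ p * (ENNReal.ofReal a ^ (p - 1) *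
          (ENNReal.ofReal (L * M / c) * Tg))) * ENNReal.ofReal a) := by
        refine mul_le_mul' le_rfl (hmain.trans ?_)
        gcongr
    _ = k⁻¹ * 2 ^ (p - 1) * (V * (ENNReal.ofReal a * Tb) + A * (ENNReal.ofReal a ^ p * Tg)) := by
        rw [hap]
        simp only [A]
        ring
    _ ≤ k⁻¹ * 2 ^ (p - 1) * ((V + A) * (ENNReal.ofReal a * Tb) +
          (V + A) * (ENNReal.ofReal a ^ p * Tg)) := by
        gcongr
        · exact le_self_add
        · exact le_add_self
    _ = _ := by ring

end IsCollar

end Strip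

section ZeroTrace

open Metric

variable {N : ℕ} {Ω : Set (EuclideanSpace ℝ (Fin N))} {f : EuclideanSpace ℝ (Fin N) → ℝ}
  {r δ c M L : ℝ}

theorem exists_abs_deriv_smoothTransition_le :
    ∃ B : ℝ, 0 ≤ B ∧ ∀ x, |deriv Real.smoothTransition x| ≤ B := by
  have hc : Continuous (deriv Real.smoothTransition) :=
    (Real.smoothTransition.contDiff (n := 1)).continuous_deriv le_rfl
  obtain ⟨B, hB⟩ := (isCompact_Icc (a := (0 : ℝ)) (b := 1)).exists_bound_of_continuousOn
    hc.continuousOn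
  refine ⟨B, (norm_nonneg _).trans (hB 0 (by simp)), fun x => ?_⟩
  by_cases hx : x ∈ Icc (0 : ℝ) 1
  · exact hB x hx
  · have h0 : deriv Real.smoothTransition x = 0 := by
      rw [mem_Icc, not_and_or, not_le, not_le] at hx
      rcases hx with hx | hx
      · have : Real.smoothTransition =ᶠ[𝓝 x] fun _ => 0 := by
          filter_upwards [Iio_mem_nhds hx] with y hy
          exact Real.smoothTransition.zero_of_nonpos (le_of_lt hy)
        rw [this.deriv_eq, deriv_const]
      · have : Real.smoothTransition =ᶠ[𝓝 x] fun _ => 1 := by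
          filter_upwards [Ioi_mem_nhds hx] with y hy
          exact Real.smoothTransition.one_of_one_le (le_of_lt hy)
        rw [this.deriv_eq, deriv_const]
    rw [h0, abs_zero]
    exact (norm_nonneg _).trans (hB 0 (by simp))

/-- Cutoff functions adapted to the defining function `f`. -/
theorem exists_cutoff (hf : ContDiff ℝ ∞ f) (hΩ : Ω = {x | f x < 0}) (hΩb : IsBounded Ω) :
    ∃ B : ℝ, 0 ≤ B ∧ ∀ b, 0 < b → ∃ χ : EuclideanSpace ℝ (Fin N) → ℝ, ContDiff ℝ ∞ χ ∧
      HasCompactSupport χ ∧ tsupport χ ⊆ Ω ∧ (∀ w, 0 ≤ χ w ∧ χ w ≤ 1) ∧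
      (∀ w, b ≤ -f w → χ w = 1 ∧ gradient χ w = 0) ∧ ∀ w ∈ Ω, ‖gradient χ w‖ ≤ B / b := by
  have hf1 : ContDiff ℝ 1 f := hf.of_le (by exact_mod_cast le_top)
  obtain ⟨B₁, hB₁, hB⟩ := exists_abs_deriv_smoothTransition_le
  obtain ⟨B₂, hB₂⟩ := hΩb.isCompact_closure.exists_bound_of_continuousOn
    (continuous_gradient hf1).continuousOn
  refine ⟨B₁ * 4 * |B₂|, by positivity, fun b hb => ?_⟩
  set k := 4 / b
  have hk : 0 < k := by positivity
  let ℓ : EuclideanSpace ℝ (Fin N) → ℝ := fun w => -(k * f w) - 1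
  have hℓ : ContDiff ℝ ∞ ℓ := (contDiff_const.mul hf).neg.sub contDiff_const
  let χ : EuclideanSpace ℝ (Fin N) → ℝ := fun w => Real.smoothTransition (ℓ w)
  have hχ : ContDiff ℝ ∞ χ := Real.smoothTransition.contDiff.comp hℓ
  have hsupp : tsupport χ ⊆ {w | f w ≤ -(1 / k)} := by
    refine closure_minimal (fun w hw => ?_) (isClosed_le hf.continuous continuous_const)
    by_contra hn
    rw [mem_ofPred_eq, not_le] at hn
    refine hw (Real.smoothTransition.zero_of_nonpos ?_)
    have h1 : k * (-(1 / k)) < k * f w := mul_lt_mul_of_pos_left hn hk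
    rw [mul_neg, mul_one_div_cancel hk.ne'] at h1
    simp only [ℓ]
    linarith
  have hsub : tsupport χ ⊆ Ω := by
    refine hsupp.trans fun w hw => ?_
    rw [hΩ]
    have : 0 < 1 / k := by positivity
    have hw' : f w ≤ -(1 / k) := hw
    exact show f w < 0 by linarith
  have hone : ∀ w, b / 2 < -f w → χ w = 1 := by
    intro w hw
    refine Real.smoothTransition.one_of_one_le ?_
    have h1 : k * (b / 2) ≤ k * (-f w) := mul_le_mul_of_nonneg_left hw.le hk.le
    have h2 : k * (b / 2) = 2 := by simp only [k]; field_simp; norm_num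
    simp only [ℓ]
    linarith
  refine ⟨χ, hχ, ?_, hsub, fun w => ⟨Real.smoothTransition.nonneg _,
    Real.smoothTransition.le_one _⟩, fun w hw => ⟨hone w (by linarith), ?_⟩, fun w hw => ?_⟩
  · exact hΩb.isCompact_closure.of_isClosed_subset (isClosed_tsupport χ)
      (hsub.trans subset_closure)
  · have h1 : χ =ᶠ[𝓝 w] fun _ => 1 := by
      filter_upwards [(isOpen_lt continuous_const hf.continuous.neg).mem_nhds
        (show b / 2 < -f w by linarith)] with y hy
      exact hone y hy
    rw [h1.gradient_eq, gradient_fun_const]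
  · have h1 : HasFDerivAt ℓ (-(k • fderiv ℝ f w)) w :=
      (((hf1.differentiable one_ne_zero) w).hasFDerivAt.const_mul k).neg.sub_const 1
    have h2 : HasDerivAt Real.smoothTransition (deriv Real.smoothTransition (ℓ w)) (ℓ w) :=
      ((Real.smoothTransition.contDiff (n := 1)).differentiable one_ne_zero _).hasDerivAt
    have h3 := (h2.comp_hasFDerivAt w h1).fderiv
    have h4 : fderiv ℝ χ w = deriv Real.smoothTransition (ℓ w) • -(k • fderiv ℝ f w) := h3
    rw [norm_gradient, h4, norm_smul, norm_neg, norm_smul, ← norm_gradient, Real.norm_eq_abs,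
      Real.norm_eq_abs, abs_of_pos hk]
    calc |deriv Real.smoothTransition (ℓ w)| * (k * ‖gradient f w‖) ≤ B₁ * (k * |B₂|) := by
          gcongr
          · exact hB _
          · exact (hB₂ w (subset_closure hw)).trans (le_abs_self _)
      _ = _ := by simp only [k]; ring

theorem gradient_mul_of_contDiff {φ ψ : EuclideanSpace ℝ (Fin N) → ℝ} (hφ : ContDiff ℝ 1 φ)
    (hψ : ContDiff ℝ 1 ψ) (x : EuclideanSpace ℝ (Fin N)) :
    gradient (fun y => φ y * ψ y) x = φ x • gradient ψ x + ψ x • gradient φ x := by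
  rw [gradient, fderiv_fun_mul (hφ.differentiable one_ne_zero).differentiableAt
    (hψ.differentiable one_ne_zero).differentiableAt, map_add]
  simp [gradient]

namespace IsCollar

theorem tendsto_eLpNorm_strip (hC : IsCollar Ω f r δ c M L) (hΩb : IsBounded Ω) {p : ℝ}
    (hp : 0 < p) {F : Type*} [NormedAddCommGroup F] {g : EuclideanSpace ℝ (Fin N) → F}
    (hg : MemLp g (ENNReal.ofReal p) (volume.restrict Ω)) {b : ℝ} (hb : 0 < b) :
    Tendsto (fun a => eLpNorm g (ENNReal.ofReal p) (volume.restrict (Ω ∩ {w | -f w < b * a})))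
      (𝓝[>] 0) (𝓝 0) := by
  have hfin := isFiniteMeasure_restrict_of_isBounded hΩb
  have hm : ∀ a, MeasurableSet {w | -f w < b * a} := fun a =>
    measurableSet_lt hC.contDiff.continuous.neg.measurable measurable_const
  have h1 : Tendsto (fun a => volume.restrict Ω {w | -f w < b * a}) (𝓝[>] 0) (𝓝 0) := by
    have h2 := tendsto_measure_biInter_gt (μ := volume.restrict Ω)
      (s := fun a => {w | -f w < b * a}) (a := (0 : ℝ)) (fun a _ => (hm a).nullMeasurableSet)
      (fun i j _ hij w hw =>
        lt_of_lt_of_le (show -f w < b * i from hw) (mul_le_mul_of_nonneg_left hij hb.le))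
      ⟨1, one_pos, measure_ne_top _ _⟩
    have : (⋂ a, ⋂ (_ : a > (0 : ℝ)), {w | -f w < b * a}) ∩ Ω = ∅ := by
      rw [eq_empty_iff_forall_notMem]
      rintro w ⟨hw, hwΩ⟩
      have hfw : 0 < -f w := by
        rw [hC.eq_sublevel] at hwΩ
        exact neg_pos.2 hwΩ
      simp only [mem_iInter, mem_ofPred_eq] at hw
      have := hw (-f w / b) (by positivity)
      rw [mul_div_cancel₀ _ hb.ne'] at this
      exact lt_irrefl _ this
    rw [Measure.restrict_apply' hC.measurableSet, this, measure_empty] at h2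
    exact h2
  have h3 : ∫⁻ w in Ω, ‖g w‖ₑ ^ p ≠ ⊤ := by
    rw [← eLpNorm_ofReal_rpow _ hp]
    exact ENNReal.rpow_ne_top_of_nonneg hp.le hg.2.ne
  have h4 := tendsto_setLIntegral_zero h3 h1
  have h5 := ((ENNReal.continuous_rpow_const (y := 1 / p)).tendsto 0).comp h4
  rw [ENNReal.zero_rpow_of_pos (by positivity)] at h5
  refine h5.congr fun a => ?_
  rw [eLpNorm_ofReal_eq _ hp, Function.comp_apply, Measure.restrict_restrict (hm a), inter_comm]

/-- The strip inequality in terms of norms. -/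
theorem exists_eLpNorm_strip_le (hC : IsCollar Ω f r δ c M L) {p : ℝ} (hp : 1 < p) :
    ∃ K : ℝ≥0∞, K ≠ ⊤ ∧ ∀ φ : EuclideanSpace ℝ (Fin N) → ℝ, ContDiff ℝ 1 φ → ∀ a, 0 < a → a < δ →
      eLpNorm φ (ENNReal.ofReal p) (volume.restrict (Ω ∩ {w | -f w < c * a})) ≤
        K * (ENNReal.ofReal a ^ (1 / p) * eLpNorm φ (ENNReal.ofReal p) (bdryMeasure Ω) +
          ENNReal.ofReal a * eLpNorm (gradient φ) (ENNReal.ofReal p)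
            (volume.restrict (Ω ∩ {w | -f w < M * a}))) := by
  obtain ⟨K, hK, h⟩ := hC.exists_lintegral_strip_le hp
  have hp0 : 0 < p := by linarith
  have hp1 : 0 ≤ 1 / p := by positivity
  refine ⟨K ^ (1 / p), ENNReal.rpow_ne_top_of_nonneg hp1 hK, fun φ hφ a ha haδ => ?_⟩
  simp only [eLpNorm_ofReal_eq _ hp0]
  refine (ENNReal.rpow_le_rpow (h φ hφ a ha haδ) hp1).trans ?_
  rw [ENNReal.mul_rpow_of_nonneg _ _ hp1]
  refine mul_le_mul' le_rfl ((ENNReal.rpow_add_le_add_rpow _ _ hp1 ?_).trans (le_of_eq ?_))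
  · rw [div_le_one hp0]; exact hp.le
  · rw [ENNReal.mul_rpow_of_nonneg _ _ hp1, ENNReal.mul_rpow_of_nonneg _ _ hp1,
      ← ENNReal.rpow_mul (ENNReal.ofReal a), mul_one_div_cancel hp0.ne', ENNReal.rpow_one]

/-- Functions of `W^{1,p}(Ω)` that are limits of smooth functions whose boundary values tend to
zero can be approximated by test functions. -/
theorem exists_testFunction_near (hC : IsCollar Ω f r δ c M L) (hΩb : IsBounded Ω) {p : ℝ}
    (hp : 1 < p) {u : EuclideanSpace ℝ (Fin N) → ℝ}
    {g : EuclideanSpace ℝ (Fin N) → EuclideanSpace ℝ (Fin N)}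
    (hu : MemLp u (ENNReal.ofReal p) (volume.restrict Ω))
    (hg : MemLp g (ENNReal.ofReal p) (volume.restrict Ω))
    {φ : ℕ → EuclideanSpace ℝ (Fin N) → ℝ} (hφ : ∀ n, ContDiff ℝ ∞ (φ n))
    (hconv : TendstoW1p Ω p φ u g)
    (hbdry : Tendsto (fun n => eLpNorm (φ n) (ENNReal.ofReal p) (bdryMeasure Ω)) atTop (𝓝 0))
    {η : ℝ≥0∞} (hη : 0 < η) :
    ∃ ψ : EuclideanSpace ℝ (Fin N) → ℝ, (ContDiff ℝ ∞ ψ ∧ HasCompactSupport ψ ∧ tsupport ψ ⊆ Ω) ∧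
      eLpNorm (fun x => ψ x - u x) (ENNReal.ofReal p) (volume.restrict Ω) < η ∧
      eLpNorm (fun x => gradient ψ x - g x) (ENNReal.ofReal p) (volume.restrict Ω) < η := by
  have hp0 : 0 < p := by linarith
  have hp1 : 1 ≤ ENNReal.ofReal p := by simpa using hp.le
  have hφ1 : ∀ n, ContDiff ℝ 1 (φ n) := fun n => (hφ n).of_le (by exact_mod_cast le_top)
  obtain ⟨K, hK, hstrip⟩ := hC.exists_eLpNorm_strip_le hp
  obtain ⟨B, hB, hcut⟩ := exists_cutoff hC.contDiff hC.eq_sublevel hΩb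
  have hc := hC.c_pos
  set D : ℝ≥0∞ := ENNReal.ofReal (B / c) * K
  have hD : D ≠ ⊤ := ENNReal.mul_ne_top ENNReal.ofReal_ne_top hK
  have hlim1 := hC.tendsto_eLpNorm_strip hΩb hp0 hu hc
  have hlim2 := (hC.tendsto_eLpNorm_strip hΩb hp0 hg hc).add
    (ENNReal.Tendsto.const_mul (a := D) (hC.tendsto_eLpNorm_strip hΩb hp0 hg hC.M_pos)
      (Or.inr hD))
  rw [mul_zero, add_zero] at hlim2
  obtain ⟨a, ⟨hau, hag⟩, ha, haδ⟩ := (((hlim1.eventually_lt_const hη).and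
    (hlim2.eventually_lt_const hη)).and (Ioo_mem_nhdsGT hC.δ_pos)).exists
  obtain ⟨χ, hχ, hχc, hχΩ, hχ01, hχ1, hχg⟩ := hcut (c * a) (by positivity)
  have hχ' : ContDiff ℝ 1 χ := hχ.of_le (by exact_mod_cast le_top)
  set S := Ω ∩ {w | -f w < c * a} with hSdef
  set S' := Ω ∩ {w | -f w < M * a} with hS'def
  have hSm : MeasurableSet S := hC.measurableSet.inter
    (measurableSet_lt hC.contDiff.continuous.neg.measurable measurable_const)
  have hSΩ : (volume.restrict Ω).restrict S = volume.restrict S := by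
    rw [Measure.restrict_restrict hSm, inter_eq_left.2 inter_subset_left]
  set E := ENNReal.ofReal (B / (c * a)) * K * ENNReal.ofReal a ^ (1 / p)
  have hE : E ≠ ⊤ := ENNReal.mul_ne_top (ENNReal.mul_ne_top ENNReal.ofReal_ne_top hK)
    (ENNReal.rpow_ne_top_of_nonneg (by positivity) ENNReal.ofReal_ne_top)
  have hcut1 : ∀ x, ‖χ x - 1‖ ≤ 1 := fun x => by
    rw [Real.norm_eq_abs, abs_le]
    constructor <;> linarith [(hχ01 x).1, (hχ01 x).2]
  have hval : ∀ n, eLpNorm (fun x => χ x * φ n x - u x) (ENNReal.ofReal p) (volume.restrict Ω) ≤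
      eLpNorm (fun x => φ n x - u x) (ENNReal.ofReal p) (volume.restrict Ω) +
        eLpNorm u (ENNReal.ofReal p) (volume.restrict S) := by
    intro n
    have hm1 : AEStronglyMeasurable (fun x => χ x * (φ n x - u x)) (volume.restrict Ω) :=
      hχ.continuous.aestronglyMeasurable.mul ((hφ n).continuous.aestronglyMeasurable.sub hu.1)
    have hm2 : AEStronglyMeasurable (fun x => (χ x - 1) * u x) (volume.restrict Ω) :=
      (hχ.continuous.sub continuous_const).aestronglyMeasurable.mul hu.1
    have he : (fun x => χ x * φ n x - u x) =
        (fun x => χ x * (φ n x - u x)) + fun x => (χ x - 1) * u x := by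
      funext x
      simp only [Pi.add_apply]
      ring
    rw [he]
    refine (eLpNorm_add_le hm1 hm2 hp1).trans (add_le_add (eLpNorm_mono fun x => ?_) ?_)
    · rw [norm_mul, Real.norm_eq_abs, abs_of_nonneg (hχ01 x).1]
      exact mul_le_of_le_one_left (norm_nonneg _) (hχ01 x).2
    · rw [← hSΩ, ← eLpNorm_indicator_eq_eLpNorm_restrict hSm]
      refine eLpNorm_mono_ae ?_
      filter_upwards [ae_restrict_mem hC.measurableSet] with x hx
      rw [norm_mul]
      by_cases hxS : x ∈ S
      · rw [indicator_of_mem hxS]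
        exact mul_le_of_le_one_left (norm_nonneg _) (hcut1 x)
      · have := (hχ1 x (not_lt.1 fun h => hxS ⟨hx, h⟩)).1
        rw [this, sub_self, norm_zero, zero_mul]
        exact norm_nonneg _
  have hgrad : ∀ n, eLpNorm (fun x => gradient (fun y => χ y * φ n y) x - g x) (ENNReal.ofReal p)
      (volume.restrict Ω) ≤
      (1 + D) * eLpNorm (fun x => gradient (φ n) x - g x) (ENNReal.ofReal p) (volume.restrict Ω) +
      E * eLpNorm (φ n) (ENNReal.ofReal p) (bdryMeasure Ω) +
      (eLpNorm g (ENNReal.ofReal p) (volume.restrict S) +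
        D * eLpNorm g (ENNReal.ofReal p) (volume.restrict S')) := by
    intro n
    have hgφ := continuous_gradient (hφ1 n)
    have hgχ := continuous_gradient hχ'
    have hm1 : AEStronglyMeasurable (fun x => χ x • (gradient (φ n) x - g x))
        (volume.restrict Ω) :=
      hχ.continuous.aestronglyMeasurable.smul (hgφ.aestronglyMeasurable.sub hg.1)
    have hm2 : AEStronglyMeasurable (fun x => (χ x - 1) • g x) (volume.restrict Ω) :=
      (hχ.continuous.sub continuous_const).aestronglyMeasurable.smul hg.1
    have hm3 : AEStronglyMeasurable (fun x => φ n x • gradient χ x) (volume.restrict Ω) :=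
      ((hφ n).continuous.smul hgχ).aestronglyMeasurable
    have he : (fun x => gradient (fun y => χ y * φ n y) x - g x) =
        ((fun x => χ x • (gradient (φ n) x - g x)) + fun x => (χ x - 1) • g x) +
          fun x => φ n x • gradient χ x := by
      funext x
      simp only [Pi.add_apply, gradient_mul_of_contDiff hχ' (hφ1 n), smul_sub, sub_smul, one_smul]
      abel
    have hb1 : eLpNorm (fun x => χ x • (gradient (φ n) x - g x)) (ENNReal.ofReal p)
        (volume.restrict Ω) ≤
        eLpNorm (fun x => gradient (φ n) x - g x) (ENNReal.ofReal p) (volume.restrict Ω) := by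
      refine eLpNorm_mono fun x => ?_
      rw [norm_smul, Real.norm_eq_abs, abs_of_nonneg (hχ01 x).1]
      exact mul_le_of_le_one_left (norm_nonneg _) (hχ01 x).2
    have hb2 : eLpNorm (fun x => (χ x - 1) • g x) (ENNReal.ofReal p) (volume.restrict Ω) ≤
        eLpNorm g (ENNReal.ofReal p) (volume.restrict S) := by
      rw [← hSΩ, ← eLpNorm_indicator_eq_eLpNorm_restrict hSm]
      refine eLpNorm_mono_ae ?_
      filter_upwards [ae_restrict_mem hC.measurableSet] with x hx
      rw [norm_smul]
      by_cases hxS : x ∈ S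
      · rw [indicator_of_mem hxS]
        exact mul_le_of_le_one_left (norm_nonneg _) (hcut1 x)
      · have := (hχ1 x (not_lt.1 fun h => hxS ⟨hx, h⟩)).1
        rw [this, sub_self, norm_zero, zero_mul]
        exact norm_nonneg _
    have hb3 : eLpNorm (fun x => φ n x • gradient χ x) (ENNReal.ofReal p) (volume.restrict Ω) ≤
        ENNReal.ofReal (B / (c * a)) *
          eLpNorm (φ n) (ENNReal.ofReal p) (volume.restrict S) := by
      rw [← hSΩ, ← eLpNorm_indicator_eq_eLpNorm_restrict hSm]
      refine eLpNorm_le_mul_eLpNorm_of_ae_le_mul ?_ _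
      filter_upwards [ae_restrict_mem hC.measurableSet] with x hx
      rw [norm_smul, mul_comm]
      by_cases hxS : x ∈ S
      · rw [indicator_of_mem hxS]
        gcongr
        exact hχg x hx
      · have := (hχ1 x (not_lt.1 fun h => hxS ⟨hx, h⟩)).2
        rw [this, norm_zero, zero_mul]
        positivity
    have hb4 : eLpNorm (gradient (φ n)) (ENNReal.ofReal p) (volume.restrict S') ≤
        eLpNorm (fun x => gradient (φ n) x - g x) (ENNReal.ofReal p) (volume.restrict Ω) +
          eLpNorm g (ENNReal.ofReal p) (volume.restrict S') := by
      have hle : volume.restrict S' ≤ volume.restrict Ω :=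
        Measure.restrict_mono inter_subset_left le_rfl
      have hgS := hg.1.mono_measure hle
      have := eLpNorm_add_le (p := ENNReal.ofReal p)
        ((hgφ.aestronglyMeasurable (μ := volume.restrict S')).sub hgS) hgS hp1
      rw [sub_add_cancel] at this
      exact this.trans (add_le_add (eLpNorm_mono_measure _ hle) le_rfl)
    have hDE : ENNReal.ofReal (B / (c * a)) * K * ENNReal.ofReal a = D := by
      simp only [D]
      rw [mul_right_comm, ← ENNReal.ofReal_mul (by positivity)]
      congr 2
      field_simp
    rw [he]
    refine (eLpNorm_add_le (hm1.add hm2) hm3 hp1).trans ?_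
    refine (add_le_add ((eLpNorm_add_le hm1 hm2 hp1).trans (add_le_add hb1 hb2))
      (hb3.trans (mul_le_mul' le_rfl ((hstrip _ (hφ1 n) a ha haδ).trans
        (mul_le_mul' le_rfl (add_le_add le_rfl (mul_le_mul' le_rfl hb4))))))).trans
      (le_of_eq ?_)
    rw [← hDE]
    simp only [E]
    ring
  have h1 := hconv.1.add_const (eLpNorm u (ENNReal.ofReal p) (volume.restrict S))
  rw [zero_add] at h1
  have h2 := ((ENNReal.Tendsto.const_mul (a := 1 + D) hconv.2
    (Or.inr (ENNReal.add_ne_top.2 ⟨ENNReal.one_ne_top, hD⟩))).add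
    (ENNReal.Tendsto.const_mul (a := E) hbdry (Or.inr hE))).add_const
    (eLpNorm g (ENNReal.ofReal p) (volume.restrict S) +
        D * eLpNorm g (ENNReal.ofReal p) (volume.restrict S'))
  rw [mul_zero, mul_zero, add_zero, zero_add] at h2
  obtain ⟨n, hn1, hn2⟩ := ((h1.eventually_lt_const hau).and (h2.eventually_lt_const hag)).exists
  refine ⟨fun x => χ x * φ n x, ⟨hχ.mul (hφ n), hχc.mul_right, ?_⟩, (hval n).trans_lt hn1,
    (hgrad n).trans_lt hn2⟩
  exact (closure_mono fun x hx => left_ne_zero_of_mul hx).trans hχΩ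

/-- A function of `W^{1,p}(Ω)` with zero trace belongs to `W^{1,p}_0(Ω)`. -/
theorem memW1p0_of_isTrace_of_ae_eq_zero (hC : IsCollar Ω f r δ c M L) (hΩb : IsBounded Ω) {p : ℝ}
    (hp : 1 < p) {u : EuclideanSpace ℝ (Fin N) → ℝ}
    {g : EuclideanSpace ℝ (Fin N) → EuclideanSpace ℝ (Fin N)} {t : EuclideanSpace ℝ (Fin N) → ℝ}
    (hu : MemW1p Ω p u g) (ht : IsTrace Ω p u g t) (ht0 : t =ᵐ[bdryMeasure Ω] 0) :
    MemW1p0 Ω p u g := by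
  obtain ⟨-, φ, hφ, hconv, hbdry⟩ := ht
  have hbdry' : Tendsto (fun n => eLpNorm (φ n) (ENNReal.ofReal p) (bdryMeasure Ω)) atTop
      (𝓝 0) := by
    refine hbdry.congr fun n => eLpNorm_congr_ae ?_
    filter_upwards [ht0] with x hx
    simp [hx]
  have hη : ∀ n : ℕ, (0 : ℝ≥0∞) < ((n : ℝ≥0∞) + 1)⁻¹ := fun n => by simp
  choose ψ hψ hψu hψg using fun n : ℕ =>
    hC.exists_testFunction_near hΩb hp hu.1 hu.2.1 hφ hconv hbdry' (hη n)
  have hlim : Tendsto (fun n : ℕ => ((n : ℝ≥0∞) + 1)⁻¹) atTop (𝓝 0) := by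
    have := (tendsto_add_atTop_iff_nat 1).2 ENNReal.tendsto_inv_nat_nhds_zero
    simpa using this
  exact ⟨hu, ψ, hψ, tendsto_of_tendsto_of_tendsto_of_le_of_le tendsto_const_nhds hlim
    (fun _ => zero_le) (fun n => (hψu n).le), tendsto_of_tendsto_of_tendsto_of_le_of_le
    tendsto_const_nhds hlim (fun _ => zero_le) (fun n => (hψg n).le)⟩

end IsCollar

end ZeroTrace

section LpSequences

variable {α F : Type*} [MeasurableSpace α] {μ : Measure α} [NormedAddCommGroup F]

theorem exists_eLpNorm_limit [CompleteSpace F] {P : ℝ≥0∞} (hP : 1 ≤ P) {v : ℕ → α → F}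
    (hv : ∀ n, MemLp (v n) P μ)
    (hcau : Tendsto (fun q : ℕ × ℕ => eLpNorm (fun x => v q.1 x - v q.2 x) P μ) atTop (𝓝 0)) :
    ∃ w, MemLp w P μ ∧ Tendsto (fun n => eLpNorm (fun x => v n x - w x) P μ) atTop (𝓝 0) := by
  have : Fact (1 ≤ P) := ⟨hP⟩
  have h1 : CauchySeq fun n => (hv n).toLp (v n) := by
    rw [EMetric.cauchySeq_iff]
    intro ε hε
    obtain ⟨⟨n₁, n₂⟩, hn⟩ := eventually_atTop.1 (hcau.eventually_lt_const hε)
    refine ⟨max n₁ n₂, fun m hm n hn' => ?_⟩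
    rw [Lp.edist_toLp_toLp]
    exact hn (m, n) ⟨(le_max_left _ _).trans hm, (le_max_right _ _).trans hn'⟩
  obtain ⟨w, hw⟩ := cauchySeq_tendsto_of_complete h1
  refine ⟨w, Lp.memLp w, ?_⟩
  have h2 := (Lp.tendsto_Lp_iff_tendsto_eLpNorm' _ _).1 hw
  refine h2.congr fun n => eLpNorm_congr_ae ?_
  filter_upwards [(hv n).coeFn_toLp] with x hx
  simp [hx]

theorem ae_eq_of_tendsto_eLpNorm {P : ℝ≥0∞} (hP : 1 ≤ P) {v : ℕ → α → F} {w w' : α → F}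
    (hv : ∀ n, AEStronglyMeasurable (v n) μ) (hw : AEStronglyMeasurable w μ)
    (hw' : AEStronglyMeasurable w' μ)
    (h : Tendsto (fun n => eLpNorm (fun x => v n x - w x) P μ) atTop (𝓝 0))
    (h' : Tendsto (fun n => eLpNorm (fun x => v n x - w' x) P μ) atTop (𝓝 0)) : w =ᵐ[μ] w' := by
  have h1 : eLpNorm (w' - w) P μ ≤ 0 := by
    have h2 := h.add h'
    rw [add_zero] at h2
    refine ge_of_tendsto' h2 fun n => ?_
    have : w' - w = (fun x => v n x - w x) - fun x => v n x - w' x := by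
      funext x
      simp
    rw [this]
    exact eLpNorm_sub_le ((hv n).sub hw) ((hv n).sub hw') hP
  have h3 := (eLpNorm_eq_zero_iff (hw'.sub hw) (by positivity)).1 (nonpos_iff_eq_zero.1 h1)
  filter_upwards [h3] with x hx
  exact (sub_eq_zero.1 hx).symm

theorem tendsto_eLpNorm_of_le_exponent [IsFiniteMeasure μ] {P R : ℝ≥0∞} (hPR : P ≤ R) (hP : P ≠ 0)
    {ι : Type*} {l : Filter ι} {v : ι → α → F} (hv : ∀ n, AEStronglyMeasurable (v n) μ)
    (h : Tendsto (fun n => eLpNorm (v n) R μ) l (𝓝 0)) :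
    Tendsto (fun n => eLpNorm (v n) P μ) l (𝓝 0) := by
  have hK : μ univ ^ (1 / P.toReal - 1 / R.toReal) ≠ ⊤ := by
    rcases eq_or_ne R ⊤ with rfl | hR
    · exact ENNReal.rpow_ne_top_of_nonneg (by simp) (measure_ne_top _ _)
    · refine ENNReal.rpow_ne_top_of_nonneg ?_ (measure_ne_top _ _)
      rw [sub_nonneg]
      exact one_div_le_one_div_of_le (ENNReal.toReal_pos hP (ne_top_of_le_ne_top hR hPR))
        (ENNReal.toReal_mono hR hPR)
  have h1 := ENNReal.Tendsto.mul_const (b := μ univ ^ (1 / P.toReal - 1 / R.toReal)) h (Or.inr hK)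
  rw [zero_mul] at h1
  exact tendsto_of_tendsto_of_tendsto_of_le_of_le tendsto_const_nhds h1 (fun _ => zero_le)
    fun n => eLpNorm_le_eLpNorm_mul_rpow_measure_univ hPR (hv n)

theorem tendsto_eLpNorm_sub_prod {P : ℝ≥0∞} (hP : 1 ≤ P) {v : ℕ → α → F} {w : α → F}
    (hv : ∀ n, AEStronglyMeasurable (v n) μ) (hw : AEStronglyMeasurable w μ)
    (h : Tendsto (fun n => eLpNorm (fun x => v n x - w x) P μ) atTop (𝓝 0)) :
    Tendsto (fun q : ℕ × ℕ => eLpNorm (fun x => v q.1 x - v q.2 x) P μ) atTop (𝓝 0) := by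
  have h1 := (h.comp (tendsto_fst (f := atTop) (g := (atTop : Filter ℕ)))).add
    (h.comp (tendsto_snd (f := (atTop : Filter ℕ)) (g := atTop)))
  rw [prod_atTop_atTop_eq] at h1
  rw [add_zero] at h1
  refine tendsto_of_tendsto_of_tendsto_of_le_of_le tendsto_const_nhds h1 (fun _ => zero_le)
    fun q => ?_
  have : (fun x => v q.1 x - v q.2 x) = (fun x => v q.1 x - w x) - fun x => v q.2 x - w x := by
    funext x
    simp
  simp only [this]
  exact eLpNorm_sub_le ((hv _).sub hw) ((hv _).sub hw) hP

theorem tendsto_eLpNorm_add_sub {P : ℝ≥0∞} (hP : 1 ≤ P) {ι : Type*} {l : Filter ι}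
    [NormedSpace ℝ F] {v v' : ι → α → F} {w w' : α → F} (a b : ℝ)
    (hv : ∀ n, AEStronglyMeasurable (v n) μ) (hv' : ∀ n, AEStronglyMeasurable (v' n) μ)
    (hw : AEStronglyMeasurable w μ) (hw' : AEStronglyMeasurable w' μ)
    (h : Tendsto (fun n => eLpNorm (fun x => v n x - w x) P μ) l (𝓝 0))
    (h' : Tendsto (fun n => eLpNorm (fun x => v' n x - w' x) P μ) l (𝓝 0)) :
    Tendsto (fun n => eLpNorm (fun x => (a • v n x + b • v' n x) - (a • w x + b • w' x)) P μ) l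
      (𝓝 0) := by
  have h1 := (ENNReal.Tendsto.const_mul (a := ‖a‖ₑ) h (Or.inr enorm_ne_top)).add
    (ENNReal.Tendsto.const_mul (a := ‖b‖ₑ) h' (Or.inr enorm_ne_top))
  rw [mul_zero, mul_zero, add_zero] at h1
  refine tendsto_of_tendsto_of_tendsto_of_le_of_le tendsto_const_nhds h1 (fun _ => zero_le)
    fun n => ?_
  have : (fun x => (a • v n x + b • v' n x) - (a • w x + b • w' x)) =
      (a • fun x => v n x - w x) + b • fun x => v' n x - w' x := by
    funext x
    simp only [Pi.add_apply, Pi.smul_apply, smul_sub]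
    abel
  simp only [this]
  refine (eLpNorm_add_le (((hv n).sub hw).const_smul a) (((hv' n).sub hw').const_smul b) hP).trans
    (add_le_add ?_ ?_)
  · exact (eLpNorm_const_smul _ _ _ _).le
  · exact (eLpNorm_const_smul _ _ _ _).le

end LpSequences

section Traces

open Metric

variable {N : ℕ} {Ω : Set (EuclideanSpace ℝ (Fin N))} {f : EuclideanSpace ℝ (Fin N) → ℝ}
  {r δ c M L : ℝ}

theorem SubcriticalTrace.exponent_lt {p q : ℝ} (hp : 1 < p) (hsub : SubcriticalTrace N p q) :
    N * (max p q / p - 1) + 1 < max p q := by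
  have hp0 : 0 < p := by linarith
  set R := max p q
  have hpR : p ≤ R := le_max_left _ _
  have hk : 0 ≤ R / p - 1 := by rw [sub_nonneg, one_le_div hp0]; exact hpR
  rcases le_or_gt (N : ℝ) p with hN | hN
  · have h1 : N * (R / p - 1) ≤ p * (R / p - 1) := mul_le_mul_of_nonneg_right hN hk
    have h2 : p * (R / p - 1) = R - p := by field_simp
    linarith
  · have hNp : 0 < (N : ℝ) - p := by linarith
    have hR : R < p * (N - 1) / (N - p) := by
      refine max_lt ?_ (hsub hN)
      rw [lt_div_iff₀ hNp]
      nlinarith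
    rw [lt_div_iff₀ hNp] at hR
    have h1 : N * (R / p - 1) + 1 = (N * R - p * N + p) / p := by field_simp
    rw [h1, div_lt_iff₀ hp0]
    nlinarith

theorem gradient_linearComb {φ ψ : EuclideanSpace ℝ (Fin N) → ℝ} (hφ : ContDiff ℝ 1 φ)
    (hψ : ContDiff ℝ 1 ψ) (a b : ℝ) (x : EuclideanSpace ℝ (Fin N)) :
    gradient (fun y => a • φ y + b • ψ y) x = a • gradient φ x + b • gradient ψ x := by
  have h1 : DifferentiableAt ℝ φ x := (hφ.differentiable one_ne_zero).differentiableAt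
  have h2 : DifferentiableAt ℝ ψ x := (hψ.differentiable one_ne_zero).differentiableAt
  rw [gradient, fderiv_fun_add (h1.fun_const_smul a) (h2.fun_const_smul b),
    fderiv_fun_const_smul h1, fderiv_fun_const_smul h2, map_add]
  simp [gradient]

theorem isTrace_linearComb {p : ℝ} (hp : 1 < p) (a b : ℝ)
    {u u' t t' : EuclideanSpace ℝ (Fin N) → ℝ}
    {g g' : EuclideanSpace ℝ (Fin N) → EuclideanSpace ℝ (Fin N)}
    (hu : MemW1p Ω p u g) (hu' : MemW1p Ω p u' g')
    (ht : IsTrace Ω p u g t) (ht' : IsTrace Ω p u' g' t') :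
    IsTrace Ω p (fun x => a • u x + b • u' x) (fun x => a • g x + b • g' x)
      (fun x => a • t x + b • t' x) := by
  have hp1 : 1 ≤ ENNReal.ofReal p := by simpa using hp.le
  obtain ⟨htm, φ, hφ, hφW, hφt⟩ := ht
  obtain ⟨htm', ψ, hψ, hψW, hψt⟩ := ht'
  have hφ1 : ∀ n, ContDiff ℝ 1 (φ n) := fun n => (hφ n).of_le (by exact_mod_cast le_top)
  have hψ1 : ∀ n, ContDiff ℝ 1 (ψ n) := fun n => (hψ n).of_le (by exact_mod_cast le_top)
  refine ⟨(htm.const_smul a).add (htm'.const_smul b), fun n x => a • φ n x + b • ψ n x,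
    fun n => ((hφ n).const_smul a).add ((hψ n).const_smul b), ⟨?_, ?_⟩, ?_⟩
  · exact tendsto_eLpNorm_add_sub hp1 a b (fun n => (hφ n).continuous.aestronglyMeasurable)
      (fun n => (hψ n).continuous.aestronglyMeasurable) hu.1.1 hu'.1.1 hφW.1 hψW.1
  · simp only [gradient_linearComb (hφ1 _) (hψ1 _)]
    exact tendsto_eLpNorm_add_sub hp1 a b
      (fun n => (continuous_gradient (hφ1 n)).aestronglyMeasurable)
      (fun n => (continuous_gradient (hψ1 n)).aestronglyMeasurable) hu.2.1.1 hu'.2.1.1 hφW.2 hψW.2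
  · exact tendsto_eLpNorm_add_sub hp1 a b (fun n => (hφ n).continuous.aestronglyMeasurable)
      (fun n => (hψ n).continuous.aestronglyMeasurable) htm.1 htm'.1 hφt hψt

theorem isBounded_fderiv_apply {φ : EuclideanSpace ℝ (Fin N) → ℝ} (hφ : ContDiff ℝ ∞ φ)
    (hφc : HasCompactSupport φ) (v : EuclideanSpace ℝ (Fin N)) :
    ∃ B : ℝ, ∀ x, ‖fderiv ℝ φ x v‖ ≤ B := by
  have h1 : Continuous fun x => fderiv ℝ φ x v :=
    ((hφ.of_le (by exact_mod_cast le_top) : ContDiff ℝ 1 φ).continuous_fderiv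
      one_ne_zero).clm_apply continuous_const
  have h2 : HasCompactSupport fun x => fderiv ℝ φ x v := (hφc.fderiv ℝ).comp_left
    (g := fun ℓ : EuclideanSpace ℝ (Fin N) →L[ℝ] ℝ => ℓ v) rfl
  exact h2.exists_bound_of_continuous h1

theorem integrable_mul_of_memLp_of_bounded {μ : Measure (EuclideanSpace ℝ (Fin N))}
    [IsFiniteMeasure μ] {P : ℝ≥0∞} (hP : 1 ≤ P) {u k : EuclideanSpace ℝ (Fin N) → ℝ}
    (hu : MemLp u P μ) (hk : Continuous k) {B : ℝ} (hB : ∀ x, ‖k x‖ ≤ B) :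
    Integrable (fun x => u x * k x) μ :=
  (hu.integrable hP).mul_bdd hk.aestronglyMeasurable (Eventually.of_forall hB)

theorem tendsto_integral_mul_of_tendsto_eLpNorm {μ : Measure (EuclideanSpace ℝ (Fin N))}
    [IsFiniteMeasure μ] {P : ℝ≥0∞} (hP : 1 ≤ P) {v : ℕ → EuclideanSpace ℝ (Fin N) → ℝ}
    {u k : EuclideanSpace ℝ (Fin N) → ℝ} (hv : ∀ n, MemLp (v n) P μ) (hu : MemLp u P μ)
    (hk : Continuous k) {B : ℝ} (hB : ∀ x, ‖k x‖ ≤ B)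
    (h : Tendsto (fun n => eLpNorm (fun x => v n x - u x) P μ) atTop (𝓝 0)) :
    Tendsto (fun n => ∫ x, v n x * k x ∂μ) atTop (𝓝 (∫ x, u x * k x ∂μ)) := by
  refine tendsto_integral_of_L1' _ (integrable_mul_of_memLp_of_bounded hP hu hk hB).1
    (Eventually.of_forall fun n => integrable_mul_of_memLp_of_bounded hP (hv n) hk hB) ?_
  have h1 := tendsto_eLpNorm_of_le_exponent hP one_ne_zero (fun n => ((hv n).sub hu).1) h
  have h2 := ENNReal.Tendsto.const_mul (a := ENNReal.ofReal B) h1 (Or.inr ENNReal.ofReal_ne_top)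
  rw [mul_zero] at h2
  refine tendsto_of_tendsto_of_tendsto_of_le_of_le tendsto_const_nhds h2 (fun _ => zero_le)
    fun n => ?_
  refine eLpNorm_le_mul_eLpNorm_of_ae_le_mul (Eventually.of_forall fun x => ?_) _
  simp only [Pi.sub_apply]
  rw [← sub_mul, norm_mul, mul_comm]
  gcongr
  exact hB x

theorem memW1p_linearComb (hΩb : IsBounded Ω) {p : ℝ} (hp : 1 < p) (a b : ℝ)
    {u u' : EuclideanSpace ℝ (Fin N) → ℝ}
    {g g' : EuclideanSpace ℝ (Fin N) → EuclideanSpace ℝ (Fin N)}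
    (hu : MemW1p Ω p u g) (hu' : MemW1p Ω p u' g') :
    MemW1p Ω p (fun x => a • u x + b • u' x) (fun x => a • g x + b • g' x) := by
  have := isFiniteMeasure_restrict_of_isBounded hΩb
  have hp1 : 1 ≤ ENNReal.ofReal p := by simpa using hp.le
  refine ⟨(hu.1.const_smul a).add (hu'.1.const_smul b),
    (hu.2.1.const_smul a).add (hu'.2.1.const_smul b), fun φ hφ hφc hφΩ v => ?_⟩
  obtain ⟨B₁, hB₁⟩ := isBounded_fderiv_apply hφ hφc v
  obtain ⟨B₂, hB₂⟩ := hφc.exists_bound_of_continuous hφ.continuous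
  have hk : Continuous fun x => fderiv ℝ φ x v :=
    ((hφ.of_le (by exact_mod_cast le_top) : ContDiff ℝ 1 φ).continuous_fderiv
      one_ne_zero).clm_apply continuous_const
  have e1 := hu.2.2 φ hφ hφc hφΩ v
  have e2 := hu'.2.2 φ hφ hφc hφΩ v
  have i1 := integrable_mul_of_memLp_of_bounded hp1 hu.1 hk hB₁
  have i2 := integrable_mul_of_memLp_of_bounded hp1 hu'.1 hk hB₁
  have j1 := integrable_mul_of_memLp_of_bounded hp1 (hu.2.1.inner_const v) hφ.continuous hB₂
  have j2 := integrable_mul_of_memLp_of_bounded hp1 (hu'.2.1.inner_const v) hφ.continuous hB₂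
  calc ∫ x in Ω, (a • u x + b • u' x) * fderiv ℝ φ x v
      = ∫ x in Ω, (a * (u x * fderiv ℝ φ x v) + b * (u' x * fderiv ℝ φ x v)) := by
        congr 1
        funext x
        simp only [smul_eq_mul]
        ring
    _ = a * (-∫ x in Ω, φ x * ⟪g x, v⟫) + b * (-∫ x in Ω, φ x * ⟪g' x, v⟫) := by
        rw [integral_add (i1.const_mul a) (i2.const_mul b), integral_const_mul,
          integral_const_mul, e1, e2]
    _ = -∫ x in Ω, (a * (⟪g x, v⟫ * φ x) + b * (⟪g' x, v⟫ * φ x)) := by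
        rw [integral_add (j1.const_mul a) (j2.const_mul b), integral_const_mul,
          integral_const_mul]
        simp only [mul_comm (φ _)]
        ring
    _ = _ := by
        congr 2
        funext x
        rw [inner_add_left, real_inner_smul_left, real_inner_smul_left]
        ring

theorem memW1p_of_tendsto (hΩb : IsBounded Ω) {p : ℝ} (hp : 1 < p)
    {v : ℕ → EuclideanSpace ℝ (Fin N) → ℝ}
    {h : ℕ → EuclideanSpace ℝ (Fin N) → EuclideanSpace ℝ (Fin N)}
    {u : EuclideanSpace ℝ (Fin N) → ℝ}
    {g : EuclideanSpace ℝ (Fin N) → EuclideanSpace ℝ (Fin N)}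
    (hv : ∀ n, MemW1p Ω p (v n) (h n)) (hu : MemLp u (ENNReal.ofReal p) (volume.restrict Ω))
    (hg : MemLp g (ENNReal.ofReal p) (volume.restrict Ω))
    (hvu : Tendsto (fun n => eLpNorm (fun x => v n x - u x) (ENNReal.ofReal p)
      (volume.restrict Ω)) atTop (𝓝 0))
    (hhg : Tendsto (fun n => eLpNorm (fun x => h n x - g x) (ENNReal.ofReal p)
      (volume.restrict Ω)) atTop (𝓝 0)) : MemW1p Ω p u g := by
  have := isFiniteMeasure_restrict_of_isBounded hΩb
  have hp1 : 1 ≤ ENNReal.ofReal p := by simpa using hp.le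
  refine ⟨hu, hg, fun φ hφ hφc hφΩ w => ?_⟩
  obtain ⟨B₁, hB₁⟩ := isBounded_fderiv_apply hφ hφc w
  obtain ⟨B₂, hB₂⟩ := hφc.exists_bound_of_continuous hφ.continuous
  have hk : Continuous fun x => fderiv ℝ φ x w :=
    ((hφ.of_le (by exact_mod_cast le_top) : ContDiff ℝ 1 φ).continuous_fderiv
      one_ne_zero).clm_apply continuous_const
  have l1 := tendsto_integral_mul_of_tendsto_eLpNorm hp1 (fun n => (hv n).1) hu hk hB₁ hvu
  have hhg' : Tendsto (fun n => eLpNorm (fun x => ⟪h n x, w⟫ - ⟪g x, w⟫) (ENNReal.ofReal p)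
      (volume.restrict Ω)) atTop (𝓝 0) := by
    have h2 := ENNReal.Tendsto.const_mul (a := ENNReal.ofReal ‖w‖) hhg
      (Or.inr ENNReal.ofReal_ne_top)
    rw [mul_zero] at h2
    refine tendsto_of_tendsto_of_tendsto_of_le_of_le tendsto_const_nhds h2 (fun _ => zero_le)
      fun n => ?_
    refine eLpNorm_le_mul_eLpNorm_of_ae_le_mul (Eventually.of_forall fun x => ?_) _
    rw [← inner_sub_left, mul_comm]
    exact norm_inner_le_norm _ _
  have l2 := tendsto_integral_mul_of_tendsto_eLpNorm hp1 (fun n => (hv n).2.1.inner_const w)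
    (hg.inner_const w) hφ.continuous hB₂ hhg'
  simp only [mul_comm _ (φ _)] at l2
  refine tendsto_nhds_unique l1 (l2.neg.congr fun n => ?_)
  exact ((hv n).2.2 φ hφ hφc hφΩ w).symm

end Traces

section TraceOperator

variable {N : ℕ} {Ω : Set (EuclideanSpace ℝ (Fin N))} {f : EuclideanSpace ℝ (Fin N) → ℝ}
  {r δ c M L : ℝ}

theorem ENNReal.ofReal_one_le {p : ℝ} (hp : 1 ≤ p) : 1 ≤ ENNReal.ofReal p := by simpa using hp

theorem tendsto_eLpNorm_sub_of_tendsto {α F : Type*} [MeasurableSpace α] {μ : Measure α}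
    [NormedAddCommGroup F] {P : ℝ≥0∞} (hP : 1 ≤ P) {ι : Type*} {l : Filter ι} {v v' w : ι → α → F}
    (hv : ∀ n, AEStronglyMeasurable (v n) μ) (hv' : ∀ n, AEStronglyMeasurable (v' n) μ)
    (hw : ∀ n, AEStronglyMeasurable (w n) μ)
    (h : Tendsto (fun n => eLpNorm (fun x => v n x - w n x) P μ) l (𝓝 0))
    (h' : Tendsto (fun n => eLpNorm (fun x => v' n x - w n x) P μ) l (𝓝 0)) :
    Tendsto (fun n => eLpNorm (fun x => v n x - v' n x) P μ) l (𝓝 0) := by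
  have h1 := h.add h'
  rw [add_zero] at h1
  refine tendsto_of_tendsto_of_tendsto_of_le_of_le tendsto_const_nhds h1 (fun _ => zero_le)
    fun n => ?_
  have : (fun x => v n x - v' n x) = (fun x => v n x - w n x) - fun x => v' n x - w n x := by
    funext x
    simp
  simp only [this]
  exact eLpNorm_sub_le ((hv n).sub (hw n)) ((hv' n).sub (hw n)) hP

theorem eLpNorm_sub_swap {α F : Type*} [MeasurableSpace α] {μ : Measure α}
    [NormedAddCommGroup F] (P : ℝ≥0∞) (v w : α → F) :
    eLpNorm (fun x => v x - w x) P μ = eLpNorm (fun x => w x - v x) P μ :=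
  eLpNorm_sub_comm v w P μ

theorem eLpNorm_le_add_of_sub {α F : Type*} [MeasurableSpace α] {μ : Measure α}
    [NormedAddCommGroup F] {P : ℝ≥0∞} (hP : 1 ≤ P) {v w : α → F}
    (hv : AEStronglyMeasurable v μ) (hw : AEStronglyMeasurable w μ) :
    eLpNorm v P μ ≤ eLpNorm (fun x => v x - w x) P μ + eLpNorm w P μ := by
  have : v = (fun x => v x - w x) + w := by
    funext x
    simp
  conv_lhs => rw [this]
  exact eLpNorm_add_le (hv.sub hw) hw hP

namespace IsCollar

theorem tendsto_eLpNorm_bdry_sub (hC : IsCollar Ω f r δ c M L) {p R : ℝ} (hp : 1 < p)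
    (hpR : p ≤ R) (hsub : N * (R / p - 1) + 1 < R) {ι : Type*} {l : Filter ι}
    {φ ψ : ι → EuclideanSpace ℝ (Fin N) → ℝ} (hφ : ∀ n, ContDiff ℝ 1 (φ n))
    (hψ : ∀ n, ContDiff ℝ 1 (ψ n))
    (h : Tendsto (fun n => eLpNorm (fun x => φ n x - ψ n x) (ENNReal.ofReal p)
      (volume.restrict Ω)) l (𝓝 0))
    (h' : Tendsto (fun n => eLpNorm (fun x => gradient (φ n) x - gradient (ψ n) x)
      (ENNReal.ofReal p) (volume.restrict Ω)) l (𝓝 0)) :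
    Tendsto (fun n => eLpNorm (fun x => φ n x - ψ n x) (ENNReal.ofReal R) (bdryMeasure Ω)) l
      (𝓝 0) := by
  obtain ⟨K, hK, hle⟩ := hC.exists_eLpNorm_bdry_le hp hpR hsub
  have h1 := ENNReal.Tendsto.const_mul (a := K) (h.add h') (Or.inr hK)
  rw [add_zero, mul_zero] at h1
  refine tendsto_of_tendsto_of_tendsto_of_le_of_le tendsto_const_nhds h1 (fun _ => zero_le)
    fun n => ?_
  have h2 := hle _ ((hφ n).sub (hψ n))
  have h3 : gradient (fun x => φ n x - ψ n x) = fun x => gradient (φ n) x - gradient (ψ n) x :=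
    funext (gradient_sub_of_contDiff (hφ n) (hψ n))
  rw [h3] at h2
  exact h2

/-- The smooth approximations of a Sobolev function converge to its trace in the better space
`L^R` of the subcritical trace embedding. -/
theorem memLp_and_tendsto_of_isTrace (hC : IsCollar Ω f r δ c M L) (hΩb : IsBounded Ω)
    {p R : ℝ} (hp : 1 < p) (hpR : p ≤ R) (hsub : N * (R / p - 1) + 1 < R)
    {u t : EuclideanSpace ℝ (Fin N) → ℝ}
    {g : EuclideanSpace ℝ (Fin N) → EuclideanSpace ℝ (Fin N)} (hu : MemW1p Ω p u g)
    (ht : IsTrace Ω p u g t) :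
    MemLp t (ENNReal.ofReal R) (bdryMeasure Ω) ∧
    ∃ φ : ℕ → EuclideanSpace ℝ (Fin N) → ℝ, (∀ n, ContDiff ℝ ∞ (φ n)) ∧ TendstoW1p Ω p φ u g ∧
      Tendsto (fun n => eLpNorm (fun x => φ n x - t x) (ENNReal.ofReal R) (bdryMeasure Ω))
        atTop (𝓝 0) := by
  have := hC.isFiniteMeasure
  have hp1 := ENNReal.ofReal_one_le hp.le
  have hR1 := ENNReal.ofReal_one_le (hp.le.trans hpR)
  obtain ⟨htm, φ, hφ, hφW, hφt⟩ := ht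
  have hφ1 : ∀ n, ContDiff ℝ 1 (φ n) := fun n => (hφ n).of_le (by exact_mod_cast le_top)
  have h1 := tendsto_eLpNorm_sub_prod hp1 (fun n => (hφ n).continuous.aestronglyMeasurable)
    hu.1.1 hφW.1
  have h2 := tendsto_eLpNorm_sub_prod hp1
    (fun n => (continuous_gradient (hφ1 n)).aestronglyMeasurable) hu.2.1.1 hφW.2
  have h3 := hC.tendsto_eLpNorm_bdry_sub hp hpR hsub (φ := fun k : ℕ × ℕ => φ k.1)
    (ψ := fun k : ℕ × ℕ => φ k.2) (fun _ => hφ1 _) (fun _ => hφ1 _) h1 h2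
  obtain ⟨w, hw, hφw⟩ := exists_eLpNorm_limit hR1
    (fun n => memLp_bdryMeasure_of_continuous hΩb (hφ n).continuous (ENNReal.ofReal R)) h3
  have h4 := tendsto_eLpNorm_of_le_exponent (ENNReal.ofReal_le_ofReal hpR)
    (by positivity) (fun n => (hφ n).continuous.aestronglyMeasurable.sub hw.1) hφw
  have h5 : w =ᵐ[bdryMeasure Ω] t := ae_eq_of_tendsto_eLpNorm hp1
    (fun n => (hφ n).continuous.aestronglyMeasurable) hw.1 htm.1 h4 hφt
  refine ⟨hw.ae_eq h5, φ, hφ, hφW, hφw.congr fun n => eLpNorm_congr_ae ?_⟩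
  filter_upwards [h5] with x hx
  rw [hx]

theorem isTrace_unique (hC : IsCollar Ω f r δ c M L) {p : ℝ} (hp : 1 < p)
    {u t t' : EuclideanSpace ℝ (Fin N) → ℝ}
    {g : EuclideanSpace ℝ (Fin N) → EuclideanSpace ℝ (Fin N)} (hu : MemW1p Ω p u g)
    (ht : IsTrace Ω p u g t) (ht' : IsTrace Ω p u g t') : t =ᵐ[bdryMeasure Ω] t' := by
  have hp1 := ENNReal.ofReal_one_le hp.le
  obtain ⟨htm, φ, hφ, hφW, hφt⟩ := ht
  obtain ⟨htm', ψ, hψ, hψW, hψt⟩ := ht'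
  have hφ1 : ∀ n, ContDiff ℝ 1 (φ n) := fun n => (hφ n).of_le (by exact_mod_cast le_top)
  have hψ1 : ∀ n, ContDiff ℝ 1 (ψ n) := fun n => (hψ n).of_le (by exact_mod_cast le_top)
  have hφm := fun (μ : Measure (EuclideanSpace ℝ (Fin N))) n =>
    (hφ n).continuous.aestronglyMeasurable (μ := μ)
  have hψm := fun (μ : Measure (EuclideanSpace ℝ (Fin N))) n =>
    (hψ n).continuous.aestronglyMeasurable (μ := μ)
  have hsub : N * (p / p - 1) + 1 < p := by
    rw [div_self (by positivity), sub_self, mul_zero]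
    linarith
  have h1 := hC.tendsto_eLpNorm_bdry_sub hp le_rfl hsub hφ1 hψ1
    (tendsto_eLpNorm_sub_of_tendsto hp1 (hφm _) (hψm _) (fun _ => hu.1.1) hφW.1 hψW.1)
    (tendsto_eLpNorm_sub_of_tendsto hp1
      (fun n => (continuous_gradient (hφ1 n)).aestronglyMeasurable)
      (fun n => (continuous_gradient (hψ1 n)).aestronglyMeasurable) (fun _ => hu.2.1.1)
      hφW.2 hψW.2)
  refine ae_eq_of_tendsto_eLpNorm hp1 (hφm _) htm.1 htm'.1 hφt ?_
  refine tendsto_eLpNorm_sub_of_tendsto hp1 (hφm _) (fun _ => htm'.1) (hψm _) h1 ?_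
  simpa only [eLpNorm_sub_swap _ t'] using hψt

theorem isTrace_zero_of_memW1p0 (hC : IsCollar Ω f r δ c M L) {p : ℝ}
    {u : EuclideanSpace ℝ (Fin N) → ℝ}
    {g : EuclideanSpace ℝ (Fin N) → EuclideanSpace ℝ (Fin N)} (hu : MemW1p0 Ω p u g) :
    IsTrace Ω p u g 0 := by
  obtain ⟨-, ψ, hψ, hψW⟩ := hu
  refine ⟨MemLp.zero, ψ, fun n => (hψ n).1, hψW, ?_⟩
  have h1 : ∀ n, eLpNorm (fun x => ψ n x - (0 : EuclideanSpace ℝ (Fin N) → ℝ) x)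
      (ENNReal.ofReal p) (bdryMeasure Ω) = 0 := fun n => by
    refine (eLpNorm_congr_ae ?_).trans eLpNorm_zero
    filter_upwards [ae_mem_frontier Ω] with x hx
    have hxΩ : x ∉ Ω := fun h => by
      rw [hC.isOpen.frontier_eq] at hx
      exact hx.2 h
    have : ψ n x = 0 := image_eq_zero_of_notMem_tsupport fun h => hxΩ ((hψ n).2.2 h)
    simp [this]
  simp only [h1]
  exact tendsto_const_nhds

/-- Sequences bounded in `W^{1,p}(Ω)` have subsequences with convergent traces, and the limit of
the traces is the trace of the limit. -/
theorem exists_subseq_tendsto_trace (hC : IsCollar Ω f r δ c M L) (hΩb : IsBounded Ω)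
    {p R : ℝ} (hp : 1 < p) (hpR : p ≤ R) (hsub : N * (R / p - 1) + 1 < R)
    {u t : ℕ → EuclideanSpace ℝ (Fin N) → ℝ}
    {g : ℕ → EuclideanSpace ℝ (Fin N) → EuclideanSpace ℝ (Fin N)}
    (hu : ∀ n, MemW1p Ω p (u n) (g n)) (ht : ∀ n, IsTrace Ω p (u n) (g n) (t n)) {B : ℝ≥0∞}
    (hB : B ≠ ⊤) (huB : ∀ n, eLpNorm (u n) (ENNReal.ofReal p) (volume.restrict Ω) ≤ B)
    (hgB : ∀ n, eLpNorm (g n) (ENNReal.ofReal p) (volume.restrict Ω) ≤ B) :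
    ∃ ns : ℕ → ℕ, StrictMono ns ∧ ∃ s, MemLp s (ENNReal.ofReal R) (bdryMeasure Ω) ∧
      Tendsto (fun n => eLpNorm (fun x => t (ns n) x - s x) (ENNReal.ofReal R) (bdryMeasure Ω))
        atTop (𝓝 0) ∧
      ∀ v h, MemW1p Ω p v h →
        Tendsto (fun n => eLpNorm (fun x => u (ns n) x - v x) (ENNReal.ofReal p)
          (volume.restrict Ω)) atTop (𝓝 0) →
        Tendsto (fun n => eLpNorm (fun x => g (ns n) x - h x) (ENNReal.ofReal p)
          (volume.restrict Ω)) atTop (𝓝 0) → IsTrace Ω p v h s := by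
  have := hC.isFiniteMeasure
  have hp1 := ENNReal.ofReal_one_le hp.le
  have hR1 := ENNReal.ofReal_one_le (hp.le.trans hpR)
  have hε : ∀ n : ℕ, (0 : ℝ≥0∞) < ((n : ℝ≥0∞) + 1)⁻¹ := fun n =>
    ENNReal.inv_pos.2 (by finiteness)
  have hex : ∀ n : ℕ, ∃ φ : EuclideanSpace ℝ (Fin N) → ℝ, ContDiff ℝ ∞ φ ∧
      eLpNorm (fun x => φ x - u n x) (ENNReal.ofReal p) (volume.restrict Ω) < ((n : ℝ≥0∞) + 1)⁻¹ ∧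
      eLpNorm (fun x => gradient φ x - g n x) (ENNReal.ofReal p) (volume.restrict Ω) <
        ((n : ℝ≥0∞) + 1)⁻¹ ∧
      eLpNorm (fun x => φ x - t n x) (ENNReal.ofReal R) (bdryMeasure Ω) < ((n : ℝ≥0∞) + 1)⁻¹ := by
    intro n
    obtain ⟨-, ψ, hψ, hψW, hψt⟩ :=
      hC.memLp_and_tendsto_of_isTrace hΩb hp hpR hsub (hu n) (ht n)
    obtain ⟨k, h1, h2, h3⟩ := ((hψW.1.eventually_lt_const (hε n)).and
      ((hψW.2.eventually_lt_const (hε n)).and (hψt.eventually_lt_const (hε n)))).exists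
    exact ⟨ψ k, hψ k, h1, h2, h3⟩
  choose φ hφ hφu hφg hφt using hex
  have hφ1 : ∀ n, ContDiff ℝ 1 (φ n) := fun n => (hφ n).of_le (by exact_mod_cast le_top)
  have hφm := fun (μ : Measure (EuclideanSpace ℝ (Fin N))) n =>
    (hφ n).continuous.aestronglyMeasurable (μ := μ)
  have hgm := fun (μ : Measure (EuclideanSpace ℝ (Fin N))) n =>
    (continuous_gradient (hφ1 n)).aestronglyMeasurable (μ := μ)
  have htm : ∀ n, AEStronglyMeasurable (t n) (bdryMeasure Ω) := fun n => (ht n).1.1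
  have hle1 : ∀ n : ℕ, ((n : ℝ≥0∞) + 1)⁻¹ ≤ 1 := fun n => by simp
  obtain ⟨ns, hns, hcau⟩ := hC.exists_subseq_tendsto_eLpNorm_sub hΩb hp hpR hsub hφ1
    (B := 1 + B) (by finiteness)
    (fun n => (eLpNorm_le_add_of_sub hp1 (hφm _ n) (hu n).1.1).trans
      (add_le_add ((hφu n).le.trans (hle1 n)) (huB n)))
    (fun n => (eLpNorm_le_add_of_sub hp1 (hgm _ n) (hu n).2.1.1).trans
      (add_le_add ((hφg n).le.trans (hle1 n)) (hgB n)))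
  obtain ⟨s, hs, hφs⟩ := exists_eLpNorm_limit hR1 (fun n =>
    memLp_bdryMeasure_of_continuous hΩb (hφ (ns n)).continuous (ENNReal.ofReal R)) hcau
  have hinv : Tendsto (fun n : ℕ => ((n : ℝ≥0∞) + 1)⁻¹) atTop (𝓝 0) := by
    have := ENNReal.tendsto_inv_nat_nhds_zero.comp (tendsto_add_atTop_nat 1)
    refine this.congr fun n => ?_
    simp
  have hsq : ∀ {a : ℕ → ℝ≥0∞}, (∀ n, a n < ((n : ℝ≥0∞) + 1)⁻¹) →
      Tendsto (fun n => a (ns n)) atTop (𝓝 0) := fun {a} ha =>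
    (tendsto_of_tendsto_of_tendsto_of_le_of_le tendsto_const_nhds hinv (fun _ => zero_le)
      fun n => (ha n).le).comp hns.tendsto_atTop
  refine ⟨ns, hns, s, hs, ?_, fun v h hv hvu hgh => ⟨?_, fun n => φ (ns n), fun n => hφ _,
    ⟨?_, ?_⟩, ?_⟩⟩
  · refine tendsto_eLpNorm_sub_of_tendsto hR1 (fun n => htm (ns n)) (fun _ => hs.1)
      (fun n => hφm _ (ns n)) ?_ ?_
    · simpa only [eLpNorm_sub_swap _ (t _)] using hsq hφt
    · simpa only [eLpNorm_sub_swap _ s] using hφs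
  · exact hs.mono_exponent (ENNReal.ofReal_le_ofReal hpR)
  · refine tendsto_eLpNorm_sub_of_tendsto hp1 (fun n => hφm _ (ns n)) (fun _ => hv.1.1)
      (fun n => (hu (ns n)).1.1) (hsq hφu) ?_
    simpa only [eLpNorm_sub_swap _ v] using hvu
  · refine tendsto_eLpNorm_sub_of_tendsto hp1 (fun n => hgm _ (ns n)) (fun _ => hv.2.1.1)
      (fun n => (hu (ns n)).2.1.1) (hsq hφg) ?_
    simpa only [eLpNorm_sub_swap _ h] using hgh
  · exact tendsto_eLpNorm_of_le_exponent (ENNReal.ofReal_le_ofReal hpR)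
      (by positivity) (fun n => (hφm _ (ns n)).sub hs.1) hφs

end IsCollar

end TraceOperator

section UniformConvexity

variable {F : Type*} [NormedAddCommGroup F] [NormedSpace ℝ F]

theorem norm_midpoint_rpow_lt [StrictConvexSpace ℝ F] {p : ℝ} (hp : 1 < p) {a b : F}
    (hab : a ≠ b) :
    ‖(1 / 2 : ℝ) • a + (1 / 2 : ℝ) • b‖ ^ p < (‖a‖ ^ p + ‖b‖ ^ p) / 2 := by
  have hp0 : 0 < p := by linarith
  have h1 : ‖(1 / 2 : ℝ) • a + (1 / 2 : ℝ) • b‖ ≤ (1 / 2) * ‖a‖ + (1 / 2) * ‖b‖ := by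
    refine (norm_add_le _ _).trans (le_of_eq ?_)
    simp [norm_smul]
  rcases eq_or_ne ‖a‖ ‖b‖ with he | hne
  · have h2 : ‖(1 / 2 : ℝ) • a + (1 / 2 : ℝ) • b‖ < ‖a‖ := by
      rw [← smul_add]
      exact (norm_midpoint_lt_iff he).2 hab
    have h3 := Real.rpow_lt_rpow (norm_nonneg _) h2 hp0
    rw [← he]
    linarith
  · have h2 := (strictConvexOn_rpow hp).2 (norm_nonneg a) (norm_nonneg b) hne
      (by norm_num : (0 : ℝ) < 1 / 2) (by norm_num : (0 : ℝ) < 1 / 2) (by norm_num)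
    simp only [smul_eq_mul] at h2
    have h3 := Real.rpow_le_rpow (norm_nonneg _) h1 hp0.le
    linarith

theorem norm_midpoint_rpow_le [StrictConvexSpace ℝ F] {p : ℝ} (hp : 1 < p) (a b : F) :
    ‖(1 / 2 : ℝ) • a + (1 / 2 : ℝ) • b‖ ^ p ≤ (‖a‖ ^ p + ‖b‖ ^ p) / 2 := by
  rcases eq_or_ne a b with rfl | hab
  · rw [← add_smul]
    norm_num
  · exact (norm_midpoint_rpow_lt hp hab).le

/-- A quantitative form of the uniform convexity of `a ↦ ‖a‖ ^ p`. -/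
theorem exists_norm_sub_rpow_add_le [StrictConvexSpace ℝ F] [FiniteDimensional ℝ F] {p : ℝ}
    (hp : 1 < p) {ε : ℝ} (hε : 0 < ε) :
    ∃ C₀ : ℝ, ∀ C, C₀ ≤ C → ∀ a b : F,
      ‖a - b‖ ^ p + C * ‖(1 / 2 : ℝ) • a + (1 / 2 : ℝ) • b‖ ^ p ≤
        (ε + C / 2) * (‖a‖ ^ p + ‖b‖ ^ p) := by
  have hp0 : 0 < p := by linarith
  let D : F × F → ℝ := fun z => (‖z.1‖ ^ p + ‖z.2‖ ^ p) / 2 -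
    ‖(1 / 2 : ℝ) • z.1 + (1 / 2 : ℝ) • z.2‖ ^ p
  have hcr : Continuous fun y : ℝ => y ^ p := Real.continuous_rpow_const hp0.le
  have hD : Continuous D :=
    ((((hcr.comp continuous_fst.norm).add (hcr.comp continuous_snd.norm)).div_const 2).sub
      (hcr.comp (by fun_prop)))
  have hD0 : ∀ z, 0 ≤ D z := fun z => sub_nonneg.2 (norm_midpoint_rpow_le hp z.1 z.2)
  let K : Set (F × F) := {z | ‖z.1‖ ^ p + ‖z.2‖ ^ p = 1} ∩ {z | ε ≤ ‖z.1 - z.2‖ ^ p}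
  have hKc : IsCompact K := by
    have hproper : ProperSpace (F × F) := FiniteDimensional.proper ℝ _
    refine Metric.isCompact_of_isClosed_isBounded ?_ ?_
    · refine (isClosed_eq ?_ continuous_const).inter (isClosed_le continuous_const ?_)
      · exact (hcr.comp continuous_fst.norm).add (hcr.comp continuous_snd.norm)
      · exact hcr.comp (by fun_prop)
    · refine (Metric.isBounded_closedBall (x := (0 : F × F)) (r := 1)).subset fun z hz => ?_
      have hz1 : ‖z.1‖ ^ p + ‖z.2‖ ^ p = 1 := hz.1
      have h1 : 0 ≤ ‖z.1‖ ^ p := by positivity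
      have h2 : 0 ≤ ‖z.2‖ ^ p := by positivity
      rw [mem_closedBall_zero_iff, Prod.norm_def]
      refine max_le ?_ ?_
      · by_contra! h
        have := Real.one_lt_rpow h hp0
        linarith
      · by_contra! h
        have := Real.one_lt_rpow h hp0
        linarith
  obtain ⟨C₀, hC₀, hCD⟩ : ∃ C₀ : ℝ, 0 ≤ C₀ ∧ ∀ z ∈ K, ‖z.1 - z.2‖ ^ p ≤ C₀ * D z := by
    rcases K.eq_empty_or_nonempty with hK | hK
    · exact ⟨0, le_rfl, fun z hz => by simp [hK] at hz⟩
    · obtain ⟨z₀, hz₀, hmin⟩ := hKc.exists_isMinOn hK hD.continuousOn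
      have hT : Continuous fun z : F × F => ‖z.1 - z.2‖ ^ p := hcr.comp (by fun_prop)
      obtain ⟨z₁, hz₁, hmax⟩ := hKc.exists_isMaxOn hK hT.continuousOn
      have hpos : 0 < D z₀ := by
        refine sub_pos.2 (norm_midpoint_rpow_lt hp fun h => ?_)
        have h1 : ε ≤ ‖z₀.1 - z₀.2‖ ^ p := hz₀.2
        rw [h, sub_self, norm_zero, Real.zero_rpow hp0.ne'] at h1
        linarith
      refine ⟨‖z₁.1 - z₁.2‖ ^ p / D z₀, by positivity, fun z hz => ?_⟩
      have h1 : ‖z.1 - z.2‖ ^ p ≤ ‖z₁.1 - z₁.2‖ ^ p := hmax hz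
      have h2 : D z₀ ≤ D z := hmin hz
      rw [div_mul_eq_mul_div, le_div_iff₀ hpos]
      exact mul_le_mul h1 h2 hpos.le (by positivity)
  refine ⟨C₀, fun C hC a b => ?_⟩
  suffices h : ‖a - b‖ ^ p ≤ ε * (‖a‖ ^ p + ‖b‖ ^ p) + C * D (a, b) by
    have h1 : D (a, b) = (‖a‖ ^ p + ‖b‖ ^ p) / 2 -
      ‖(1 / 2 : ℝ) • a + (1 / 2 : ℝ) • b‖ ^ p := rfl
    rw [h1] at h
    linarith
  set s := ‖a‖ ^ p + ‖b‖ ^ p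
  have ha : 0 ≤ ‖a‖ ^ p := by positivity
  have hb : 0 ≤ ‖b‖ ^ p := by positivity
  have hs0 : 0 ≤ s := add_nonneg ha hb
  rcases hs0.eq_or_lt with hs | hs
  · have ha0 : ‖a‖ ^ p = 0 := by linarith
    have hb0 : ‖b‖ ^ p = 0 := by linarith
    rw [Real.rpow_eq_zero (norm_nonneg _) hp0.ne', norm_eq_zero] at ha0 hb0
    rw [ha0, hb0, sub_self, norm_zero, Real.zero_rpow hp0.ne', ← hs]
    have := mul_nonneg (hC₀.trans hC) (hD0 (0, 0))
    linarith
  · set k : ℝ := s ^ (-(1 / p))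
    have hk : 0 < k := Real.rpow_pos_of_pos hs _
    have hkp : k ^ p = s⁻¹ := by
      rw [← Real.rpow_mul hs.le, neg_mul, one_div_mul_cancel hp0.ne', Real.rpow_neg_one]
    have hnorm : ∀ y : F, ‖k • y‖ ^ p = s⁻¹ * ‖y‖ ^ p := fun y => by
      rw [norm_smul, Real.mul_rpow (norm_nonneg _) (norm_nonneg _), Real.norm_of_nonneg hk.le, hkp]
    have hDk : D (k • a, k • b) = s⁻¹ * D (a, b) := by
      simp only [D]
      rw [smul_comm _ k, smul_comm _ k, ← smul_add, hnorm, hnorm, hnorm]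
      ring
    have hsub : ‖k • a - k • b‖ ^ p = s⁻¹ * ‖a - b‖ ^ p := by rw [← smul_sub, hnorm]
    have hsum : ‖k • a‖ ^ p + ‖k • b‖ ^ p = 1 := by
      rw [hnorm, hnorm, ← mul_add]
      exact inv_mul_cancel₀ hs.ne'
    have key : ‖k • a - k • b‖ ^ p ≤ ε + C * D (k • a, k • b) := by
      have hD1 := hD0 (k • a, k • b)
      rcases le_or_gt ε (‖k • a - k • b‖ ^ p) with h | h
      · have h1 := hCD (k • a, k • b) ⟨hsum, h⟩
        have h2 := mul_le_mul_of_nonneg_right hC hD1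
        simp only at h1
        linarith
      · have h2 := mul_nonneg (hC₀.trans hC) hD1
        linarith
    rw [hsub, hDk] at key
    have h3 := mul_le_mul_of_nonneg_left key hs.le
    rw [← mul_assoc, mul_inv_cancel₀ hs.ne', one_mul] at h3
    refine h3.trans (le_of_eq ?_)
    field_simp

theorem exists_lintegral_sub_rpow_add_le [StrictConvexSpace ℝ F] [FiniteDimensional ℝ F]
    {α : Type*} [MeasurableSpace α] (μ : Measure α) {p : ℝ} (hp : 1 < p) {ε : ℝ} (hε : 0 < ε) :
    ∃ C₀ : ℝ, ∀ C, C₀ ≤ C → 0 ≤ C → ∀ a b : α → F, AEStronglyMeasurable a μ →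
      AEStronglyMeasurable b μ →
      ∫⁻ x, ‖a x - b x‖ₑ ^ p ∂μ +
          ENNReal.ofReal C * ∫⁻ x, ‖(1 / 2 : ℝ) • a x + (1 / 2 : ℝ) • b x‖ₑ ^ p ∂μ ≤
        ENNReal.ofReal (ε + C / 2) * (∫⁻ x, ‖a x‖ₑ ^ p ∂μ + ∫⁻ x, ‖b x‖ₑ ^ p ∂μ) := by
  have hp0 : 0 < p := by linarith
  obtain ⟨C₀, h⟩ := exists_norm_sub_rpow_add_le (F := F) hp hε
  refine ⟨C₀, fun C hC hC0 a b ha hb => ?_⟩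
  have hen : ∀ y : F, ‖y‖ₑ ^ p = ENNReal.ofReal (‖y‖ ^ p) := fun y => by
    rw [← ofReal_norm, ENNReal.ofReal_rpow_of_nonneg (norm_nonneg _) hp0.le]
  have hab : AEMeasurable (fun x => ‖a x - b x‖ₑ ^ p) μ := (ha.sub hb).enorm.pow_const p
  rw [← lintegral_const_mul' _ _ ENNReal.ofReal_ne_top, ← lintegral_add_left' hab,
    ← lintegral_add_left' (ha.enorm.pow_const p), ← lintegral_const_mul' _ _ ENNReal.ofReal_ne_top]
  refine lintegral_mono fun x => ?_
  simp only [hen]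
  rw [← ENNReal.ofReal_mul hC0, ← ENNReal.ofReal_add (by positivity) (by positivity),
    ← ENNReal.ofReal_add (by positivity) (by positivity), ← ENNReal.ofReal_mul (by positivity)]
  exact ENNReal.ofReal_le_ofReal (h C hC _ _)

end UniformConvexity

theorem tendsto_eLpNorm_of_tendsto_sub {α F : Type*} [MeasurableSpace α] {μ : Measure α}
    [NormedAddCommGroup F] {P : ℝ≥0∞} (hP : 1 ≤ P) {ι : Type*} {l : Filter ι} {v : ι → α → F}
    {w : α → F} (hv : ∀ n, AEStronglyMeasurable (v n) μ) (hw : MemLp w P μ)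
    (h : Tendsto (fun n => eLpNorm (fun x => v n x - w x) P μ) l (𝓝 0)) :
    Tendsto (fun n => eLpNorm (v n) P μ) l (𝓝 (eLpNorm w P μ)) := by
  have h1 := h.add_const (eLpNorm w P μ)
  have h2 := ENNReal.Tendsto.sub (tendsto_const_nhds (x := eLpNorm w P μ)) h (Or.inl hw.2.ne)
  rw [zero_add] at h1
  rw [tsub_zero] at h2
  refine tendsto_of_tendsto_of_tendsto_of_le_of_le h2 h1 (fun n => ?_) fun n =>
    eLpNorm_le_add_of_sub hP (hv n) hw.1
  rw [tsub_le_iff_left]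
  simpa only [eLpNorm_sub_swap _ w] using eLpNorm_le_add_of_sub hP hw.1 (hv n)

section Minimisation

variable {N : ℕ} {Ω : Set (EuclideanSpace ℝ (Fin N))} {f : EuclideanSpace ℝ (Fin N) → ℝ}
  {r δ c M L : ℝ}

theorem sobolevEnergy_eq {p : ℝ} (hp : 0 < p) {u : EuclideanSpace ℝ (Fin N) → ℝ}
    {g : EuclideanSpace ℝ (Fin N) → EuclideanSpace ℝ (Fin N)} (hu : MemW1p Ω p u g) :
    sobolevEnergy Ω p u g = eLpNorm g (ENNReal.ofReal p) (volume.restrict Ω) ^ p +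
      eLpNorm u (ENNReal.ofReal p) (volume.restrict Ω) ^ p := by
  rw [sobolevEnergy, lintegral_add_left' (hu.2.1.1.enorm.pow_const p),
    eLpNorm_ofReal_rpow _ hp, eLpNorm_ofReal_rpow _ hp]

theorem sobolevEnergy_ne_top {p : ℝ} (hp : 0 < p) {u : EuclideanSpace ℝ (Fin N) → ℝ}
    {g : EuclideanSpace ℝ (Fin N) → EuclideanSpace ℝ (Fin N)} (hu : MemW1p Ω p u g) :
    sobolevEnergy Ω p u g ≠ ⊤ := by
  rw [sobolevEnergy_eq hp hu]
  exact ENNReal.add_ne_top.2 ⟨ENNReal.rpow_ne_top_of_nonneg hp.le hu.2.1.2.ne,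
    ENNReal.rpow_ne_top_of_nonneg hp.le hu.1.2.ne⟩

theorem bdryLqPow_eq {q : ℝ} (hq : 0 < q) (t : EuclideanSpace ℝ (Fin N) → ℝ) :
    bdryLqPow Ω q t = eLpNorm t (ENNReal.ofReal q) (bdryMeasure Ω) ^ q :=
  (eLpNorm_ofReal_rpow _ hq t).symm

theorem rayleighQuot_eq {p q : ℝ} (hq : 0 < q) (u t : EuclideanSpace ℝ (Fin N) → ℝ)
    (g : EuclideanSpace ℝ (Fin N) → EuclideanSpace ℝ (Fin N)) :
    rayleighQuot Ω p q u g t =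
      sobolevEnergy Ω p u g / eLpNorm t (ENNReal.ofReal q) (bdryMeasure Ω) ^ p := by
  rw [rayleighQuot, bdryLqPow_eq hq, ← ENNReal.rpow_mul, mul_div_cancel₀ _ hq.ne']

/-- The Sobolev energies of two functions and of their midpoint control the energy of the
difference. -/
theorem exists_sobolevEnergy_sub_add_le (Ω : Set (EuclideanSpace ℝ (Fin N))) {p : ℝ} (hp : 1 < p)
    {ε : ℝ} (hε : 0 < ε) :
    ∃ C : ℝ, 0 ≤ C ∧ ∀ u u' g g', MemW1p Ω p u g → MemW1p Ω p u' g' →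
      sobolevEnergy Ω p (fun x => u x - u' x) (fun x => g x - g' x) + ENNReal.ofReal C *
          sobolevEnergy Ω p (fun x => (1 / 2 : ℝ) • u x + (1 / 2 : ℝ) • u' x)
            (fun x => (1 / 2 : ℝ) • g x + (1 / 2 : ℝ) • g' x) ≤
        ENNReal.ofReal (ε + C / 2) * (sobolevEnergy Ω p u g + sobolevEnergy Ω p u' g') := by
  obtain ⟨C₁, h₁⟩ := exists_lintegral_sub_rpow_add_le (F := ℝ) (volume.restrict Ω) hp hε
  obtain ⟨C₂, h₂⟩ := exists_lintegral_sub_rpow_add_le (F := EuclideanSpace ℝ (Fin N))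
    (volume.restrict Ω) hp hε
  set C := max (max C₁ C₂) 0
  have hC : 0 ≤ C := le_max_right _ _
  refine ⟨C, hC, fun u u' g g' hu hu' => ?_⟩
  have k₁ := h₁ C ((le_max_left _ _).trans (le_max_left _ _)) hC u u' hu.1.1 hu'.1.1
  have k₂ := h₂ C ((le_max_right _ _).trans (le_max_left _ _)) hC g g' hu.2.1.1 hu'.2.1.1
  have hg := hu.2.1.1
  have hg' := hu'.2.1.1
  have hsub : AEMeasurable (fun x => ‖g x - g' x‖ₑ ^ p) (volume.restrict Ω) :=
    (hg.sub hg').enorm.pow_const p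
  have hmid : AEMeasurable (fun x => ‖(1 / 2 : ℝ) • g x + (1 / 2 : ℝ) • g' x‖ₑ ^ p)
      (volume.restrict Ω) :=
    ((hg.const_smul (1 / 2 : ℝ)).add (hg'.const_smul (1 / 2 : ℝ))).enorm.pow_const p
  simp only [sobolevEnergy]
  rw [lintegral_add_left' hsub, lintegral_add_left' hmid,
    lintegral_add_left' (hg.enorm.pow_const p), lintegral_add_left' (hg'.enorm.pow_const p)]
  refine le_trans (le_of_eq ?_) ((add_le_add k₂ k₁).trans (le_of_eq ?_))
  · ring
  · ring

end Minimisation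

section Existence

variable {N : ℕ} {Ω : Set (EuclideanSpace ℝ (Fin N))} {f : EuclideanSpace ℝ (Fin N) → ℝ}
  {r δ c M L : ℝ}

/-- `u ∈ W^{1,p}(Ω)` has weak gradient `g` and trace `t`, and `t` vanishes a.e. on `Γ`; unlike in
`MemXGamma`, membership of `u` in `W^{1,p}_0(Ω)` is not excluded. -/
def MemTraceVanishing (Ω : Set (EuclideanSpace ℝ (Fin N))) (p : ℝ)
    (Γ : Set (EuclideanSpace ℝ (Fin N))) (u : EuclideanSpace ℝ (Fin N) → ℝ)
    (g : EuclideanSpace ℝ (Fin N) → EuclideanSpace ℝ (Fin N))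
    (t : EuclideanSpace ℝ (Fin N) → ℝ) : Prop :=
  MemW1p Ω p u g ∧ IsTrace Ω p u g t ∧
    ∀ᵐ x ∂(μH[(N : ℝ) - 1] : Measure (EuclideanSpace ℝ (Fin N))), x ∈ Γ → t x = 0

theorem MemTraceVanishing.linearComb (hΩb : IsBounded Ω) {p : ℝ} (hp : 1 < p) (a b : ℝ)
    {Γ : Set (EuclideanSpace ℝ (Fin N))} {u u' t t' : EuclideanSpace ℝ (Fin N) → ℝ}
    {g g' : EuclideanSpace ℝ (Fin N) → EuclideanSpace ℝ (Fin N)}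
    (h : MemTraceVanishing Ω p Γ u g t) (h' : MemTraceVanishing Ω p Γ u' g' t') :
    MemTraceVanishing Ω p Γ (fun x => a • u x + b • u' x) (fun x => a • g x + b • g' x)
      (fun x => a • t x + b • t' x) := by
  refine ⟨memW1p_linearComb hΩb hp a b h.1 h'.1, isTrace_linearComb hp a b h.1 h'.1 h.2.1 h'.2.1,
    ?_⟩
  filter_upwards [h.2.2, h'.2.2] with x hx hx' hΓ
  simp [hx hΓ, hx' hΓ]

theorem MemXGamma.memTraceVanishing {p : ℝ} {Γ : Set (EuclideanSpace ℝ (Fin N))}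
    {u t : EuclideanSpace ℝ (Fin N) → ℝ}
    {g : EuclideanSpace ℝ (Fin N) → EuclideanSpace ℝ (Fin N)} (h : MemXGamma Ω p Γ u g t) :
    MemTraceVanishing Ω p Γ u g t :=
  ⟨h.1, h.2.2.1, h.2.2.2⟩

theorem ae_eq_zero_on_of_tendsto {Γ : Set (EuclideanSpace ℝ (Fin N))} (hΓ : Γ ⊆ frontier Ω)
    {P : ℝ≥0∞} (hP : P ≠ 0) {t : ℕ → EuclideanSpace ℝ (Fin N) → ℝ}
    {s : EuclideanSpace ℝ (Fin N) → ℝ} (ht : ∀ n, AEStronglyMeasurable (t n) (bdryMeasure Ω))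
    (hs : AEStronglyMeasurable s (bdryMeasure Ω))
    (h0 : ∀ n, ∀ᵐ x ∂(μH[(N : ℝ) - 1] : Measure (EuclideanSpace ℝ (Fin N))), x ∈ Γ → t n x = 0)
    (h : Tendsto (fun n => eLpNorm (fun x => t n x - s x) P (bdryMeasure Ω)) atTop (𝓝 0)) :
    ∀ᵐ x ∂(μH[(N : ℝ) - 1] : Measure (EuclideanSpace ℝ (Fin N))), x ∈ Γ → s x = 0 := by
  obtain ⟨ns, -, hns⟩ := (tendstoInMeasure_of_tendsto_eLpNorm hP ht hs h).exists_seq_tendsto_ae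
  have h1 := (ae_restrict_iff' isClosed_frontier.measurableSet).1 hns
  filter_upwards [h1, ae_all_iff.2 h0] with x hx hx0 hxΓ
  have h2 := hx (hΓ hxΓ)
  simp only [hx0 _ hxΓ] at h2
  exact (tendsto_nhds_unique h2 tendsto_const_nhds)

namespace IsCollar

theorem memW1p0_iff_ae_eq_zero (hC : IsCollar Ω f r δ c M L) (hΩb : IsBounded Ω) {p : ℝ} (hp : 1 < p)
    {u t : EuclideanSpace ℝ (Fin N) → ℝ}
    {g : EuclideanSpace ℝ (Fin N) → EuclideanSpace ℝ (Fin N)} (hu : MemW1p Ω p u g)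
    (ht : IsTrace Ω p u g t) : MemW1p0 Ω p u g ↔ t =ᵐ[bdryMeasure Ω] 0 :=
  ⟨fun h => hC.isTrace_unique hp hu ht (hC.isTrace_zero_of_memW1p0 h),
    fun h => hC.memW1p0_of_isTrace_of_ae_eq_zero hΩb hp hu ht h⟩

theorem traceConst_mul_le (hC : IsCollar Ω f r δ c M L) (hΩb : IsBounded Ω) {p q : ℝ} (hp : 1 < p)
    (hq : 1 ≤ q) {Γ : Set (EuclideanSpace ℝ (Fin N))}
    {u t : EuclideanSpace ℝ (Fin N) → ℝ}
    {g : EuclideanSpace ℝ (Fin N) → EuclideanSpace ℝ (Fin N)}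
    (h : MemTraceVanishing Ω p Γ u g t)
    (htq : MemLp t (ENNReal.ofReal q) (bdryMeasure Ω)) :
    traceConst Ω p q Γ * eLpNorm t (ENNReal.ofReal q) (bdryMeasure Ω) ^ p ≤
      sobolevEnergy Ω p u g := by
  have hp0 : 0 < p := by linarith
  have hq0 : 0 < q := by linarith
  rcases eq_or_ne (eLpNorm t (ENNReal.ofReal q) (bdryMeasure Ω)) 0 with h0 | h0
  · rw [h0, ENNReal.zero_rpow_of_pos hp0, mul_zero]
    exact zero_le
  · have hX : MemXGamma Ω p Γ u g t := by
      refine ⟨h.1, fun hW => h0 ?_, h.2.1, h.2.2⟩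
      rw [hC.memW1p0_iff_ae_eq_zero hΩb hp h.1 h.2.1] at hW
      rw [eLpNorm_congr_ae hW, eLpNorm_zero]
    have h1 : traceConst Ω p q Γ ≤ rayleighQuot Ω p q u g t := sInf_le ⟨u, g, t, hX, rfl⟩
    rw [rayleighQuot_eq hq0] at h1
    rw [ENNReal.le_div_iff_mul_le] at h1
    · exact h1
    · exact Or.inl (by simp [h0, htq.2.ne])
    · exact Or.inl (ENNReal.rpow_ne_top_of_nonneg hp0.le htq.2.ne)

end IsCollar

theorem sobolevEnergy_smul {p : ℝ} (hp : 0 < p) (a : ℝ)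
    (u : EuclideanSpace ℝ (Fin N) → ℝ)
    (g : EuclideanSpace ℝ (Fin N) → EuclideanSpace ℝ (Fin N)) :
    sobolevEnergy Ω p (fun x => a • u x + (0 : ℝ) • u x) (fun x => a • g x + (0 : ℝ) • g x) =
      ‖a‖ₑ ^ p * sobolevEnergy Ω p u g := by
  have ha : ‖a‖ₑ ^ p ≠ ⊤ := ENNReal.rpow_ne_top_of_nonneg hp.le enorm_ne_top
  simp only [sobolevEnergy]
  rw [← lintegral_const_mul' _ _ ha]
  congr 1
  funext x
  rw [zero_smul, zero_smul, add_zero, add_zero, enorm_smul, enorm_smul,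
    ENNReal.mul_rpow_of_nonneg _ _ hp.le, ENNReal.mul_rpow_of_nonneg _ _ hp.le, mul_add]

namespace IsCollar

/-- Every value of the Rayleigh quotient is the energy of a function with normalised trace. -/
theorem exists_normalised (hC : IsCollar Ω f r δ c M L) (hΩb : IsBounded Ω) {p q : ℝ} (hp : 1 < p)
    (hq : 1 ≤ q) {Γ : Set (EuclideanSpace ℝ (Fin N))}
    {u t : EuclideanSpace ℝ (Fin N) → ℝ}
    {g : EuclideanSpace ℝ (Fin N) → EuclideanSpace ℝ (Fin N)} (h : MemXGamma Ω p Γ u g t)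
    (htq : MemLp t (ENNReal.ofReal q) (bdryMeasure Ω)) :
    ∃ v h s, MemTraceVanishing Ω p Γ v h s ∧
      eLpNorm s (ENNReal.ofReal q) (bdryMeasure Ω) = 1 ∧
      sobolevEnergy Ω p v h = rayleighQuot Ω p q u g t := by
  have hp0 : 0 < p := by linarith
  have hq0 : 0 < q := by linarith
  have h0 : eLpNorm t (ENNReal.ofReal q) (bdryMeasure Ω) ≠ 0 := fun h0 => by
    rw [eLpNorm_eq_zero_iff htq.1 (by positivity)] at h0
    exact h.2.1 ((hC.memW1p0_iff_ae_eq_zero hΩb hp h.1 h.2.2.1).2 h0)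
  set τ := eLpNorm t (ENNReal.ofReal q) (bdryMeasure Ω)
  have hτ : τ ≠ ⊤ := htq.2.ne
  have ha : ‖(τ.toReal)⁻¹‖ₑ = τ⁻¹ := by
    rw [enorm_inv (ENNReal.toReal_ne_zero.2 ⟨h0, hτ⟩), Real.enorm_of_nonneg ENNReal.toReal_nonneg,
      ENNReal.ofReal_toReal hτ]
  refine ⟨_, _, _, h.memTraceVanishing.linearComb hΩb hp (τ.toReal)⁻¹ 0 h.memTraceVanishing, ?_, ?_⟩
  · have h1 : (fun x => (τ.toReal)⁻¹ • t x + (0 : ℝ) • t x) = (τ.toReal)⁻¹ • t := by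
      funext x
      simp
    rw [h1, eLpNorm_const_smul, ha]
    exact ENNReal.inv_mul_cancel h0 hτ
  · rw [sobolevEnergy_smul hp0, ha, rayleighQuot_eq hq0, ENNReal.inv_rpow, mul_comm]
    rfl

/-- A minimising sequence with normalised and convergent traces is a Cauchy sequence. -/
theorem tendsto_sobolevEnergy_sub (hC : IsCollar Ω f r δ c M L) (hΩb : IsBounded Ω) {p q : ℝ}
    (hp : 1 < p) (hq : 1 ≤ q) {Γ : Set (EuclideanSpace ℝ (Fin N))}
    {u t : ℕ → EuclideanSpace ℝ (Fin N) → ℝ}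
    {g : ℕ → EuclideanSpace ℝ (Fin N) → EuclideanSpace ℝ (Fin N)}
    {s : EuclideanSpace ℝ (Fin N) → ℝ}
    (h : ∀ n, MemTraceVanishing Ω p Γ (u n) (g n) (t n))
    (htq : ∀ n, MemLp (t n) (ENNReal.ofReal q) (bdryMeasure Ω))
    (hs : MemLp s (ENNReal.ofReal q) (bdryMeasure Ω))
    (hs1 : eLpNorm s (ENNReal.ofReal q) (bdryMeasure Ω) = 1)
    (hts : Tendsto (fun n => eLpNorm (fun x => t n x - s x) (ENNReal.ofReal q) (bdryMeasure Ω))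
      atTop (𝓝 0))
    (hS : traceConst Ω p q Γ ≠ ⊤)
    (hE : Tendsto (fun n => sobolevEnergy Ω p (u n) (g n)) atTop (𝓝 (traceConst Ω p q Γ))) :
    Tendsto (fun k : ℕ × ℕ => sobolevEnergy Ω p (fun x => u k.1 x - u k.2 x)
      (fun x => g k.1 x - g k.2 x)) atTop (𝓝 0) := by
  have hp0 : 0 < p := by linarith
  have hq1 := ENNReal.ofReal_one_le hq
  set S := traceConst Ω p q Γ
  have hfst : Tendsto (Prod.fst : ℕ × ℕ → ℕ) atTop atTop := by
    rw [← prod_atTop_atTop_eq]; exact tendsto_fst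
  have hsnd : Tendsto (Prod.snd : ℕ × ℕ → ℕ) atTop atTop := by
    rw [← prod_atTop_atTop_eq]; exact tendsto_snd
  have hmidq : ∀ k : ℕ × ℕ, MemLp (fun x => (1 / 2 : ℝ) • t k.1 x + (1 / 2 : ℝ) • t k.2 x)
      (ENNReal.ofReal q) (bdryMeasure Ω) := fun k =>
    ((htq k.1).const_smul (1 / 2 : ℝ)).add ((htq k.2).const_smul (1 / 2 : ℝ))
  have hτ : Tendsto (fun k : ℕ × ℕ =>
      eLpNorm (fun x => (1 / 2 : ℝ) • t k.1 x + (1 / 2 : ℝ) • t k.2 x)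
      (ENNReal.ofReal q) (bdryMeasure Ω)) atTop (𝓝 1) := by
    have h1 := tendsto_eLpNorm_add_sub hq1 (1 / 2 : ℝ) (1 / 2 : ℝ) (v := fun k : ℕ × ℕ => t k.1)
      (v' := fun k : ℕ × ℕ => t k.2) (fun k => (htq k.1).1) (fun k => (htq k.2).1) hs.1 hs.1
      (hts.comp hfst) (hts.comp hsnd)
    rw [← hs1]
    refine tendsto_eLpNorm_of_tendsto_sub hq1 (fun k => (hmidq k).1) hs (h1.congr fun k => ?_)
    congr 1
    funext x
    rw [← add_smul (1 / 2 : ℝ) (1 / 2 : ℝ) (s x)]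
    norm_num
  rw [ENNReal.tendsto_nhds_zero]
  intro η hη
  obtain ⟨ε, hε, hεη⟩ := ENNReal.exists_nnreal_pos_mul_lt
    (ENNReal.mul_ne_top ENNReal.ofNat_ne_top hS : 2 * S ≠ ⊤) hη.ne'
  obtain ⟨C, hC0, hconv⟩ := exists_sobolevEnergy_sub_add_le Ω hp (NNReal.coe_pos.2 hε)
  have hlow : Tendsto (fun k : ℕ × ℕ => ENNReal.ofReal C *
      (S * eLpNorm (fun x => (1 / 2 : ℝ) • t k.1 x + (1 / 2 : ℝ) • t k.2 x)
      (ENNReal.ofReal q) (bdryMeasure Ω) ^ p)) atTop (𝓝 (ENNReal.ofReal C * S)) := by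
    have h1 := (ENNReal.continuous_rpow_const (y := p)).tendsto 1 |>.comp hτ
    rw [ENNReal.one_rpow] at h1
    have h2 := ENNReal.Tendsto.const_mul (a := ENNReal.ofReal C)
      (ENNReal.Tendsto.const_mul (a := S) h1 (Or.inr hS)) (Or.inr ENNReal.ofReal_ne_top)
    rwa [mul_one] at h2
  have hup : Tendsto (fun k : ℕ × ℕ => ENNReal.ofReal (ε + C / 2) *
      (sobolevEnergy Ω p (u k.1) (g k.1) + sobolevEnergy Ω p (u k.2) (g k.2))) atTop
      (𝓝 (ENNReal.ofReal (ε + C / 2) * (S + S))) :=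
    ENNReal.Tendsto.const_mul ((hE.comp hfst).add (hE.comp hsnd)) (Or.inr ENNReal.ofReal_ne_top)
  have hCS : ENNReal.ofReal C * S ≠ ⊤ := ENNReal.mul_ne_top ENNReal.ofReal_ne_top hS
  have hdiff := ENNReal.Tendsto.sub hup hlow (Or.inr hCS)
  have hlim : ENNReal.ofReal (ε + C / 2) * (S + S) - ENNReal.ofReal C * S = ε * (2 * S) := by
    rw [ENNReal.ofReal_add (NNReal.coe_nonneg _) (by positivity), ← two_mul, add_mul,
      ← mul_assoc (ENNReal.ofReal (C / 2)), ← ENNReal.ofReal_ofNat 2,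
      ← ENNReal.ofReal_mul (by positivity), div_mul_cancel₀ _ (two_ne_zero),
      ENNReal.add_sub_cancel_right hCS, ENNReal.ofReal_coe_nnreal]
  rw [hlim] at hdiff
  filter_upwards [hdiff.eventually_lt_const hεη] with k hk
  refine le_trans ?_ hk.le
  have hmid := (h k.1).linearComb hΩb hp (1 / 2) (1 / 2) (h k.2)
  have h3 := hC.traceConst_mul_le hΩb hp hq hmid (hmidq k)
  have h4 := hconv _ _ _ _ (h k.1).1 (h k.2).1
  refine ENNReal.le_sub_of_add_le_right ?_
    (le_trans (add_le_add le_rfl (mul_le_mul le_rfl h3 zero_le zero_le)) h4)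
  refine ENNReal.mul_ne_top ENNReal.ofReal_ne_top (ENNReal.mul_ne_top hS ?_)
  exact ENNReal.rpow_ne_top_of_nonneg hp0.le (hmidq k).2.ne

theorem exists_rayleighQuot_eq_traceConst (hC : IsCollar Ω f r δ c M L) (hΩb : IsBounded Ω)
    {p q : ℝ} (hp : 1 < p) (hq : 1 ≤ q) (hsub : SubcriticalTrace N p q)
    {Γ : Set (EuclideanSpace ℝ (Fin N))} (hΓ : Γ ⊆ frontier Ω)
    (hne : ∃ u g t, MemXGamma Ω p Γ u g t) :
    ∃ u g t, MemXGamma Ω p Γ u g t ∧ 0 < bdryLqPow Ω q t ∧ bdryLqPow Ω q t < ⊤ ∧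
      traceConst Ω p q Γ = rayleighQuot Ω p q u g t := by
  have := hC.isFiniteMeasure
  have hp0 : 0 < p := by linarith
  have hq0 : 0 < q := by linarith
  have hp1 := ENNReal.ofReal_one_le hp.le
  have hq1 := ENNReal.ofReal_one_le hq
  have hqR : ENNReal.ofReal q ≤ ENNReal.ofReal (max p q) :=
    ENNReal.ofReal_le_ofReal (le_max_right _ _)
  have hR1 := hq1.trans hqR
  have hsubR := hsub.exponent_lt hp
  have hLq : ∀ {u g t}, MemTraceVanishing Ω p Γ u g t →
      MemLp t (ENNReal.ofReal q) (bdryMeasure Ω) := fun h =>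
    (hC.memLp_and_tendsto_of_isTrace hΩb hp (le_max_left _ _) hsubR h.1 h.2.1).1.mono_exponent hqR
  obtain ⟨ρ, hρa, hρ, hρmem⟩ := exists_seq_tendsto_sInf
    (S := {r | ∃ u g t, MemXGamma Ω p Γ u g t ∧ r = rayleighQuot Ω p q u g t})
    (by obtain ⟨u, g, t, h⟩ := hne; exact ⟨_, u, g, t, h, rfl⟩) (OrderBot.bddBelow _)
  have hex : ∀ n, ∃ v h s, MemTraceVanishing Ω p Γ v h s ∧
      eLpNorm s (ENNReal.ofReal q) (bdryMeasure Ω) = 1 ∧ sobolevEnergy Ω p v h = ρ n := fun n => by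
    obtain ⟨u, g, t, h, hr⟩ := hρmem n
    rw [hr]
    exact hC.exists_normalised hΩb hp hq h (hLq h.memTraceVanishing)
  choose u g t hA ht1 hEρ using hex
  change Tendsto ρ atTop (𝓝 (traceConst Ω p q Γ)) at hρ
  have hρt : ∀ n, ρ n ≠ ⊤ := fun n => hEρ n ▸ sobolevEnergy_ne_top hp0 (hA n).1
  have hS : traceConst Ω p q Γ ≠ ⊤ :=
    ne_top_of_le_ne_top (hρt 0) (sInf_le (hρmem 0))
  have hb : ∀ n, eLpNorm (g n) (ENNReal.ofReal p) (volume.restrict Ω) ^ p +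
      eLpNorm (u n) (ENNReal.ofReal p) (volume.restrict Ω) ^ p ≤ ρ 0 := fun n => by
    rw [← sobolevEnergy_eq hp0 (hA n).1, hEρ n]
    exact hρa (Nat.zero_le n)
  have hroot : ∀ {a b : ℝ≥0∞}, a ^ p ≤ b → a ≤ b ^ (1 / p) := fun {a b} h => by
    rw [one_div]
    exact (ENNReal.le_rpow_inv_iff hp0).2 h
  obtain ⟨ns, hns, s, hsR, htsR, htr⟩ := hC.exists_subseq_tendsto_trace hΩb hp (le_max_left _ _)
    hsubR (fun n => (hA n).1) (fun n => (hA n).2.1) (B := ρ 0 ^ (1 / p))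
    (ENNReal.rpow_ne_top_of_nonneg (by positivity) (hρt 0))
    (fun n => hroot (le_add_self.trans (hb n))) (fun n => hroot (le_self_add.trans (hb n)))
  have hs : MemLp s (ENNReal.ofReal q) (bdryMeasure Ω) := hsR.mono_exponent hqR
  have hts := tendsto_eLpNorm_of_le_exponent hqR (by positivity)
    (fun n => (hLq (hA (ns n))).1.sub hs.1) htsR
  have hs1 : eLpNorm s (ENNReal.ofReal q) (bdryMeasure Ω) = 1 := by
    have h1 := tendsto_eLpNorm_of_tendsto_sub hq1 (fun n => (hLq (hA (ns n))).1) hs hts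
    simp only [ht1] at h1
    exact tendsto_nhds_unique h1 tendsto_const_nhds
  have hE : Tendsto (fun n => sobolevEnergy Ω p (u (ns n)) (g (ns n))) atTop
      (𝓝 (traceConst Ω p q Γ)) := by
    simp only [hEρ]
    exact hρ.comp hns.tendsto_atTop
  have hcau := hC.tendsto_sobolevEnergy_sub hΩb hp hq (fun n => hA (ns n))
    (fun n => hLq (hA (ns n))) hs hs1 hts hS hE
  have hcauroot : Tendsto (fun k : ℕ × ℕ => sobolevEnergy Ω p
      (fun x => u (ns k.1) x - u (ns k.2) x) (fun x => g (ns k.1) x - g (ns k.2) x) ^ (1 / p))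
      atTop (𝓝 0) := by
    have h1 := (ENNReal.continuous_rpow_const (y := 1 / p)).tendsto 0 |>.comp hcau
    rwa [ENNReal.zero_rpow_of_pos (by positivity)] at h1
  obtain ⟨v, hv, huv⟩ := exists_eLpNorm_limit hp1 (fun n => (hA (ns n)).1.1)
    (tendsto_of_tendsto_of_tendsto_of_le_of_le tendsto_const_nhds hcauroot (fun _ => zero_le)
      fun k => hroot (by
        rw [eLpNorm_ofReal_rpow _ hp0]
        exact lintegral_mono fun x => le_add_self))
  obtain ⟨h, hh, hgh⟩ := exists_eLpNorm_limit hp1 (fun n => (hA (ns n)).1.2.1)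
    (tendsto_of_tendsto_of_tendsto_of_le_of_le tendsto_const_nhds hcauroot (fun _ => zero_le)
      fun k => hroot (by
        rw [eLpNorm_ofReal_rpow _ hp0]
        exact lintegral_mono fun x => le_self_add))
  have hW : MemW1p Ω p v h := memW1p_of_tendsto hΩb hp (fun n => (hA (ns n)).1) hv hh huv hgh
  have hT : IsTrace Ω p v h s := htr v h hW huv hgh
  have h0 := ae_eq_zero_on_of_tendsto hΓ (by positivity) (fun n => (hLq (hA (ns n))).1) hs.1
    (fun n => (hA (ns n)).2.2) hts
  have hEv : sobolevEnergy Ω p v h = traceConst Ω p q Γ := by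
    refine tendsto_nhds_unique ?_ hE
    simp only [sobolevEnergy_eq hp0 hW, sobolevEnergy_eq hp0 (hA _).1]
    exact (((ENNReal.continuous_rpow_const (y := p)).tendsto _).comp
      (tendsto_eLpNorm_of_tendsto_sub hp1 (fun n => (hA (ns n)).1.2.1.1) hh hgh)).add
      (((ENNReal.continuous_rpow_const (y := p)).tendsto _).comp
      (tendsto_eLpNorm_of_tendsto_sub hp1 (fun n => (hA (ns n)).1.1.1) hv huv))
  refine ⟨v, h, s, ⟨hW, fun hW0 => ?_, hT, h0⟩, ?_, ?_, ?_⟩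
  · rw [hC.memW1p0_iff_ae_eq_zero hΩb hp hW hT] at hW0
    rw [eLpNorm_congr_ae hW0, eLpNorm_zero] at hs1
    exact zero_ne_one hs1
  · simp [bdryLqPow_eq hq0, hs1]
  · simp [bdryLqPow_eq hq0, hs1]
  · rw [rayleighQuot_eq hq0, hs1, ENNReal.one_rpow, div_one, hEv]

end IsCollar

end Existence

section Nonempty

variable {N : ℕ} {Ω : Set (EuclideanSpace ℝ (Fin N))} {f : EuclideanSpace ℝ (Fin N) → ℝ}
  {r δ c M L : ℝ}

theorem isWeakGradient_gradient {φ : EuclideanSpace ℝ (Fin N) → ℝ} (hφ : ContDiff ℝ 1 φ) :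
    IsWeakGradient Ω φ (gradient φ) := by
  intro ψ hψ hψc hψΩ v
  have hψ1 : ContDiff ℝ 1 ψ := hψ.of_le (by exact_mod_cast le_top)
  have hdc : ∀ {χ : EuclideanSpace ℝ (Fin N) → ℝ}, ContDiff ℝ 1 χ →
      Continuous fun x => fderiv ℝ χ x v := fun hχ =>
    (hχ.continuous_fderiv one_ne_zero).clm_apply continuous_const
  have hψ0 : ∀ x, x ∉ Ω → ψ x = 0 := fun x hx =>
    image_eq_zero_of_notMem_tsupport fun h => hx (hψΩ h)
  have hdψ0 : ∀ x, x ∉ Ω → fderiv ℝ ψ x v = 0 := fun x hx => by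
    rw [fderiv_of_notMem_tsupport ℝ fun h => hx (hψΩ h)]
    rfl
  have hdψc : HasCompactSupport fun x => fderiv ℝ ψ x v := (hψc.fderiv ℝ).comp_left
    (g := fun ℓ : EuclideanSpace ℝ (Fin N) →L[ℝ] ℝ => ℓ v) rfl
  rw [setIntegral_eq_integral_of_forall_compl_eq_zero fun x hx => by rw [hdψ0 x hx, mul_zero],
    setIntegral_eq_integral_of_forall_compl_eq_zero fun x hx => by rw [hψ0 x hx, zero_mul]]
  have h1 := integral_mul_fderiv_eq_neg_fderiv_mul_of_integrable (μ := volume) (f := φ) (g := ψ)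
    (v := v) (((hdc hφ).mul hψ.continuous).integrable_of_hasCompactSupport hψc.mul_left)
    ((hφ.continuous.mul (hdc hψ1)).integrable_of_hasCompactSupport hdψc.mul_left)
    ((hφ.continuous.mul hψ.continuous).integrable_of_hasCompactSupport hψc.mul_left)
    (fun x _ => (hφ.differentiable one_ne_zero).differentiableAt)
    (fun x _ => (hψ1.differentiable one_ne_zero).differentiableAt)
  rw [h1]
  congr 2
  funext x
  rw [inner_gradient_left, mul_comm]

theorem memW1p_of_contDiff (hΩm : MeasurableSet Ω) (hΩb : IsBounded Ω) (p : ℝ)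
    {φ : EuclideanSpace ℝ (Fin N) → ℝ} (hφ : ContDiff ℝ 1 φ) : MemW1p Ω p φ (gradient φ) :=
  ⟨memLp_restrict_of_continuous hΩm hΩb hφ.continuous _,
    memLp_restrict_of_continuous hΩm hΩb (continuous_gradient hφ) _, isWeakGradient_gradient hφ⟩

theorem isTrace_of_contDiff [IsFiniteMeasure (bdryMeasure Ω)] (hΩb : IsBounded Ω) (p : ℝ)
    {φ : EuclideanSpace ℝ (Fin N) → ℝ} (hφ : ContDiff ℝ ∞ φ) : IsTrace Ω p φ (gradient φ) φ :=
  ⟨memLp_bdryMeasure_of_continuous hΩb hφ.continuous _, fun _ => φ, fun _ => hφ, by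
    simp [TendstoW1p], by simp⟩

theorem IsCollar.exists_memXGamma (hC : IsCollar Ω f r δ c M L) (hΩb : IsBounded Ω) {p : ℝ}
    (hp : 1 < p) {Γ : Set (EuclideanSpace ℝ (Fin N))}
    (hlt : μH[(N : ℝ) - 1] (closure Γ) < μH[(N : ℝ) - 1] (frontier Ω)) :
    ∃ u g t, MemXGamma Ω p Γ u g t := by
  have := hC.isFiniteMeasure
  have hpos : μH[(N : ℝ) - 1] (frontier Ω \ closure Γ) ≠ 0 := fun h => by
    have h1 := measure_le_inter_add_sdiff (μH[(N : ℝ) - 1]) (frontier Ω) (closure Γ)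
    rw [h, add_zero] at h1
    exact hlt.not_ge (h1.trans (measure_mono inter_subset_right))
  obtain ⟨x₀, hx₀, hx₀pos⟩ := exists_mem_forall_mem_nhdsWithin_pos_measure hpos
  obtain ⟨ε, hε, hball⟩ := Metric.isOpen_iff.1 isClosed_closure.isOpen_compl x₀ hx₀.2
  let φ : ContDiffBump x₀ := ⟨ε / 2, ε, half_pos hε, half_lt_self hε⟩
  have hW := memW1p_of_contDiff hC.measurableSet hΩb p (φ.contDiff (n := 1))
  have hT := isTrace_of_contDiff hΩb p φ.contDiff
  refine ⟨φ, gradient φ, φ, hW, fun hW0 => ?_, hT, Eventually.of_forall fun x hx => ?_⟩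
  · rw [hC.memW1p0_iff_ae_eq_zero hΩb hp hW hT] at hW0
    have h1 := (ae_restrict_iff' isClosed_frontier.measurableSet).1 hW0
    refine (hx₀pos _ (inter_mem_nhdsWithin _ (Metric.ball_mem_nhds x₀ hε))).ne'
      (measure_mono_null ?_ (ae_iff.1 h1))
    rintro x ⟨hx, hxb⟩ hx'
    exact (φ.pos_of_mem_ball hxb).ne' (hx' hx.1)
  · exact φ.zero_of_le_dist (not_lt.1 fun h => hball (Metric.mem_ball.2 h) (subset_closure hx))

end Nonempty

/-- **Existence of extremals for the trace constant with a boundary hole.** If `Γ ⊆ ∂Ω` is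
`H^{N-1}`-measurable and `X_Γ` is nonempty, then the infimum defining `S(Γ)` is attained; and
`X_Γ` is nonempty as soon as the closure of `Γ` does not have full measure in `∂Ω`. -/
theorem traceConst_attained {N : ℕ} (Ω : Set (EuclideanSpace ℝ (Fin N)))
    (hΩo : IsOpen Ω) (hΩb : IsBounded Ω) (hΩc : IsConnected Ω) (hΩs : HasSmoothBoundary Ω)
    (p q : ℝ) (hp : 1 < p) (hq : 1 ≤ q) (hsub : SubcriticalTrace N p q)
    (Γ : Set (EuclideanSpace ℝ (Fin N))) (hΓ : Γ ⊆ frontier Ω)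
    (hΓm : NullMeasurableSet Γ (μH[(N : ℝ) - 1])) :
    ((∃ u g t, MemXGamma Ω p Γ u g t) →
      ∃ u g t, MemXGamma Ω p Γ u g t ∧ 0 < bdryLqPow Ω q t ∧ bdryLqPow Ω q t < ⊤ ∧
        traceConst Ω p q Γ = rayleighQuot Ω p q u g t) ∧
    (μH[(N : ℝ) - 1] (closure Γ) < μH[(N : ℝ) - 1] (frontier Ω) →
      ∃ u g t, MemXGamma Ω p Γ u g t) := by
  obtain ⟨f, r, δ, c, M, L, hC⟩ := exists_isCollar hΩb hΩs
  exact ⟨hC.exists_rayleighQuot_eq_traceConst hΩb hp hq hsub hΓ, hC.exists_memXGamma hΩb hp⟩
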